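/- arXiv:1809.02015 — 2 statements merged into one kernel-verified Lean document; each statement's English description precedes it below -/
import Mathlib

section
/- Let 0 < α < 1, λ > 0, T > 0, g ∈ L²(0,T), and suppose y ∈ L²(0,T) satisfies y(t) = ∫_0^t g(s) ds − λ (I_{0+}^α y)(t) for almost every t ∈ (0,T). Then y has an absolutely continuous representative on [0,T] with y(0) = 0 and derivative y' ∈ L²(0,T), this derivative satisfies y'(t) + λ (I_{0+}^α y')(t) = g(t) for almost every t ∈ (0,T), and there is a constant C depending only on α and T such that ‖y'‖_{L²(0,T)} + λ^{1/2} ‖y‖_{H^{1−α/2}(0,T)} + λ ‖y‖_{H^{1−α}(0,T)} ≤ C ‖g‖_{L²(0,T)}. -/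
open MeasureTheory

/-- Left Riemann–Liouville fractional integral:
`(I_{0+}^γ v)(t) = (1/Γ(γ)) ∫_0^t (t-s)^(γ-1) v(s) ds`. -/
noncomputable def leftFracInt (γ : ℝ) (v : ℝ → ℝ) (t : ℝ) : ℝ :=
  (Real.Gamma γ)⁻¹ * ∫ s in (0 : ℝ)..t, (t - s) ^ (γ - 1) * v s

/-- Gagliardo seminorm `[v]_{H^s(0,T)}`. -/
noncomputable def gagliardoSemiT (T s : ℝ) (v : ℝ → ℝ) : ℝ :=
  Real.sqrt (∫ σ in Set.Ioo (0 : ℝ) T, ∫ t in Set.Ioo (0 : ℝ) T,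
    (v σ - v t) ^ 2 / |σ - t| ^ (1 + 2 * s))

/-- The `H^s(0,T)` norm `(‖v‖²_{L²(0,T)} + [v]²_{H^s(0,T)})^(1/2)`. -/
noncomputable def sobNormT (T s : ℝ) (v : ℝ → ℝ) : ℝ :=
  Real.sqrt ((∫ t in Set.Ioo (0 : ℝ) T, (v t) ^ 2) + (gagliardoSemiT T s v) ^ 2)

section Helpers
open Set Filter Topology
open scoped ENNReal


/-- one-dimensional convolution, written with the kernel first -/
noncomputable def cv (k u : ℝ → ℝ) (t : ℝ) : ℝ := ∫ a, k (t - a) * u a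

lemma schur_lintegral {M f : ℝ → ℝ≥0∞} (hM : Measurable M) (hf : Measurable f) :
    ∫⁻ p : ℝ × ℝ, f p.1 * f p.2 * M (p.1 - p.2) ≤ 2 * (∫⁻ a, f a ^ 2) * ∫⁻ x, M x := by
  have h1 : ∀ p : ℝ × ℝ, f p.1 * f p.2 * M (p.1 - p.2) ≤
      f p.1 ^ 2 * M (p.1 - p.2) + f p.2 ^ 2 * M (p.1 - p.2) := by
    intro p
    rw [← add_mul]
    gcongr
    rcases le_total (f p.1) (f p.2) with h | h
    · calc f p.1 * f p.2 ≤ f p.2 * f p.2 := by gcongr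
        _ ≤ _ := by rw [← sq]; exact le_add_self
    · calc f p.1 * f p.2 ≤ f p.1 * f p.1 := by gcongr
        _ ≤ _ := by rw [← sq]; exact le_self_add
  refine (lintegral_mono h1).trans ?_
  rw [lintegral_add_left (by fun_prop)]
  have e1 : ∫⁻ p : ℝ × ℝ, f p.1 ^ 2 * M (p.1 - p.2) = (∫⁻ a, f a ^ 2) * ∫⁻ x, M x := by
    rw [Measure.volume_eq_prod, lintegral_prod _ (by fun_prop)]
    simp only
    rw [← lintegral_mul_const _ (by fun_prop)]
    congr 1; ext a
    rw [lintegral_const_mul _ (by fun_prop), lintegral_sub_left_eq_self]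
  have e2 : ∫⁻ p : ℝ × ℝ, f p.2 ^ 2 * M (p.1 - p.2) = (∫⁻ a, f a ^ 2) * ∫⁻ x, M x := by
    rw [Measure.volume_eq_prod, lintegral_prod_symm _ (by fun_prop)]
    simp only
    rw [← lintegral_mul_const _ (by fun_prop)]
    congr 1; ext a
    rw [lintegral_const_mul _ (by fun_prop), lintegral_sub_right_eq_self]
  rw [e1, e2, mul_assoc, two_mul]

lemma TT_integrable {X : Type*} [MeasurableSpace X] {ν : Measure X} [SFinite ν]
    {Φ : X → ℝ → ℝ} (hΦ : Measurable (fun p : X × ℝ => Φ p.1 p.2)) {u : ℝ → ℝ} (hu : Measurable u)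
    (hfin : ∫⁻ p : ℝ × ℝ, ‖u p.1‖ₑ * ‖u p.2‖ₑ * ∫⁻ x, ‖Φ x p.1‖ₑ * ‖Φ x p.2‖ₑ ∂ν ≠ ∞) :
    Integrable (fun z : X × (ℝ × ℝ) => (Φ z.1 z.2.1 * u z.2.1) * (Φ z.1 z.2.2 * u z.2.2))
      (ν.prod volume) := by
  have m1 : Measurable (fun z : X × (ℝ × ℝ) => Φ z.1 z.2.1) :=
    hΦ.comp (measurable_fst.prodMk (measurable_fst.comp measurable_snd))
  have m2 : Measurable (fun z : X × (ℝ × ℝ) => Φ z.1 z.2.2) :=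
    hΦ.comp (measurable_fst.prodMk (measurable_snd.comp measurable_snd))
  refine ⟨by fun_prop, ?_⟩
  rw [hasFiniteIntegral_iff_enorm, lintegral_prod_symm _ (by fun_prop)]
  refine lt_of_le_of_lt (le_of_eq ?_) (lt_top_iff_ne_top.mpr hfin)
  congr 1; ext p
  rw [← lintegral_const_mul]
  · congr 1; ext x
    simp only [enorm_mul]; ring
  · have a1 : Measurable (fun x => Φ x p.1) := hΦ.comp (measurable_id.prodMk measurable_const)
    have a2 : Measurable (fun x => Φ x p.2) := hΦ.comp (measurable_id.prodMk measurable_const)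
    fun_prop

lemma TT_star {X : Type*} [MeasurableSpace X] {ν : Measure X} [SFinite ν]
    {Φ : X → ℝ → ℝ} (hΦ : Measurable (fun p : X × ℝ => Φ p.1 p.2)) {u : ℝ → ℝ} (hu : Measurable u)
    (hfin : ∫⁻ p : ℝ × ℝ, ‖u p.1‖ₑ * ‖u p.2‖ₑ * ∫⁻ x, ‖Φ x p.1‖ₑ * ‖Φ x p.2‖ₑ ∂ν ≠ ∞) :
    0 ≤ ∫ p : ℝ × ℝ, u p.1 * u p.2 * ∫ x, Φ x p.1 * Φ x p.2 ∂ν ∧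
    ∫⁻ x, ENNReal.ofReal ((∫ a, Φ x a * u a) ^ 2) ∂ν =
      ENNReal.ofReal (∫ p : ℝ × ℝ, u p.1 * u p.2 * ∫ x, Φ x p.1 * Φ x p.2 ∂ν) := by
  have hI := TT_integrable hΦ hu hfin
  have e1 := integral_prod _ hI
  have e2 := integral_prod_symm _ hI
  have e3 : ∀ x, ∫ p : ℝ × ℝ, (Φ x p.1 * u p.1) * (Φ x p.2 * u p.2) = (∫ a, Φ x a * u a) ^ 2 := by
    intro x
    rw [Measure.volume_eq_prod, integral_prod_mul (fun a => Φ x a * u a) (fun a => Φ x a * u a), sq]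
  have e4 : ∀ p : ℝ × ℝ, ∫ x, (Φ x p.1 * u p.1) * (Φ x p.2 * u p.2) ∂ν
      = u p.1 * u p.2 * ∫ x, Φ x p.1 * Φ x p.2 ∂ν := by
    intro p
    rw [← integral_const_mul]
    congr 1; ext x; ring
  have hI2 := hI.integral_prod_left
  simp only [e3, e4] at e1 e2 hI2
  rw [← e2, e1]
  refine ⟨integral_nonneg (fun x => sq_nonneg _), ?_⟩
  rw [ofReal_integral_eq_lintegral_ofReal hI2 (Eventually.of_forall fun x => sq_nonneg _)]

lemma ofReal_sq_eq (r : ℝ) : ENNReal.ofReal (r ^ 2) = ‖r‖ₑ ^ 2 := by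
  rw [← sq_abs, ENNReal.ofReal_pow (abs_nonneg _), Real.enorm_eq_ofReal_abs]

lemma young_fin {k : ℝ → ℝ} (hk : Measurable k) {u : ℝ → ℝ} (hu : Measurable u) :
    ∫⁻ p : ℝ × ℝ, ‖u p.1‖ₑ * ‖u p.2‖ₑ * ∫⁻ x, ‖k (x - p.1)‖ₑ * ‖k (x - p.2)‖ₑ
      ≤ 2 * (∫⁻ a, ‖u a‖ₑ ^ 2) * (∫⁻ x, ‖k x‖ₑ) ^ 2 := by
  have h := schur_lintegral (M := fun d => ∫⁻ x, ‖k x‖ₑ * ‖k (x + d)‖ₑ) (f := fun a => ‖u a‖ₑ)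
    (by fun_prop) (by fun_prop)
  have e : ∫⁻ d, ∫⁻ x, ‖k x‖ₑ * ‖k (x + d)‖ₑ = (∫⁻ x, ‖k x‖ₑ) ^ 2 := by
    rw [lintegral_lintegral_swap (by fun_prop), sq, ← lintegral_mul_const _ (by fun_prop)]
    congr 1; ext x
    rw [lintegral_const_mul _ (by fun_prop), lintegral_add_left_eq_self (fun y => ‖k y‖ₑ)]
  rw [e] at h
  refine le_trans (le_of_eq ?_) h
  congr 1; ext p
  congr 1
  rw [← lintegral_sub_right_eq_self (fun x => ‖k x‖ₑ * ‖k (x + (p.1 - p.2))‖ₑ) p.1]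
  congr 1; ext x
  rw [show x - p.1 + (p.1 - p.2) = x - p.2 by ring]

lemma young_l2 {k : ℝ → ℝ} (hk : Measurable k) {u : ℝ → ℝ} (hu : Measurable u) :
    ∫⁻ t, (∫⁻ a, ‖k (t - a) * u a‖ₑ) ^ 2 ≤ 2 * (∫⁻ a, ‖u a‖ₑ ^ 2) * (∫⁻ x, ‖k x‖ₑ) ^ 2 := by
  refine le_trans (le_of_eq ?_) (young_fin hk hu)
  have : ∀ t, (∫⁻ a, ‖k (t - a) * u a‖ₑ) ^ 2 =
      ∫⁻ p : ℝ × ℝ, ‖k (t - p.1) * u p.1‖ₑ * ‖k (t - p.2) * u p.2‖ₑ := by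
    intro t
    rw [Measure.volume_eq_prod, lintegral_prod_mul (f := fun a => ‖k (t - a) * u a‖ₑ)
      (g := fun a => ‖k (t - a) * u a‖ₑ) (by fun_prop) (by fun_prop), sq]
  simp only [this]
  rw [lintegral_lintegral_swap (by fun_prop)]
  congr 1; ext p
  rw [← lintegral_const_mul _ (by fun_prop)]
  congr 1; ext x
  simp only [enorm_mul]; ring

lemma cv_measurable {k : ℝ → ℝ} (hk : Measurable k) {u : ℝ → ℝ} (hu : Measurable u) :
    Measurable (cv k u) := by
  have : StronglyMeasurable (fun p : ℝ × ℝ => k (p.1 - p.2) * u p.2) :=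
    Measurable.stronglyMeasurable (by fun_prop)
  exact (this.integral_prod_right).measurable

lemma cv_l2 {k : ℝ → ℝ} (hk : Measurable k) {u : ℝ → ℝ} (hu : Measurable u) :
    ∫⁻ t, ‖cv k u t‖ₑ ^ 2 ≤ 2 * (∫⁻ a, ‖u a‖ₑ ^ 2) * (∫⁻ x, ‖k x‖ₑ) ^ 2 := by
  refine le_trans (lintegral_mono fun t => ?_) (young_l2 hk hu)
  gcongr
  exact enorm_integral_le_lintegral_enorm _

lemma cv_ae_integrable {k : ℝ → ℝ} (hk : Measurable k) {u : ℝ → ℝ} (hu : Measurable u)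
    (hk1 : ∫⁻ x, ‖k x‖ₑ ≠ ∞) (hu2 : ∫⁻ a, ‖u a‖ₑ ^ 2 ≠ ∞) :
    ∀ᵐ t, Integrable (fun a => k (t - a) * u a) := by
  have h := young_l2 hk hu
  have h2 : ∫⁻ t, (∫⁻ a, ‖k (t - a) * u a‖ₑ) ^ 2 ≠ ∞ := by
    refine ne_top_of_le_ne_top ?_ h
    exact ENNReal.mul_ne_top (ENNReal.mul_ne_top (by simp) hu2) (ENNReal.pow_ne_top hk1)
  filter_upwards [ae_lt_top (by fun_prop) h2] with t ht
  refine ⟨by fun_prop, ?_⟩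
  rw [hasFiniteIntegral_iff_enorm]
  by_contra hc
  rw [not_lt_top_iff.mp hc] at ht
  simp at ht


lemma gag_le {T p : ℝ} {v : ℝ → ℝ} (hv : Measurable v) {F : ℝ × ℝ → ℝ≥0∞}
    (hF : ∀ᵐ x : ℝ × ℝ ∂((volume.restrict (Ioo 0 T)).prod volume), x.2 ∈ Ioo 0 T →
      x.2 + x.1 ∈ Ioo 0 T → ENNReal.ofReal ((v (x.2 + x.1) - v x.2) ^ 2 / x.1 ^ p) ≤ F x) :
    ∫⁻ σ in Ioo 0 T, ∫⁻ t in Ioo 0 T, ENNReal.ofReal ((v σ - v t) ^ 2 / |σ - t| ^ p) ≤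
      2 * ∫⁻ x, F x ∂((volume.restrict (Ioo 0 T)).prod volume) := by
  set S := Ioo 0 T with hS
  set D : ℝ → ℝ → ℝ≥0∞ := fun σ t =>
    (if σ ∈ S ∧ t ∈ S ∧ t < σ then ENNReal.ofReal ((v σ - v t) ^ 2 / |σ - t| ^ p) else 0) with hD
  have mS : MeasurableSet S := measurableSet_Ioo
  have mset : MeasurableSet {q : ℝ × ℝ | q.1 ∈ S ∧ q.2 ∈ S ∧ q.2 < q.1} :=
    (measurable_fst mS).inter ((measurable_snd mS).inter (measurableSet_lt measurable_snd measurable_fst))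
  have mD : Measurable (fun q : ℝ × ℝ => D q.1 q.2) := by
    refine Measurable.ite mset ?_ measurable_const
    fun_prop
  have mD' : Measurable (fun q : ℝ × ℝ => D q.2 q.1) := mD.comp measurable_swap
  have h1 : ∫⁻ σ in S, ∫⁻ t in S, ENNReal.ofReal ((v σ - v t) ^ 2 / |σ - t| ^ p) ≤
      ∫⁻ σ, ∫⁻ t, (D σ t + D t σ) := by
    rw [← lintegral_indicator mS]
    refine lintegral_mono fun σ => ?_
    by_cases hσ : σ ∈ S
    · simp only [Set.indicator_of_mem hσ]
      rw [← lintegral_indicator mS]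
      refine lintegral_mono fun t => ?_
      by_cases ht : t ∈ S
      · simp only [Set.indicator_of_mem ht, hD]
        rcases lt_trichotomy t σ with h | h | h
        · rw [if_pos ⟨hσ, ht, h⟩]; exact le_self_add
        · subst h; simp
        · rw [if_pos (c := t ∈ S ∧ σ ∈ S ∧ σ < t) ⟨ht, hσ, h⟩, abs_sub_comm,
            show (v σ - v t) ^ 2 = (v t - v σ) ^ 2 by ring]
          exact le_add_self
      · simp [ht]
    · simp [hσ]
  have h2 : ∫⁻ σ, ∫⁻ t, (D σ t + D t σ) = 2 * ∫⁻ t, ∫⁻ σ, D σ t := by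
    have : ∀ σ, ∫⁻ t, (D σ t + D t σ) = (∫⁻ t, D σ t) + ∫⁻ t, D t σ := fun σ =>
      lintegral_add_left (mD.comp (measurable_const.prodMk measurable_id)) _
    simp only [this]
    rw [lintegral_add_left (Measurable.lintegral_prod_right' mD), two_mul]
    congr 1
    exact lintegral_lintegral_swap mD.aemeasurable
  have h3 : ∫⁻ t, ∫⁻ σ, D σ t = ∫⁻ h, ∫⁻ t, D (t + h) t := by
    have : ∀ t, ∫⁻ σ, D σ t = ∫⁻ h, D (t + h) t := fun t =>
      (lintegral_add_left_eq_self (fun σ => D σ t) t).symm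
    simp only [this]
    refine lintegral_lintegral_swap (Measurable.aemeasurable ?_)
    exact mD.comp (f := fun q : ℝ × ℝ => (q.1 + q.2, q.1)) (by fun_prop)
  have mD2 : Measurable (fun q : ℝ × ℝ => D (q.2 + q.1) q.2) :=
    mD.comp (f := fun q : ℝ × ℝ => (q.2 + q.1, q.2)) (by fun_prop)
  have h4 : ∫⁻ h, ∫⁻ t, D (t + h) t ≤ ∫⁻ h in S, ∫⁻ t, D (t + h) t := by
    rw [← lintegral_indicator mS]
    refine lintegral_mono fun h => ?_
    by_cases hh : h ∈ S
    · simp [hh]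
    · simp only [Set.indicator_of_notMem hh, nonpos_iff_eq_zero]
      suffices hz : ∀ t, D (t + h) t = 0 by simp only [hz, lintegral_zero]
      intro t
      simp only [hD]
      rw [if_neg]
      rintro ⟨a, b, c⟩
      apply hh
      rw [hS, mem_Ioo] at *
      constructor <;> linarith [a.1, a.2, b.1, b.2]
  have h5 : ∫⁻ h in S, ∫⁻ t, D (t + h) t = ∫⁻ x, D (x.2 + x.1) x.2 ∂((volume.restrict S).prod volume) := by
    rw [lintegral_prod _ mD2.aemeasurable]
  refine h1.trans ?_
  rw [h2, h3]
  gcongr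
  refine h4.trans ?_
  rw [h5]
  refine lintegral_mono_ae ?_
  filter_upwards [hF] with x hx
  simp only [hD]
  split_ifs with hc
  · obtain ⟨a, b, c⟩ := hc
    have : |x.2 + x.1 - x.2| = x.1 := by rw [add_sub_cancel_left, abs_of_pos (by linarith)]
    rw [this]
    exact hx b a
  · exact zero_le

lemma integral_le_of_lintegral_le {X : Type*} [MeasurableSpace X] {ν : Measure X} {f : X → ℝ} {b : ℝ}
    (hf : ∀ x, 0 ≤ f x) (hb : 0 ≤ b) (h : ∫⁻ x, ENNReal.ofReal (f x) ∂ν ≤ ENNReal.ofReal b) :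
    ∫ x, f x ∂ν ≤ b := by
  by_cases hm : AEStronglyMeasurable f ν
  · rw [integral_eq_lintegral_of_nonneg_ae (Eventually.of_forall hf) hm]
    exact ENNReal.toReal_le_of_le_ofReal hb h
  · rw [integral_non_aestronglyMeasurable hm]; exact hb

lemma gag_real {T s b : ℝ} {v : ℝ → ℝ} (hb : 0 ≤ b)
    (h : ∫⁻ σ in Ioo 0 T, ∫⁻ t in Ioo 0 T,
      ENNReal.ofReal ((v σ - v t) ^ 2 / |σ - t| ^ (1 + 2 * s)) ≤ ENNReal.ofReal b) :
    gagliardoSemiT T s v ^ 2 ≤ b := by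
  unfold gagliardoSemiT
  have pos : ∀ σ t, 0 ≤ (v σ - v t) ^ 2 / |σ - t| ^ (1 + 2 * s) := fun σ t => by positivity
  rw [Real.sq_sqrt (integral_nonneg fun σ => integral_nonneg fun t => pos σ t)]
  refine integral_le_of_lintegral_le (fun σ => integral_nonneg fun t => pos σ t) hb ?_
  refine le_trans (lintegral_mono fun σ => ?_) h
  by_cases hi : Integrable (fun t => (v σ - v t) ^ 2 / |σ - t| ^ (1 + 2 * s)) (volume.restrict (Ioo 0 T))
  · rw [ofReal_integral_eq_lintegral_ofReal hi (Eventually.of_forall (pos σ))]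
  · rw [integral_undef hi]; simp

lemma supp_integrable {T : ℝ} {u : ℝ → ℝ} (hu : Measurable u) (hs : ∀ a, a ∉ Ioo 0 T → u a = 0)
    (hu2 : ∫⁻ a, ‖u a‖ₑ ^ 2 ≠ ∞) : Integrable u := by
  refine ⟨by fun_prop, ?_⟩
  rw [hasFiniteIntegral_iff_enorm]
  have : ∀ a, ‖u a‖ₑ ≤ ‖u a‖ₑ ^ 2 + (Ioo 0 T).indicator 1 a := by
    intro a
    by_cases ha : a ∈ Ioo 0 T
    · simp only [Set.indicator_of_mem ha, Pi.one_apply]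
      rcases le_total ‖u a‖ₑ 1 with h | h
      · exact h.trans le_add_self
      · refine le_trans ?_ le_self_add
        rw [sq]; exact le_mul_of_one_le_left' h
    · simp [hs a ha]
  refine lt_of_le_of_lt (lintegral_mono this) ?_
  rw [lintegral_add_left (by fun_prop), lintegral_indicator_one measurableSet_Ioo]
  simp [lt_top_iff_ne_top, hu2]

lemma ae_ne_diag : ∀ᵐ p : ℝ × ℝ, p.1 ≠ p.2 := by
  have : MeasurableSet {p : ℝ × ℝ | p.1 = p.2} := measurableSet_eq_fun measurable_fst measurable_snd
  rw [ae_iff]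
  simp only [ne_eq, not_not]
  rw [Measure.volume_eq_prod, Measure.measure_prod_null this]
  refine Eventually.of_forall fun x => ?_
  have : (Prod.mk x ⁻¹' {p : ℝ × ℝ | p.1 = p.2}) = {x} := by ext y; simp [eq_comm]
  simp [this]

noncomputable def phiE (α : ℝ) (x : ℝ × ℝ) (a : ℝ) : ℝ :=
  if x.2 < a ∧ a < x.2 + x.1 then x.1 ^ ((α - 3) / 2) else 0

lemma phiE_meas (α : ℝ) : Measurable (fun p : (ℝ × ℝ) × ℝ => phiE α p.1 p.2) := by
  unfold phiE
  refine Measurable.ite ?_ (by fun_prop) measurable_const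
  have h1 : MeasurableSet {p : (ℝ × ℝ) × ℝ | p.1.2 < p.2} :=
    measurableSet_lt (by fun_prop) (by fun_prop)
  have h2 : MeasurableSet {p : (ℝ × ℝ) × ℝ | p.2 < p.1.2 + p.1.1} :=
    measurableSet_lt (by fun_prop) (by fun_prop)
  exact h1.inter h2

noncomputable def cE (α : ℝ) : ℝ := 1 / (1 - α) - 1 / (2 - α)

lemma cE_pos {α : ℝ} (h1 : α < 1) : 0 < cE α := by
  unfold cE
  have : 1 / (2 - α) < 1 / (1 - α) := one_div_lt_one_div_of_lt (by linarith) (by linarith)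
  linarith

lemma phiE_kernel {α : ℝ} (h1 : α < 1) {a b : ℝ} (hab : a ≠ b) :
    ∫⁻ x, ‖phiE α x a‖ₑ * ‖phiE α x b‖ₑ ∂((volume.restrict (Ioi 0)).prod volume)
      = ENNReal.ofReal (cE α * |a - b| ^ (α - 1)) := by
  set d := |a - b| with hd
  have hdpos : 0 < d := abs_pos.mpr (sub_ne_zero.mpr hab)
  have m1 : ∀ a, Measurable (fun x => phiE α x a) := fun a =>
    (phiE_meas α).comp (measurable_id.prodMk measurable_const)
  have m1a := m1 a
  have m1b := m1 b
  rw [lintegral_prod _ (by fun_prop)]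
  have e1 : ∀ h ∈ Ioi (0 : ℝ), ∫⁻ t, ‖phiE α (h, t) a‖ₑ * ‖phiE α (h, t) b‖ₑ =
      (Ioi d).indicator (fun h => ENNReal.ofReal (h ^ (α - 2) - d * h ^ (α - 3))) h := by
    intro h hh
    have hh' : 0 < h := hh
    have : ∀ t, ‖phiE α (h, t) a‖ₑ * ‖phiE α (h, t) b‖ₑ =
        (Ioo (max a b - h) (min a b)).indicator (fun _ => ENNReal.ofReal (h ^ (α - 3))) t := by
      intro t
      rw [← enorm_mul]
      unfold phiE
      by_cases hc : t ∈ Ioo (max a b - h) (min a b)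
      · rw [Set.indicator_of_mem hc]
        have c1 := lt_min_iff.mp hc.2
        have c2 := max_lt_iff.mp (sub_lt_iff_lt_add.mp hc.1)
        rw [if_pos ⟨c1.1, c2.1⟩, if_pos ⟨c1.2, c2.2⟩, ← Real.rpow_add hh',
          Real.enorm_eq_ofReal (by positivity)]
        congr 2; ring
      · rw [Set.indicator_of_notMem hc]
        by_cases q1 : t < a ∧ a < t + h
        · have q2 : ¬ (t < b ∧ b < t + h) := by
            intro q2
            exact hc ⟨sub_lt_iff_lt_add.mpr (max_lt q1.2 q2.2), lt_min q1.1 q2.1⟩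
          simp [q2]
        · simp [q1]
    simp only [this]
    rw [lintegral_indicator measurableSet_Ioo, lintegral_const, Measure.restrict_apply_univ,
      Real.volume_Ioo]
    have hm : min a b - (max a b - h) = h - d := by
      have := max_sub_min_eq_abs a b
      rw [hd, abs_sub_comm]; linarith
    rw [hm]
    by_cases hhd : h ∈ Ioi d
    · rw [Set.indicator_of_mem hhd, ← ENNReal.ofReal_mul (by positivity)]
      congr 1
      rw [show α - 2 = (α - 3) + 1 by ring, Real.rpow_add_one hh'.ne']
      ring
    · rw [Set.indicator_of_notMem hhd, ENNReal.ofReal_of_nonpos (p := h - d), mul_zero]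
      simp only [mem_Ioi, not_lt] at hhd; linarith
  rw [setLIntegral_congr_fun measurableSet_Ioi e1, lintegral_indicator measurableSet_Ioi,
    Measure.restrict_restrict measurableSet_Ioi,
    show Ioi d ∩ Ioi 0 = Ioi d from inter_eq_left.mpr (Ioi_subset_Ioi hdpos.le)]
  have i1 := integrableOn_Ioi_rpow_of_lt (a := α - 2) (by linarith) hdpos
  have i2 := integrableOn_Ioi_rpow_of_lt (a := α - 3) (by linarith) hdpos
  rw [← ofReal_integral_eq_lintegral_ofReal
    (f := fun h => h ^ (α - 2) - d * h ^ (α - 3)) (i1.sub (i2.const_mul d))]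
  · congr 1
    rw [integral_sub i1 (i2.const_mul d), integral_const_mul, integral_Ioi_rpow_of_lt (by linarith) hdpos,
      integral_Ioi_rpow_of_lt (by linarith) hdpos]
    unfold cE
    have e : d ^ (α - 1) = d ^ (α - 2) * d := by
      rw [← Real.rpow_add_one hdpos.ne']; congr 1; ring
    rw [show α - 2 + 1 = α - 1 by ring, show α - 3 + 1 = α - 2 by ring, e]
    have : (1 - α) ≠ 0 := by linarith
    have : (2 - α) ≠ 0 := by linarith
    have : (α - 1) ≠ 0 := by linarith
    have : (α - 2) ≠ 0 := by linarith
    rw [show α - 1 = -(1 - α) by ring, show α - 2 = -(2 - α) by ring]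
    field_simp
  · refine (ae_restrict_iff' measurableSet_Ioi).mpr (Eventually.of_forall fun h hh => ?_)
    have hh' : d < h := hh
    have hp : 0 < h := hdpos.trans hh'
    simp only [Pi.zero_apply]
    rw [show α - 2 = (α - 3) + 1 by ring, Real.rpow_add_one hp.ne']
    have := Real.rpow_pos_of_pos hp (α - 3)
    nlinarith


/-- truncated fractional kernel -/
noncomputable def fk (a T : ℝ) (x : ℝ) : ℝ := if 0 < x ∧ x < T then x ^ (a - 1) else 0

lemma fk_meas (a T : ℝ) : Measurable (fk a T) := by
  unfold fk
  exact Measurable.ite (measurableSet_Ioo (a := (0:ℝ)) (b := T)) (by fun_prop) measurable_const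

lemma fk_eq_indicator (a T : ℝ) : fk a T = (Ioo 0 T).indicator (fun x => x ^ (a - 1)) := by
  ext x; simp [fk, Set.indicator_apply]

lemma fk_nonneg (a T x : ℝ) : 0 ≤ fk a T x := by
  unfold fk; split_ifs with h
  · exact Real.rpow_nonneg h.1.le _
  · exact le_rfl

lemma fk_integrable {a T : ℝ} (ha : 0 < a) (hT : 0 < T) : Integrable (fk a T) := by
  rw [fk_eq_indicator, integrable_indicator_iff measurableSet_Ioo]
  have := intervalIntegral.intervalIntegrable_rpow' (a := 0) (b := T) (r := a - 1) (by linarith)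
  rw [intervalIntegrable_iff_integrableOn_Ioc_of_le hT.le] at this
  exact this.mono_set Ioo_subset_Ioc_self

lemma fk_fin {a T : ℝ} (ha : 0 < a) (hT : 0 < T) : ∫⁻ x, ‖fk a T x‖ₑ ≠ ∞ :=
  (fk_integrable ha hT).2.ne

lemma schur_fin {M u : ℝ → ℝ} (hM : Measurable M) (hMi : Integrable M) (hu : Measurable u)
    (hu2 : ∫⁻ a, ‖u a‖ₑ ^ 2 ≠ ∞) :
    ∫⁻ p : ℝ × ℝ, ‖u p.1‖ₑ * ‖u p.2‖ₑ * ‖M (p.1 - p.2)‖ₑ ≠ ∞ := by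
  refine ne_top_of_le_ne_top ?_ (schur_lintegral (M := fun x => ‖M x‖ₑ) (f := fun x => ‖u x‖ₑ)
    (by fun_prop) (by fun_prop))
  exact ENNReal.mul_ne_top (ENNReal.mul_ne_top (by simp) hu2) hMi.2.ne

lemma schur_integrable {M u : ℝ → ℝ} (hM : Measurable M) (hMi : Integrable M) (hu : Measurable u)
    (hu2 : ∫⁻ a, ‖u a‖ₑ ^ 2 ≠ ∞) :
    Integrable (fun p : ℝ × ℝ => u p.1 * u p.2 * M (p.1 - p.2)) := by
  refine ⟨by fun_prop, ?_⟩
  rw [hasFiniteIntegral_iff_enorm]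
  simp only [enorm_mul]
  exact lt_top_iff_ne_top.mpr (schur_fin hM hMi hu hu2)

/-- the energy `⟨I^α u, u⟩` -/
noncomputable def en (α T : ℝ) (u : ℝ → ℝ) : ℝ := ∫ t, u t * cv (fk α T) u t

lemma en_eq {α T : ℝ} (h0 : 0 < α) (h1 : α < 1) (hT : 0 < T) {u : ℝ → ℝ} (hu : Measurable u)
    (hs : ∀ a, a ∉ Ioo 0 T → u a = 0) (hu2 : ∫⁻ a, ‖u a‖ₑ ^ 2 ≠ ∞) :
    2 * en α T u = ∫ p : ℝ × ℝ, u p.1 * u p.2 * |p.1 - p.2| ^ (α - 1) := by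
  have hI := schur_integrable (fk_meas α T) (fk_integrable h0 hT) hu hu2
  have e1 : en α T u = ∫ p : ℝ × ℝ, u p.1 * u p.2 * fk α T (p.1 - p.2) := by
    rw [Measure.volume_eq_prod, integral_prod _ hI]
    unfold en cv
    congr 1; ext t
    rw [← integral_const_mul]
    congr 1; ext a; ring
  have hI' : Integrable (fun p : ℝ × ℝ => u p.1 * u p.2 * fk α T (p.2 - p.1)) := by
    have := hI.swap
    refine this.congr (Eventually.of_forall fun p => ?_)
    simp [mul_comm]
  have e2 : en α T u = ∫ p : ℝ × ℝ, u p.1 * u p.2 * fk α T (p.2 - p.1) := by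
    rw [e1, Measure.volume_eq_prod, ← integral_prod_swap]
    congr 1; ext p
    simp [mul_comm]
  rw [two_mul]
  nth_rewrite 1 [e1]
  rw [e2, ← integral_add hI hI']
  congr 1; ext p
  by_cases ha : p.1 ∈ Ioo 0 T
  · by_cases hb : p.2 ∈ Ioo 0 T
    · rw [← mul_add]
      congr 1
      unfold fk
      rcases lt_trichotomy p.1 p.2 with h | h | h
      · rw [if_neg (by intro hh; linarith [hh.1]), if_pos ⟨by linarith, by linarith [ha.1, hb.2]⟩,
          abs_of_neg (by linarith), zero_add, neg_sub]
      · rw [h]; simp [Real.zero_rpow (show α - 1 ≠ 0 by linarith)]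
      · rw [if_neg (c := 0 < p.2 - p.1 ∧ _) (by intro hh; linarith [hh.1]),
          if_pos ⟨by linarith, by linarith [ha.2, hb.1]⟩,
          abs_of_pos (by linarith), add_zero]
    · simp [hs _ hb]
  · simp [hs _ ha]

lemma en_key {α T : ℝ} (h0 : 0 < α) (h1 : α < 1) (hT : 0 < T) {u : ℝ → ℝ} (hu : Measurable u)
    (hs : ∀ a, a ∉ Ioo 0 T → u a = 0) (hu2 : ∫⁻ a, ‖u a‖ₑ ^ 2 ≠ ∞) :
    0 ≤ en α T u ∧
    ∫⁻ x, ENNReal.ofReal ((∫ a, phiE α x a * u a) ^ 2) ∂((volume.restrict (Ioi 0)).prod volume) =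
      ENNReal.ofReal (2 * cE α * en α T u) := by
  have hc := cE_pos h1
  have hM : Integrable (fun x => cE α * (fk α T x + fk α T (-x))) :=
    ((fk_integrable h0 hT).add (fk_integrable h0 hT).comp_neg).const_mul _
  have mM : Measurable (fun x => cE α * (fk α T x + fk α T (-x))) := by
    have := fk_meas α T
    fun_prop
  have hfin : ∫⁻ p : ℝ × ℝ, ‖u p.1‖ₑ * ‖u p.2‖ₑ * ∫⁻ x, ‖phiE α x p.1‖ₑ * ‖phiE α x p.2‖ₑ
      ∂((volume.restrict (Ioi 0)).prod volume) ≠ ∞ := by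
    refine ne_top_of_le_ne_top (schur_fin mM hM hu hu2) (lintegral_mono_ae ?_)
    filter_upwards [ae_ne_diag] with p hp
    rw [phiE_kernel h1 hp]
    by_cases ha : p.1 ∈ Ioo 0 T
    · by_cases hb : p.2 ∈ Ioo 0 T
      · gcongr
        rw [← Real.enorm_eq_ofReal (by positivity)]
        apply le_of_eq
        congr 2
        unfold fk
        rcases lt_trichotomy p.1 p.2 with h | h | h
        · rw [if_neg (by intro hh; linarith [hh.1]), if_pos ⟨by linarith, by linarith [ha.1, hb.2]⟩,
            abs_of_neg (by linarith), zero_add]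
        · exact absurd h hp
        · rw [if_neg (c := 0 < -(p.1 - p.2) ∧ _) (by intro hh; linarith [hh.1]),
            if_pos ⟨by linarith, by linarith [ha.2, hb.1]⟩,
            abs_of_pos (by linarith), add_zero]
      · simp [hs _ hb]
    · simp [hs _ ha]
  have key := TT_star (phiE_meas α) hu hfin
  have e : ∫ p : ℝ × ℝ, u p.1 * u p.2 * ∫ x, phiE α x p.1 * phiE α x p.2
      ∂((volume.restrict (Ioi 0)).prod volume) = 2 * cE α * en α T u := by
    rw [mul_comm 2, mul_assoc, en_eq h0 h1 hT hu hs hu2, ← integral_const_mul]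
    refine integral_congr_ae ?_
    filter_upwards [ae_ne_diag] with p hp
    have m1 : ∀ a, Measurable (fun x => phiE α x a) := fun a =>
      (phiE_meas α).comp (measurable_id.prodMk measurable_const)
    have m1a := m1 p.1
    have m1b := m1 p.2
    have hk := phiE_kernel h1 hp
    have : ∫ x, phiE α x p.1 * phiE α x p.2 ∂((volume.restrict (Ioi 0)).prod volume)
        = cE α * |p.1 - p.2| ^ (α - 1) := by
      have hnn : ∀ᵐ x ∂((volume.restrict (Ioi (0:ℝ))).prod (volume : Measure ℝ)),
          ∀ a, 0 ≤ phiE α x a := by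
        have : ∀ᵐ x ∂((volume.restrict (Ioi (0:ℝ))).prod (volume : Measure ℝ)), 0 < x.1 :=
          Measure.quasiMeasurePreserving_fst.ae (p := fun h => 0 < h) (ae_restrict_mem measurableSet_Ioi)
        filter_upwards [this] with x hx a
        unfold phiE; split_ifs
        · positivity
        · exact le_rfl
      rw [integral_eq_lintegral_of_nonneg_ae]
      · rw [← ENNReal.toReal_ofReal (r := cE α * |p.1 - p.2| ^ (α - 1)) (by positivity), ← hk]
        congr 1
        refine lintegral_congr_ae ?_
        filter_upwards [hnn] with x hx
        rw [ENNReal.ofReal_mul (hx _), Real.enorm_eq_ofReal (hx _), Real.enorm_eq_ofReal (hx _)]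
      · filter_upwards [hnn] with x hx
        exact mul_nonneg (hx _) (hx _)
      · fun_prop
    rw [this]; ring
  rw [e] at key
  refine ⟨?_, key.2⟩
  have := key.1
  exact nonneg_of_mul_nonneg_right this (by positivity)

lemma en_gag {α T : ℝ} (h0 : 0 < α) (h1 : α < 1) (hT : 0 < T) {u : ℝ → ℝ} (hu : Measurable u)
    (hs : ∀ a, a ∉ Ioo 0 T → u a = 0) (hu2 : ∫⁻ a, ‖u a‖ₑ ^ 2 ≠ ∞) :
    gagliardoSemiT T (1 - α / 2) (fun t => ∫ s in (0:ℝ)..t, u s) ^ 2 ≤ 4 * cE α * en α T u := by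
  obtain ⟨hn, hk⟩ := en_key h0 h1 hT hu hs hu2
  have hui := supp_integrable hu hs hu2
  have hc := cE_pos h1
  refine gag_real (by positivity) ?_
  have hcont : Continuous (fun t => ∫ s in (0:ℝ)..t, u s) :=
    intervalIntegral.continuous_primitive (fun a b => hui.intervalIntegrable) 0
  refine (gag_le (F := fun x => ENNReal.ofReal ((∫ a, phiE α x a * u a) ^ 2))
    hcont.measurable ?_).trans ?_
  · have : ∀ᵐ x ∂((volume.restrict (Ioo (0:ℝ) T)).prod (volume : Measure ℝ)), 0 < x.1 :=
      Measure.quasiMeasurePreserving_fst.ae (p := fun h => 0 < h)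
        ((ae_restrict_mem measurableSet_Ioo).mono fun h hh => hh.1)
    filter_upwards [this] with x hx _ _
    apply le_of_eq
    congr 1
    have e : ∫ a, phiE α x a * u a = x.1 ^ ((α - 3) / 2) * ∫ s in x.2..(x.2 + x.1), u s := by
      rw [intervalIntegral.integral_of_le (by linarith), integral_Ioc_eq_integral_Ioo,
        ← integral_indicator measurableSet_Ioo, ← integral_const_mul]
      congr 1; ext a
      unfold phiE
      by_cases ha : a ∈ Ioo x.2 (x.2 + x.1)
      · rw [if_pos (c := x.2 < a ∧ a < x.2 + x.1) ha, Set.indicator_of_mem ha]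
      · rw [if_neg (c := x.2 < a ∧ a < x.2 + x.1) ha, Set.indicator_of_notMem ha]; simp
    rw [e, intervalIntegral.integral_interval_sub_left hui.intervalIntegrable hui.intervalIntegrable,
      mul_pow, ← Real.rpow_natCast (x.1 ^ ((α - 3) / 2)), ← Real.rpow_mul hx.le, div_eq_mul_inv,
      ← Real.rpow_neg hx.le, mul_comm]
    congr 2
    push_cast; ring
  · rw [show 4 * cE α * en α T u = 2 * (2 * cE α * en α T u) by ring,
      ENNReal.ofReal_mul (p := 2) (by norm_num), ← hk]
    simp only [ENNReal.ofReal_ofNat]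
    gcongr
    exact fun x hx => hx.1


noncomputable def qq (κ : ℝ → ℝ) (z : ℝ) : ℝ := ∫ x, κ x * κ (x + z)

noncomputable def wt (δ z : ℝ) : ℝ := |z| ^ δ + |z| ^ (-δ)

noncomputable def f1 (δ x : ℝ) : ℝ :=
  if 0 < x then (if x ≤ 1 then x ^ (δ - 1) else x ^ (-δ - 1)) else 0

lemma f1_nonneg (δ x : ℝ) : 0 ≤ f1 δ x := by
  unfold f1
  split_ifs <;> positivity

lemma f1_meas (δ : ℝ) : Measurable (f1 δ) := by
  unfold f1
  refine Measurable.ite (measurableSet_Ioi (a := (0:ℝ))) ?_ measurable_const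
  exact Measurable.ite (measurableSet_Iic (a := (1:ℝ))) (by fun_prop) (by fun_prop)

lemma f1_integrable {δ : ℝ} (hδ : 0 < δ) : Integrable (f1 δ) := by
  have i1 : IntegrableOn (fun x : ℝ => x ^ (δ - 1)) (Ioc 0 1) := by
    have := intervalIntegral.intervalIntegrable_rpow' (a := 0) (b := 1) (r := δ - 1) (by linarith)
    rwa [intervalIntegrable_iff_integrableOn_Ioc_of_le zero_le_one] at this
  have i2 : IntegrableOn (fun x : ℝ => x ^ (-δ - 1)) (Ioi 1) :=
    integrableOn_Ioi_rpow_of_lt (by linarith) one_pos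
  have j1 := (integrable_indicator_iff measurableSet_Ioc).mpr i1
  have j2 := (integrable_indicator_iff measurableSet_Ioi).mpr i2
  refine (j1.add j2).congr (Eventually.of_forall fun x => ?_)
  simp only [Pi.add_apply, f1, Set.indicator_apply, mem_Ioc, mem_Ioi]
  by_cases h0 : 0 < x
  · by_cases h1 : x ≤ 1
    · simp [h0, h1, not_lt.mpr h1]
    · simp [h0, h1, not_le.mp h1]
  · have : ¬ (1 < x) := by linarith
    simp [h0, this]

section
variable {κ : ℝ → ℝ} {δ : ℝ}

lemma qq_even (z : ℝ) : qq κ (-z) = qq κ z := by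
  unfold qq
  rw [← integral_add_right_eq_self _ z]
  congr 1; ext x
  rw [add_neg_cancel_right, mul_comm]

lemma qq_prod_integrable (hκ : Measurable κ) (hi : Integrable κ) :
    Integrable (fun p : ℝ × ℝ => κ p.2 * κ (p.2 + p.1)) := by
  refine ⟨by fun_prop, ?_⟩
  rw [hasFiniteIntegral_iff_enorm, Measure.volume_eq_prod, lintegral_prod_symm _ (by fun_prop)]
  simp only [enorm_mul]
  have : ∀ y, ∫⁻ x, ‖κ y‖ₑ * ‖κ (y + x)‖ₑ = ‖κ y‖ₑ * ∫⁻ x, ‖κ x‖ₑ := fun y => by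
    rw [lintegral_const_mul _ (by fun_prop), lintegral_add_left_eq_self (fun y => ‖κ y‖ₑ)]
  simp only [this]
  rw [lintegral_mul_const _ (by fun_prop)]
  exact ENNReal.mul_lt_top hi.2 hi.2

lemma qq_integrable (hκ : Measurable κ) (hi : Integrable κ) : Integrable (qq κ) :=
  (qq_prod_integrable hκ hi).integral_prod_left

lemma qq_meas (hκ : Measurable κ) : Measurable (qq κ) := by
  have : StronglyMeasurable (fun p : ℝ × ℝ => κ p.2 * κ (p.2 + p.1)) :=
    Measurable.stronglyMeasurable (by fun_prop)
  exact (this.integral_prod_right).measurable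

lemma qq_integral (hκ : Measurable κ) (hi : Integrable κ) (h0 : ∫ x, κ x = 0) : ∫ z, qq κ z = 0 := by
  unfold qq
  rw [integral_integral_swap (f := fun z x => κ x * κ (x + z)) (qq_prod_integrable hκ hi)]
  have : ∀ y, ∫ x, κ y * κ (y + x) = 0 := fun y => by
    rw [integral_const_mul, integral_add_left_eq_self (fun x => κ x), h0, mul_zero]
  simp [this]

lemma qq_integral_Ioi (hκ : Measurable κ) (hi : Integrable κ) (h0 : ∫ x, κ x = 0) :
    ∫ z in Ioi 0, qq κ z = 0 := by
  have h1 := qq_integral hκ hi h0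
  have hI := qq_integrable hκ hi
  rw [← intervalIntegral.integral_Iic_add_Ioi (b := 0) hI.integrableOn hI.integrableOn] at h1
  have h2 : ∫ z in Iic 0, qq κ z = ∫ z in Ioi 0, qq κ z := by
    have := integral_comp_neg_Iic 0 (qq κ)
    simp only [qq_even, neg_zero] at this
    exact this
  linarith

lemma wt_nonneg (z : ℝ) : 0 ≤ wt δ z := by unfold wt; positivity

lemma qq_wt_integrable (hκ : Measurable κ)
    (hD : ∫⁻ z, ∫⁻ x, ‖κ x‖ₑ * ‖κ (x + z)‖ₑ * ENNReal.ofReal (wt δ z) ≠ ∞) :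
    Integrable (fun z => |qq κ z| * wt δ z) := by
  have hm := qq_meas hκ
  have hw : Measurable (wt δ) := by unfold wt; fun_prop
  refine ⟨by fun_prop, ?_⟩
  rw [hasFiniteIntegral_iff_enorm]
  refine lt_of_le_of_lt (lintegral_mono fun z => ?_) (lt_top_iff_ne_top.mpr hD)
  rw [enorm_mul, Real.enorm_eq_ofReal (wt_nonneg z), lintegral_mul_const _ (by fun_prop)]
  gcongr
  rw [Real.enorm_abs]
  refine (enorm_integral_le_lintegral_enorm _).trans ?_
  simp [enorm_mul]

/-- the primitive bound -/
lemma qq_prim (hδ : 0 < δ) (hκ : Measurable κ) (hi : Integrable κ) (h0 : ∫ x, κ x = 0)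
    (hD : ∫⁻ z, ∫⁻ x, ‖κ x‖ₑ * ‖κ (x + z)‖ₑ * ENNReal.ofReal (wt δ z) ≠ ∞) {x : ℝ} (hx : 0 < x) :
    |∫ z in Ioc 0 x, qq κ z| ≤ (∫ z, |qq κ z| * wt δ z) * (x * f1 δ x) := by
  have hI := qq_integrable hκ hi
  have hW := qq_wt_integrable hκ hD
  have gen : ∀ (s : Set ℝ) (c : ℝ), MeasurableSet s → 0 < c → (∀ z ∈ s, 1 ≤ c * wt δ z) →
      |∫ z in s, qq κ z| ≤ (∫ z, |qq κ z| * wt δ z) * c := by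
    intro s c hs hc hz
    calc |∫ z in s, qq κ z| ≤ ∫ z in s, |qq κ z| := abs_integral_le_integral_abs
      _ ≤ ∫ z in s, |qq κ z| * wt δ z * c := by
        refine setIntegral_mono_on hI.abs.integrableOn (hW.mul_const c).integrableOn hs fun z hzs => ?_
        have := hz z hzs
        have := abs_nonneg (qq κ z)
        nlinarith
      _ ≤ ∫ z, |qq κ z| * wt δ z * c := by
        refine setIntegral_le_integral (hW.mul_const c) (Eventually.of_forall fun z => ?_)
        have := wt_nonneg (δ := δ) z
        simp only [Pi.zero_apply]
        positivity
      _ = _ := integral_mul_const _ _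
  unfold f1
  rw [if_pos hx]
  split_ifs with h1
  · rw [show x * x ^ (δ - 1) = x ^ δ by
      rw [mul_comm, ← Real.rpow_add_one hx.ne']; congr 1; ring]
    refine gen _ _ measurableSet_Ioc (by positivity) fun z hz => ?_
    unfold wt
    rw [abs_of_pos hz.1]
    have : z ^ δ ≤ x ^ δ := Real.rpow_le_rpow hz.1.le hz.2 hδ.le
    have e : z ^ δ * z ^ (-δ) = 1 := by rw [← Real.rpow_add hz.1]; simp
    have p1 : 0 < z ^ δ := Real.rpow_pos_of_pos hz.1 _
    have p2 : 0 < z ^ (-δ) := Real.rpow_pos_of_pos hz.1 _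
    nlinarith [mul_le_mul_of_nonneg_right this p2.le, mul_pos (p1.trans_le this) p1]
  · rw [show x * x ^ (-δ - 1) = x ^ (-δ) by
      rw [mul_comm, ← Real.rpow_add_one hx.ne']; congr 1; ring]
    have hsplit : ∫ z in Ioc 0 x, qq κ z = - ∫ z in Ioi x, qq κ z := by
      have a := qq_integral_Ioi hκ hi h0
      rw [← Ioc_union_Ioi_eq_Ioi hx.le, setIntegral_union (by
        rw [Set.disjoint_left]; intro z hz hz'; exact absurd hz.2 (not_le.mpr hz'))
        measurableSet_Ioi hI.integrableOn hI.integrableOn] at a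
      linarith
    rw [hsplit, abs_neg]
    refine gen _ _ measurableSet_Ioi (by positivity) fun z hz => ?_
    have hz0 : 0 < z := hx.trans hz
    unfold wt
    rw [abs_of_pos hz0]
    have : x ^ δ ≤ z ^ δ := Real.rpow_le_rpow hx.le (le_of_lt hz) hδ.le
    have e : x ^ (-δ) * x ^ δ = 1 := by rw [← Real.rpow_add hx]; simp
    have p1 : 0 < x ^ (-δ) := Real.rpow_pos_of_pos hx _
    have p2 : 0 < z ^ (-δ) := Real.rpow_pos_of_pos hz0 _
    nlinarith [mul_le_mul_of_nonneg_left this p1.le, mul_pos p1 p2]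

lemma scale_cov {q : ℝ → ℝ} {ε N d : ℝ} (hε : 0 < ε) (hN : ε < N) (hd : 0 < d) :
    ∫ h in Ioo ε N, h ^ (-2 : ℝ) * q (d / h) = d⁻¹ * ∫ z in Ioo (d / N) (d / ε), q z := by
  have him : (fun h => d / h) '' (Ioo ε N) = Ioo (d / N) (d / ε) := by
    ext z
    constructor
    · rintro ⟨h, hh, rfl⟩
      have : 0 < h := hε.trans hh.1
      exact ⟨div_lt_div_of_pos_left hd this hh.2, div_lt_div_of_pos_left hd hε hh.1⟩
    · intro hz
      have hN0 := hε.trans hN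
      have hz0 : 0 < z := (div_pos hd hN0).trans hz.1
      refine ⟨d / z, ⟨?_, ?_⟩, ?_⟩
      · rw [lt_div_iff₀ hz0, mul_comm, ← lt_div_iff₀ hε]; exact hz.2
      · rw [div_lt_iff₀ hz0, mul_comm, ← div_lt_iff₀ hN0]; exact hz.1
      · field_simp
  rw [← him, integral_image_eq_integral_abs_deriv_smul (f' := fun h => -d / h ^ 2) measurableSet_Ioo,
    ← integral_const_mul]
  · refine setIntegral_congr_fun measurableSet_Ioo fun h hh => ?_
    have h0 : 0 < h := hε.trans hh.1
    simp only [smul_eq_mul]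
    rw [abs_div, abs_neg, abs_of_pos hd, abs_of_pos (by positivity : 0 < h ^ 2), Real.rpow_neg h0.le]
    norm_cast
    field_simp
  · intro h hh
    have h0 : h ≠ 0 := (hε.trans hh.1).ne'
    have := ((hasDerivAt_inv h0).const_mul d).hasDerivWithinAt (s := Ioo ε N)
    refine (this.congr_deriv ?_).congr_of_mem (fun x _ => ?_) hh
    · field_simp
    · simp [div_eq_mul_inv]
  · intro a ha b hb hab
    have ha0 : a ≠ 0 := (hε.trans ha.1).ne'
    have hb0 : b ≠ 0 := (hε.trans hb.1).ne'
    simp only at hab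
    field_simp at hab
    exact hab.symm

/-- kernel bound -/
lemma M_bound (hδ : 0 < δ) (hκ : Measurable κ) (hi : Integrable κ) (h0 : ∫ x, κ x = 0)
    (hD : ∫⁻ z, ∫⁻ x, ‖κ x‖ₑ * ‖κ (x + z)‖ₑ * ENNReal.ofReal (wt δ z) ≠ ∞)
    {ε N : ℝ} (hε : 0 < ε) (hN : ε < N) {d : ℝ} (hd : d ≠ 0) :
    |∫ h in Ioo ε N, h ^ (-2 : ℝ) * qq κ (d / h)| ≤ (∫ z, |qq κ z| * wt δ z) *
      ((ε⁻¹ * f1 δ (d / ε) + N⁻¹ * f1 δ (d / N)) + (ε⁻¹ * f1 δ (-d / ε) + N⁻¹ * f1 δ (-d / N))) := by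
  have hN0 := hε.trans hN
  have hI := qq_integrable hκ hi
  have hD0 : 0 ≤ ∫ z, |qq κ z| * wt δ z :=
    integral_nonneg fun z => mul_nonneg (abs_nonneg _) (wt_nonneg z)
  have pos : ∀ d, 0 < d → |∫ h in Ioo ε N, h ^ (-2 : ℝ) * qq κ (d / h)| ≤
      (∫ z, |qq κ z| * wt δ z) * (ε⁻¹ * f1 δ (d / ε) + N⁻¹ * f1 δ (d / N)) := by
    intro d hd
    rw [scale_cov hε hN hd, abs_mul, abs_of_pos (inv_pos.mpr hd)]
    have b1 := qq_prim hδ hκ hi h0 hD (div_pos hd hε)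
    have b2 := qq_prim hδ hκ hi h0 hD (div_pos hd hN0)
    have hlt : d / N < d / ε := div_lt_div_of_pos_left hd hε hN
    have e : ∫ z in Ioo (d / N) (d / ε), qq κ z =
        (∫ z in Ioc 0 (d / ε), qq κ z) - ∫ z in Ioc 0 (d / N), qq κ z := by
      rw [← integral_Ioc_eq_integral_Ioo, ← intervalIntegral.integral_of_le hlt.le,
        ← intervalIntegral.integral_of_le (div_pos hd hε).le,
        ← intervalIntegral.integral_of_le (div_pos hd hN0).le,
        intervalIntegral.integral_interval_sub_left hI.intervalIntegrable hI.intervalIntegrable]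
    rw [e]
    calc _ ≤ d⁻¹ * ((∫ z, |qq κ z| * wt δ z) * (d / ε * f1 δ (d / ε)) +
          (∫ z, |qq κ z| * wt δ z) * (d / N * f1 δ (d / N))) := by
          gcongr
          exact (abs_sub _ _).trans (add_le_add b1 b2)
      _ = _ := by field_simp
  have n1 := f1_nonneg δ
  rcases lt_or_gt_of_ne hd with h | h
  · have := pos (-d) (by linarith)
    simp only [neg_div, qq_even] at this ⊢
    refine this.trans ?_
    refine mul_le_mul_of_nonneg_left ?_ hD0
    have := n1 (d / ε)
    have := n1 (d / N)
    have : 0 ≤ ε⁻¹ * f1 δ (d / ε) + N⁻¹ * f1 δ (d / N) := by positivity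
    linarith
  · refine (pos d h).trans ?_
    refine mul_le_mul_of_nonneg_left ?_ hD0
    have := n1 (-d / ε)
    have := n1 (-d / N)
    have : 0 ≤ ε⁻¹ * f1 δ (-d / ε) + N⁻¹ * f1 δ (-d / N) := by positivity
    linarith
end


noncomputable def phiS (κ : ℝ → ℝ) (x : ℝ × ℝ) (a : ℝ) : ℝ :=
  x.1 ^ (-3 / 2 : ℝ) * κ ((x.2 - a) / x.1)

lemma phiS_meas {κ : ℝ → ℝ} (hκ : Measurable κ) :
    Measurable (fun p : (ℝ × ℝ) × ℝ => phiS κ p.1 p.2) := by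
  unfold phiS; fun_prop

lemma phiS_fin {κ : ℝ → ℝ} (hκ : Measurable κ) (hi : Integrable κ) {u : ℝ → ℝ} (hu : Measurable u)
    (hu2 : ∫⁻ a, ‖u a‖ₑ ^ 2 ≠ ∞) {ε N : ℝ} (hε : 0 < ε) :
    ∫⁻ p : ℝ × ℝ, ‖u p.1‖ₑ * ‖u p.2‖ₑ * ∫⁻ x, ‖phiS κ x p.1‖ₑ * ‖phiS κ x p.2‖ₑ
      ∂((volume.restrict (Ioo ε N)).prod volume) ≠ ∞ := by
  have hm := phiS_meas hκ
  have mk : ∀ a, Measurable (fun x => phiS κ x a) := fun a =>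
    hm.comp (measurable_id.prodMk measurable_const)
  have e1 : ∀ p : ℝ × ℝ, ‖u p.1‖ₑ * ‖u p.2‖ₑ * ∫⁻ x, ‖phiS κ x p.1‖ₑ * ‖phiS κ x p.2‖ₑ
      ∂((volume.restrict (Ioo ε N)).prod volume) =
      ∫⁻ h in Ioo ε N, ‖u p.1‖ₑ * ‖u p.2‖ₑ * ∫⁻ t, ‖phiS κ (h, t) p.1‖ₑ * ‖phiS κ (h, t) p.2‖ₑ := by
    intro p
    have m1 := mk p.1
    have m2 := mk p.2
    rw [lintegral_prod _ (by fun_prop), lintegral_const_mul]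
    exact Measurable.lintegral_prod_right' (f := fun x => ‖phiS κ x p.1‖ₑ * ‖phiS κ x p.2‖ₑ) (by fun_prop)
  simp only [e1]
  rw [lintegral_lintegral_swap]
  · have b : ∀ h ∈ Ioo ε N, ∫⁻ p : ℝ × ℝ, ‖u p.1‖ₑ * ‖u p.2‖ₑ *
        ∫⁻ t, ‖phiS κ (h, t) p.1‖ₑ * ‖phiS κ (h, t) p.2‖ₑ ≤
        2 * (∫⁻ a, ‖u a‖ₑ ^ 2) * ENNReal.ofReal (ε ^ (-1 / 2 : ℝ) * ∫ x, |κ x|) ^ 2 := by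
      intro h hh
      have h0 : 0 < h := hε.trans hh.1
      have := young_fin (k := fun x => h ^ (-3 / 2 : ℝ) * κ (x / h)) (by fun_prop) hu
      refine this.trans ?_
      gcongr
      have hi' : Integrable (fun x => h ^ (-3 / 2 : ℝ) * κ (x / h)) :=
        (hi.comp_div h0.ne').const_mul _
      rw [← ofReal_integral_norm_eq_lintegral_enorm hi']
      apply ENNReal.ofReal_le_ofReal
      simp only [norm_mul, Real.norm_eq_abs]
      rw [integral_const_mul, Measure.integral_comp_div (fun x => |κ x|) h, smul_eq_mul, abs_of_pos h0,
        abs_of_pos (by positivity), ← mul_assoc, ← Real.rpow_add_one h0.ne',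
        show (-3 / 2 + 1 : ℝ) = -1 / 2 by norm_num]
      have : 0 ≤ ∫ x, |κ x| := integral_nonneg fun x => abs_nonneg _
      refine mul_le_mul_of_nonneg_right ?_ this
      exact Real.rpow_le_rpow_of_nonpos hε hh.1.le (by norm_num)
    refine ne_top_of_le_ne_top ?_ (setLIntegral_mono measurable_const b)
    rw [lintegral_const]
    refine ENNReal.mul_ne_top ?_ (by simp)
    exact ENNReal.mul_ne_top (ENNReal.mul_ne_top (by simp) hu2) (ENNReal.pow_ne_top ENNReal.ofReal_ne_top)
  · have : Measurable (fun z : ((ℝ × ℝ) × ℝ) × ℝ =>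
        ‖phiS κ (z.1.2, z.2) z.1.1.1‖ₑ * ‖phiS κ (z.1.2, z.2) z.1.1.2‖ₑ) := by
      unfold phiS; fun_prop
    have m := Measurable.lintegral_prod_right' (ν := (volume : Measure ℝ)) this
    refine Measurable.aemeasurable ?_
    simp only [Function.uncurry_def]
    refine Measurable.mul (by fun_prop) m

lemma phiS_kernel {κ : ℝ → ℝ} {ε N a b : ℝ} (hε : 0 < ε)
    (hprodI : Integrable (fun x => phiS κ x a * phiS κ x b) ((volume.restrict (Ioo ε N)).prod volume)) :
    ∫ x, phiS κ x a * phiS κ x b ∂((volume.restrict (Ioo ε N)).prod volume) =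
      ∫ h in Ioo ε N, h ^ (-2 : ℝ) * qq κ ((a - b) / h) := by
  rw [integral_prod _ hprodI]
  refine setIntegral_congr_fun measurableSet_Ioo fun h hh => ?_
  have h0 : 0 < h := hε.trans hh.1
  simp only [phiS]
  have : ∀ t, h ^ (-3 / 2 : ℝ) * κ ((t - a) / h) * (h ^ (-3 / 2 : ℝ) * κ ((t - b) / h)) =
      h ^ (-3 : ℝ) * (κ ((t - a) / h) * κ ((t - a) / h + (a - b) / h)) := by
    intro t
    rw [← add_div, show t - a + (a - b) = t - b by ring, show (-3 : ℝ) = -3/2 + -3/2 by norm_num,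
      Real.rpow_add h0]
    norm_num
    ring
  simp only [this]
  rw [integral_const_mul, integral_sub_right_eq_self (fun t => κ (t / h) * κ (t / h + (a - b) / h)) a,
    Measure.integral_comp_div (fun t => κ t * κ (t + (a - b) / h)) h, smul_eq_mul, abs_of_pos h0,
    ← mul_assoc, ← Real.rpow_add_one h0.ne']
  norm_num
  left; rfl

lemma sq_fun_eps {κ : ℝ → ℝ} {δ : ℝ} (hδ : 0 < δ) (hκ : Measurable κ) (hi : Integrable κ) (h0 : ∫ x, κ x = 0)
    (hD : ∫⁻ z, ∫⁻ x, ‖κ x‖ₑ * ‖κ (x + z)‖ₑ * ENNReal.ofReal (wt δ z) ≠ ∞)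
    {u : ℝ → ℝ} (hu : Measurable u) (hu2 : ∫⁻ a, ‖u a‖ₑ ^ 2 ≠ ∞) {ε N : ℝ} (hε : 0 < ε) (hN : ε < N) :
    ∫⁻ x, ENNReal.ofReal ((∫ a, phiS κ x a * u a) ^ 2) ∂((volume.restrict (Ioo ε N)).prod volume) ≤
      2 * (∫⁻ a, ‖u a‖ₑ ^ 2) *
        ENNReal.ofReal ((∫ z, |qq κ z| * wt δ z) * (4 * ∫ x, f1 δ x)) := by
  have hN0 := hε.trans hN
  have hfin := phiS_fin hκ hi hu hu2 (N := N) hε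
  rw [(TT_star (phiS_meas hκ) hu hfin).2]
  set D := ∫ z, |qq κ z| * wt δ z with hDdef
  have hD0 : 0 ≤ D := integral_nonneg fun z => mul_nonneg (abs_nonneg _) (wt_nonneg z)
  set Mb : ℝ → ℝ := fun d => D *
      ((ε⁻¹ * f1 δ (d / ε) + N⁻¹ * f1 δ (d / N)) + (ε⁻¹ * f1 δ (-d / ε) + N⁻¹ * f1 δ (-d / N))) with hMb
  have mMb : Measurable Mb := by
    have := f1_meas δ
    fun_prop
  have Mb0 : ∀ d, 0 ≤ Mb d := fun d => by
    have := f1_nonneg δ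
    have := this (d / ε)
    have := f1_nonneg δ (d / N)
    have := f1_nonneg δ (-d / ε)
    have := f1_nonneg δ (-d / N)
    simp only [hMb]; positivity
  have hf := f1_integrable hδ
  have I1 : ∀ c, 0 < c → Integrable (fun d => c⁻¹ * f1 δ (d / c)) ∧
      ∫ d, c⁻¹ * f1 δ (d / c) = ∫ x, f1 δ x := by
    intro c hc
    refine ⟨(hf.comp_div hc.ne').const_mul _, ?_⟩
    rw [integral_const_mul, Measure.integral_comp_div (f1 δ) c, smul_eq_mul, abs_of_pos hc]
    field_simp
  have I2 : ∀ c, 0 < c → Integrable (fun d => c⁻¹ * f1 δ (-d / c)) ∧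
      ∫ d, c⁻¹ * f1 δ (-d / c) = ∫ x, f1 δ x := by
    intro c hc
    refine ⟨(I1 c hc).1.comp_neg, ?_⟩
    rw [← (I1 c hc).2, ← integral_neg_eq_self]
    simp
  have iMb : Integrable Mb :=
    (((I1 ε hε).1.add (I1 N hN0).1).add ((I2 ε hε).1.add (I2 N hN0).1)).const_mul D
  have vMb : ∫ d, Mb d = D * (4 * ∫ x, f1 δ x) := by
    simp only [hMb]
    have A : Integrable (fun d => ε⁻¹ * f1 δ (d / ε) + N⁻¹ * f1 δ (d / N)) :=
      (I1 ε hε).1.add (I1 N hN0).1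
    have B : Integrable (fun d => ε⁻¹ * f1 δ (-d / ε) + N⁻¹ * f1 δ (-d / N)) :=
      (I2 ε hε).1.add (I2 N hN0).1
    rw [integral_const_mul, integral_add A B,
      integral_add (I1 ε hε).1 (I1 N hN0).1, integral_add (I2 ε hε).1 (I2 N hN0).1, (I1 ε hε).2,
      (I1 N hN0).2, (I2 ε hε).2, (I2 N hN0).2]
    ring
  rw [← vMb, ofReal_integral_eq_lintegral_ofReal iMb (Eventually.of_forall Mb0)]
  refine le_trans ?_ (schur_lintegral (M := fun d => ENNReal.ofReal (Mb d)) (f := fun x => ‖u x‖ₑ)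
    (by fun_prop) (by fun_prop))
  refine le_trans ?_ ((enorm_integral_le_lintegral_enorm
    (fun p : ℝ × ℝ => u p.1 * u p.2 * ∫ x, phiS κ x p.1 * phiS κ x p.2
      ∂((volume.restrict (Ioo ε N)).prod volume))).trans (lintegral_mono_ae ?_))
  · rw [Real.enorm_eq_ofReal_abs]
    exact ENNReal.ofReal_le_ofReal (le_abs_self _)
  · have hae := (TT_integrable (phiS_meas hκ) hu hfin).prod_left_ae
    filter_upwards [hae, ae_ne_diag] with p hp hne
    rw [enorm_mul, enorm_mul]
    by_cases hz : u p.1 * u p.2 = 0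
    · rcases mul_eq_zero.mp hz with h | h <;> simp [h]
    · gcongr
      have hp' : Integrable (fun x => phiS κ x p.1 * phiS κ x p.2)
          ((volume.restrict (Ioo ε N)).prod volume) := by
        refine (hp.const_mul (u p.1 * u p.2)⁻¹).congr (Eventually.of_forall fun x => ?_)
        simp only
        have := mul_ne_zero_iff.mp hz
        field_simp [this.1, this.2]
      rw [phiS_kernel hε hp', Real.enorm_eq_ofReal_abs]
      exact ENNReal.ofReal_le_ofReal (M_bound hδ hκ hi h0 hD hε hN (sub_ne_zero.mpr hne))

lemma sq_fun {κ : ℝ → ℝ} {δ : ℝ} (hδ : 0 < δ) (hκ : Measurable κ) (hi : Integrable κ) (h0 : ∫ x, κ x = 0)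
    (hD : ∫⁻ z, ∫⁻ x, ‖κ x‖ₑ * ‖κ (x + z)‖ₑ * ENNReal.ofReal (wt δ z) ≠ ∞)
    {u : ℝ → ℝ} (hu : Measurable u) (hu2 : ∫⁻ a, ‖u a‖ₑ ^ 2 ≠ ∞) {N : ℝ} (hN : 0 < N) :
    ∫⁻ x, ENNReal.ofReal ((∫ a, phiS κ x a * u a) ^ 2) ∂((volume.restrict (Ioo 0 N)).prod volume) ≤
      2 * (∫⁻ a, ‖u a‖ₑ ^ 2) *
        ENNReal.ofReal ((∫ z, |qq κ z| * wt δ z) * (4 * ∫ x, f1 δ x)) := by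
  set F : ℝ × ℝ → ℝ≥0∞ := fun x => ENNReal.ofReal ((∫ a, phiS κ x a * u a) ^ 2) with hF
  have mF : Measurable F := by
    have : StronglyMeasurable (fun p : (ℝ × ℝ) × ℝ => phiS κ p.1 p.2 * u p.2) :=
      Measurable.stronglyMeasurable (by have := phiS_meas hκ; fun_prop)
    have := (this.integral_prod_right' (ν := (volume : Measure ℝ))).measurable
    fun_prop
  have hU : Ioo 0 N = ⋃ n : ℕ, Ioo (N / (n + 2)) N := by
    ext x
    simp only [mem_iUnion, mem_Ioo]
    constructor
    · rintro ⟨a, b⟩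
      obtain ⟨n, hn⟩ := exists_nat_gt (N / x)
      refine ⟨n, ?_, b⟩
      rw [div_lt_iff₀ a] at hn
      rw [div_lt_iff₀ (by positivity)]
      nlinarith
    · rintro ⟨n, a, b⟩
      exact ⟨lt_trans (by positivity) a, b⟩
  rw [lintegral_prod _ mF.aemeasurable, hU, setLIntegral_iUnion_of_directed]
  · refine iSup_le fun n => ?_
    have hn : (0:ℝ) < N / (n + 2) := by positivity
    have hn2 : N / (n + 2) < N := by
      apply div_lt_self hN
      have : (0:ℝ) ≤ n := Nat.cast_nonneg n
      linarith
    have := sq_fun_eps hδ hκ hi h0 hD hu hu2 hn hn2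
    rwa [lintegral_prod _ mF.aemeasurable] at this
  · refine Monotone.directed_le ?_
    intro n m hnm
    refine Ioo_subset_Ioo_left ?_
    have : (n : ℝ) ≤ m := by exact_mod_cast hnm
    gcongr


noncomputable def pk (s x : ℝ) : ℝ := if 0 < x then x ^ (s - 1) else 0

noncomputable def kap (s x : ℝ) : ℝ := pk s (x + 1) - pk s x

lemma pk_meas (s : ℝ) : Measurable (pk s) := by
  unfold pk
  exact Measurable.ite (measurableSet_Ioi (a := (0:ℝ))) (by fun_prop) measurable_const

lemma kap_meas (s : ℝ) : Measurable (kap s) := by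
  have := pk_meas s
  unfold kap; fun_prop

lemma pk_nonneg (s x : ℝ) : 0 ≤ pk s x := by
  unfold pk; split_ifs <;> positivity

lemma f1_mono {δ ρ : ℝ} (h : δ ≤ ρ) (x : ℝ) : f1 ρ x ≤ f1 δ x := by
  unfold f1
  split_ifs with h0 h1
  · exact Real.rpow_le_rpow_of_exponent_ge h0 h1 (by linarith)
  · exact Real.rpow_le_rpow_of_exponent_le (by linarith) (by linarith)
  · exact le_rfl

lemma pk_le_f1 {s ρ : ℝ} (h : ρ ≤ s) {x : ℝ} (hx : x ≤ 1) : pk s x ≤ f1 ρ x := by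
  unfold pk f1
  split_ifs with h0
  · exact Real.rpow_le_rpow_of_exponent_ge h0 hx (by linarith)
  · exact le_rfl

lemma pk_anti {s : ℝ} (h1 : s < 1) {x y : ℝ} (hx : 0 < x) (h : x ≤ y) : pk s y ≤ pk s x := by
  unfold pk
  rw [if_pos hx, if_pos (hx.trans_le h)]
  exact Real.rpow_le_rpow_of_nonpos hx h (by linarith)

lemma kap_bound {s ρ : ℝ} (h0 : 0 < s) (h1 : s < 1) (hρ : ρ ≤ s) (hρ' : ρ ≤ 1 - s) (x : ℝ) :
    |kap s x| ≤ f1 ρ x + f1 ρ (x + 1) := by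
  have n1 := f1_nonneg ρ x
  have n2 := f1_nonneg ρ (x + 1)
  have p1 := pk_nonneg s x
  have p2 := pk_nonneg s (x + 1)
  unfold kap
  rcases le_or_gt x 0 with hx | hx
  · have : pk s x = 0 := by unfold pk; rw [if_neg (by linarith)]
    rw [this, sub_zero, abs_of_nonneg p2]
    linarith [pk_le_f1 hρ (x := x + 1) (by linarith)]
  · have ha := pk_anti h1 hx (show x ≤ x + 1 by linarith)
    rw [abs_of_nonpos (by linarith)]
    rcases le_or_gt x 1 with hx1 | hx1
    · linarith [pk_le_f1 hρ hx1]
    · have : pk s x - pk s (x + 1) ≤ f1 ρ x := by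
        unfold pk f1
        rw [if_pos hx, if_pos (by linarith), if_pos hx, if_neg (by linarith)]
        have e1 : x ^ (s - 1) * (x / (x + 1)) ≤ (x + 1) ^ (s - 1) := by
          have hr : x / (x + 1) ≤ (x / (x + 1)) ^ (1 - s) := by
            conv_lhs => rw [← Real.rpow_one (x / (x + 1))]
            exact Real.rpow_le_rpow_of_exponent_ge (by positivity)
              ((div_le_one (by linarith)).mpr (by linarith)) (by linarith)
          rw [Real.div_rpow hx.le (by linarith)] at hr
          calc x ^ (s - 1) * (x / (x + 1)) ≤ x ^ (s - 1) * (x ^ (1 - s) / (x + 1) ^ (1 - s)) := by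
                gcongr
            _ = (x + 1) ^ (s - 1) := by
                rw [mul_div_assoc', ← Real.rpow_add hx, show s - 1 = -(1 - s) by ring,
                  Real.rpow_neg (by linarith)]
                simp
        have e2 : x ^ (s - 1) * (1 / (x + 1)) ≤ x ^ (-ρ - 1) := by
          calc x ^ (s - 1) * (1 / (x + 1)) ≤ x ^ (s - 1) * (1 / x) := by
                gcongr; linarith
            _ = x ^ (s - 2) := by
                rw [one_div, ← Real.rpow_neg_one, ← Real.rpow_add hx]; congr 1; ring
            _ ≤ _ := Real.rpow_le_rpow_of_exponent_le hx1.le (by linarith)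
        have e3 : x ^ (s - 1) = x ^ (s - 1) * (x / (x + 1)) + x ^ (s - 1) * (1 / (x + 1)) := by
          field_simp
        linarith
      linarith

lemma kap_integrable {s : ℝ} (h0 : 0 < s) (h1 : s < 1) : Integrable (kap s) := by
  have hf := f1_integrable (δ := min s (1 - s)) (lt_min h0 (by linarith))
  refine (hf.add (hf.comp_add_right 1)).mono' (kap_meas s).aestronglyMeasurable
    (Eventually.of_forall fun x => ?_)
  exact kap_bound h0 h1 (min_le_left _ _) (min_le_right _ _) x

lemma pk_ii {s : ℝ} (h0 : 0 < s) (a b : ℝ) : IntervalIntegrable (pk s) volume a b := by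
  refine (intervalIntegral.intervalIntegrable_rpow' (r := s - 1) (by linarith)).mono_fun
    (pk_meas s).aestronglyMeasurable (Eventually.of_forall fun x => ?_)
  beta_reduce
  unfold pk
  split_ifs <;> simp

lemma kap_integral {s : ℝ} (h0 : 0 < s) (h1 : s < 1) : ∫ x, kap s x = 0 := by
  have t1 := intervalIntegral_tendsto_integral (kap_integrable h0 h1)
    (tendsto_neg_atTop_atBot (G := ℝ)) tendsto_id
  refine tendsto_nhds_unique t1 ?_
  have t2 : Tendsto (fun N : ℝ => N ^ (s - 1)) atTop (𝓝 0) := by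
    have := tendsto_rpow_neg_atTop (y := 1 - s) (by linarith)
    simpa using this
  refine squeeze_zero' (g := fun N : ℝ => N ^ (s - 1)) ?_ ?_ t2
  all_goals
    filter_upwards [eventually_ge_atTop (1 : ℝ)] with N hN
    have e : ∫ x in (-N)..N, kap s x = ∫ x in N..(N + 1), pk s x := by
      unfold kap
      have hc : IntervalIntegrable (fun x => pk s (x + 1)) volume (-N) N := by
        have := (pk_ii h0 (-N + 1) (N + 1)).comp_add_right 1
        simpa using this
      rw [intervalIntegral.integral_sub hc (pk_ii h0 _ _),
        intervalIntegral.integral_comp_add_right (fun x => pk s x) 1,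
        intervalIntegral.integral_interval_sub_interval_comm (pk_ii h0 _ _) (pk_ii h0 _ _) (pk_ii h0 _ _)]
      have z : ∫ x in (-N + 1)..(-N), pk s x = 0 := by
        rw [intervalIntegral.integral_symm, intervalIntegral.integral_of_le (by linarith), neg_eq_zero]
        refine setIntegral_eq_zero_of_forall_eq_zero fun x hx => ?_
        unfold pk
        rw [if_neg]
        linarith [hx.2]
      rw [z, zero_sub, ← intervalIntegral.integral_symm]
    simp only [id]
    rw [e]
  · exact intervalIntegral.integral_nonneg (by linarith) fun x _ => pk_nonneg s x
  · have := intervalIntegral.integral_mono_on (a := N) (b := N + 1) (by linarith) (pk_ii h0 _ _)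
      (intervalIntegrable_const (c := N ^ (s - 1))) (fun x hx => by
        have := pk_anti h1 (show 0 < N by linarith) hx.1
        refine this.trans (le_of_eq ?_)
        unfold pk; rw [if_pos (by linarith)])
    simpa using this

lemma f1_wt {δ : ℝ} (hδ : 0 < δ) (hδ1 : δ ≤ 1 / 2) {p q z : ℝ} (hz : |q - p - z| ≤ 1) :
    f1 (2 * δ) p * f1 (2 * δ) q * wt δ z ≤
      5 * (f1 δ p * f1 δ q) + f1 δ p * (f1 δ z + f1 δ (-z)) := by
  have np := f1_nonneg δ p
  have nq := f1_nonneg δ q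
  have nz := f1_nonneg δ z
  have nz' := f1_nonneg δ (-z)
  have np2 := f1_nonneg (2 * δ) p
  have nq2 := f1_nonneg (2 * δ) q
  have mp := f1_mono (show δ ≤ 2 * δ by linarith) p
  have mq := f1_mono (show δ ≤ 2 * δ by linarith) q
  rcases le_or_gt p 0 with hp | hp
  · have : f1 (2 * δ) p = 0 := by unfold f1; rw [if_neg (by linarith)]
    rw [this]; simp only [zero_mul]; positivity
  rcases le_or_gt q 0 with hq | hq
  · have : f1 (2 * δ) q = 0 := by unfold f1; rw [if_neg (by linarith)]
    rw [this]; simp only [zero_mul, mul_zero]; positivity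
  have A : |z| ^ δ ≤ p ^ δ + q ^ δ + 1 := by
    have h1 : |z| ≤ p + q + 1 := by
      rw [abs_le] at hz ⊢
      constructor <;> linarith [hz.1, hz.2]
    calc |z| ^ δ ≤ (p + q + 1) ^ δ := Real.rpow_le_rpow (abs_nonneg _) h1 hδ.le
      _ ≤ (p + q) ^ δ + 1 ^ δ := Real.rpow_add_le_add_rpow (by linarith) zero_le_one hδ.le (by linarith)
      _ ≤ p ^ δ + q ^ δ + 1 := by
        rw [Real.one_rpow]
        gcongr
        exact Real.rpow_add_le_add_rpow hp.le hq.le hδ.le (by linarith)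
  have B : ∀ x, 0 < x → f1 (2 * δ) x * x ^ δ ≤ f1 δ x := by
    intro x hx
    unfold f1
    rw [if_pos hx, if_pos hx]
    split_ifs with h
    · rw [← Real.rpow_add hx]
      exact Real.rpow_le_rpow_of_exponent_ge hx h (by linarith)
    · rw [← Real.rpow_add hx]
      apply le_of_eq; congr 1; ring
  have Bp := B p hp
  have Bq := B q hq
  have C : f1 (2 * δ) q * |z| ^ (-δ) ≤ 2 * f1 δ q + (f1 δ z + f1 δ (-z)) := by
    rcases eq_or_ne z 0 with h0 | h0
    · rw [h0, abs_zero, Real.zero_rpow (by linarith)]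
      have := f1_nonneg δ 0
      simp only [mul_zero, neg_zero]; linarith
    have hz0 : 0 < |z| := abs_pos.mpr h0
    rcases le_or_gt 1 |z| with h1 | h1
    · have : |z| ^ (-δ) ≤ 1 := Real.rpow_le_one_of_one_le_of_nonpos h1 (by linarith)
      nlinarith [mul_le_mul_of_nonneg_left this nq2]
    · rcases le_or_gt q |z| with hqz | hqz
      · have a1 : |z| ^ (-δ) ≤ q ^ (-δ) := Real.rpow_le_rpow_of_nonpos hq hqz (by linarith)
        have a2 : f1 (2 * δ) q * q ^ (-δ) = f1 δ q := by
          unfold f1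
          rw [if_pos hq, if_pos hq, if_pos (by linarith), if_pos (by linarith), ← Real.rpow_add hq]
          congr 1; ring
        nlinarith [mul_le_mul_of_nonneg_left a1 nq2]
      · have a1 : f1 (2 * δ) q ≤ |z| ^ (2 * δ - 1) := by
          unfold f1
          rw [if_pos hq]
          split_ifs with h
          · exact Real.rpow_le_rpow_of_nonpos hz0 hqz.le (by linarith)
          · calc q ^ (-(2 * δ) - 1) ≤ 1 :=
                  Real.rpow_le_one_of_one_le_of_nonpos (by linarith) (by linarith)
              _ ≤ _ := Real.one_le_rpow_of_pos_of_le_one_of_nonpos hz0 h1.le (by linarith)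
        have a2 : |z| ^ (2 * δ - 1) * |z| ^ (-δ) = f1 δ |z| := by
          unfold f1
          rw [if_pos hz0, if_pos h1.le, ← Real.rpow_add hz0]
          congr 1; ring
        have a3 : f1 δ |z| ≤ f1 δ z + f1 δ (-z) := by
          rcases abs_choice z with h | h <;> rw [h] <;> linarith
        have := mul_le_mul_of_nonneg_right a1 (Real.rpow_nonneg hz0.le (-δ))
        linarith
  unfold wt
  have A' : f1 (2 * δ) p * f1 (2 * δ) q * |z| ^ δ ≤ 3 * (f1 δ p * f1 δ q) := by
    calc f1 (2 * δ) p * f1 (2 * δ) q * |z| ^ δ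
        ≤ f1 (2 * δ) p * f1 (2 * δ) q * (p ^ δ + q ^ δ + 1) := by gcongr
      _ = (f1 (2 * δ) p * p ^ δ) * f1 (2 * δ) q + f1 (2 * δ) p * (f1 (2 * δ) q * q ^ δ)
          + f1 (2 * δ) p * f1 (2 * δ) q := by ring
      _ ≤ f1 δ p * f1 δ q + f1 δ p * f1 δ q + f1 δ p * f1 δ q := by gcongr
      _ = _ := by ring
  have C' : f1 (2 * δ) p * (f1 (2 * δ) q * |z| ^ (-δ)) ≤
      f1 δ p * (2 * f1 δ q + (f1 δ z + f1 δ (-z))) := by gcongr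
  linarith

lemma kap_D {s δ : ℝ} (h0 : 0 < s) (h1 : s < 1) (hδ : 0 < δ) (hδs : 2 * δ ≤ s) (hδs' : 2 * δ ≤ 1 - s) :
    ∫⁻ z, ∫⁻ x, ‖kap s x‖ₑ * ‖kap s (x + z)‖ₑ * ENNReal.ofReal (wt δ z) ≠ ∞ := by
  set G : ℝ → ℝ := fun x => f1 δ x + f1 δ (x + 1) with hG
  set Z : ℝ → ℝ := fun x => f1 δ x + f1 δ (-x) with hZ
  have hf := f1_integrable hδ
  have iG : Integrable G := hf.add (hf.comp_add_right 1)
  have iZ : Integrable Z := hf.add hf.comp_neg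
  have mf := f1_meas δ
  have mG : Measurable G := by fun_prop
  have mZ : Measurable Z := by fun_prop
  have G0 : ∀ x, 0 ≤ G x := fun x => add_nonneg (f1_nonneg _ _) (f1_nonneg _ _)
  have Z0 : ∀ x, 0 ≤ Z x := fun x => add_nonneg (f1_nonneg _ _) (f1_nonneg _ _)
  have pw : ∀ z x, ‖kap s x‖ₑ * ‖kap s (x + z)‖ₑ * ENNReal.ofReal (wt δ z) ≤
      5 * (‖G x‖ₑ * ‖G (x + z)‖ₑ) + 2 * (‖G x‖ₑ * ‖Z z‖ₑ) := by
    intro z x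
    have b1 := kap_bound h0 h1 hδs hδs' x
    have b2 := kap_bound h0 h1 hδs hδs' (x + z)
    have w0 := wt_nonneg (δ := δ) z
    rw [Real.enorm_eq_ofReal_abs, Real.enorm_eq_ofReal_abs, Real.enorm_eq_ofReal (G0 _),
      Real.enorm_eq_ofReal (G0 _), Real.enorm_eq_ofReal (Z0 _), ← ENNReal.ofReal_mul (abs_nonneg _),
      ← ENNReal.ofReal_mul (by positivity), ← ENNReal.ofReal_mul (G0 _), ← ENNReal.ofReal_mul (G0 _),
      show (5 : ℝ≥0∞) = ENNReal.ofReal 5 by simp, show (2 : ℝ≥0∞) = ENNReal.ofReal 2 by simp,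
      ← ENNReal.ofReal_mul (by norm_num), ← ENNReal.ofReal_mul (by norm_num),
      ← ENNReal.ofReal_add (by have := G0 x; have := G0 (x + z); positivity)
        (by have := G0 x; have := Z0 z; positivity)]
    apply ENNReal.ofReal_le_ofReal
    have hd : δ ≤ 1 / 2 := by linarith
    have c1 := f1_wt hδ hd (p := x) (q := x + z) (z := z) (by norm_num)
    have c2 := f1_wt hδ hd (p := x) (q := x + z + 1) (z := z)
      (by rw [show x + z + 1 - x - z = 1 by ring]; norm_num)
    have c3 := f1_wt hδ hd (p := x + 1) (q := x + z) (z := z)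
      (by rw [show x + z - (x + 1) - z = -1 by ring]; norm_num)
    have c4 := f1_wt hδ hd (p := x + 1) (q := x + z + 1) (z := z)
      (by rw [show x + z + 1 - (x + 1) - z = 0 by ring]; norm_num)
    have n1 := f1_nonneg (2 * δ) x
    have n2 := f1_nonneg (2 * δ) (x + 1)
    calc |kap s x| * |kap s (x + z)| * wt δ z ≤ (f1 (2 * δ) x + f1 (2 * δ) (x + 1)) *
          (f1 (2 * δ) (x + z) + f1 (2 * δ) (x + z + 1)) * wt δ z := by gcongr
      _ ≤ _ := by
        simp only [hG, hZ]
        linarith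
  refine ne_top_of_le_ne_top ?_ (lintegral_mono fun z => lintegral_mono fun x => pw z x)
  have e : ∀ z, ∫⁻ x, (5 * (‖G x‖ₑ * ‖G (x + z)‖ₑ) + 2 * (‖G x‖ₑ * ‖Z z‖ₑ)) =
      5 * (∫⁻ x, ‖G x‖ₑ * ‖G (x + z)‖ₑ) + 2 * ((∫⁻ x, ‖G x‖ₑ) * ‖Z z‖ₑ) := by
    intro z
    rw [lintegral_add_left (by fun_prop), lintegral_const_mul _ (by fun_prop),
      lintegral_const_mul _ (by fun_prop), lintegral_mul_const _ (by fun_prop)]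
  simp only [e]
  have mm : Measurable (fun z => ∫⁻ x, ‖G x‖ₑ * ‖G (x + z)‖ₑ) :=
    Measurable.lintegral_prod_right' (f := fun p : ℝ × ℝ => ‖G p.2‖ₑ * ‖G (p.2 + p.1)‖ₑ) (by fun_prop)
  rw [lintegral_add_left (by fun_prop), lintegral_const_mul _ (by fun_prop),
    lintegral_const_mul _ (by fun_prop), lintegral_const_mul _ (by fun_prop),
    lintegral_lintegral_swap (by fun_prop)]
  have e2 : ∀ y, ∫⁻ x, ‖G y‖ₑ * ‖G (y + x)‖ₑ = ‖G y‖ₑ * ∫⁻ x, ‖G x‖ₑ := fun y => by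
    rw [lintegral_const_mul _ (by fun_prop), lintegral_add_left_eq_self (fun y => ‖G y‖ₑ)]
  simp only [e2]
  rw [lintegral_mul_const _ (by fun_prop)]
  have f1 := iG.2.ne
  have f2 := iZ.2.ne
  refine ENNReal.add_ne_top.mpr ⟨ENNReal.mul_ne_top (by simp) (ENNReal.mul_ne_top f1 f1),
    ENNReal.mul_ne_top (by simp) (ENNReal.mul_ne_top f1 f2)⟩


lemma pk_scale {s h y : ℝ} (hh : 0 < h) : pk s (h * y) = h ^ (s - 1) * pk s y := by
  unfold pk
  by_cases hy : 0 < y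
  · rw [if_pos (mul_pos hh hy), if_pos hy, Real.mul_rpow hh.le hy.le]
  · rw [if_neg (by rw [mul_pos_iff_of_pos_left hh]; exact hy), if_neg hy, mul_zero]

/-- Gagliardo bound for the fractional integral -/
lemma frac_gag {s T : ℝ} (h0 : 0 < s) (h1 : s < 1) (hT : 0 < T) :
    ∃ C : ℝ, 0 ≤ C ∧ ∀ w : ℝ → ℝ, Measurable w → (∀ a, a ∉ Ioo 0 T → w a = 0) →
      Integrable (fun a => w a ^ 2) → ∀ v : ℝ → ℝ, Measurable v →
      (∀ᵐ t, t ∈ Ioo 0 T → v t = cv (fk s T) w t) →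
      gagliardoSemiT T s v ^ 2 ≤ C * ∫ a, w a ^ 2 := by
  set δ := min s (1 - s) / 2 with hδ
  have hδ0 : 0 < δ := by have : 0 < min s (1 - s) := lt_min h0 (by linarith); positivity
  have hδs : 2 * δ ≤ s := by rw [hδ]; linarith [min_le_left s (1 - s)]
  have hδs' : 2 * δ ≤ 1 - s := by rw [hδ]; linarith [min_le_right s (1 - s)]
  set K := (∫ z, |qq (kap s) z| * wt δ z) * (4 * ∫ x, f1 δ x) with hK
  have K0 : 0 ≤ K := by
    have a : 0 ≤ ∫ z, |qq (kap s) z| * wt δ z :=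
      integral_nonneg fun z => mul_nonneg (abs_nonneg _) (wt_nonneg z)
    have b : 0 ≤ ∫ x, f1 δ x := integral_nonneg (f1_nonneg δ)
    positivity
  refine ⟨4 * K, by positivity, fun w hw hs hw2 v hv hvw => ?_⟩
  have w2 : ∫⁻ a, ‖w a‖ₑ ^ 2 = ENNReal.ofReal (∫ a, w a ^ 2) := by
    rw [ofReal_integral_eq_lintegral_ofReal hw2 (Eventually.of_forall fun a => sq_nonneg _)]
    simp only [ofReal_sq_eq]
  have w2f : ∫⁻ a, ‖w a‖ₑ ^ 2 ≠ ∞ := by rw [w2]; exact ENNReal.ofReal_ne_top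
  have W0 : 0 ≤ ∫ a, w a ^ 2 := integral_nonneg fun a => sq_nonneg _
  refine gag_real (by positivity) ?_
  refine (gag_le (F := fun x => ENNReal.ofReal ((∫ a, phiS (kap s) x a * w a) ^ 2)) hv ?_).trans ?_
  · have good : ∀ᵐ t, (t ∈ Ioo 0 T → v t = cv (fk s T) w t) ∧
        Integrable (fun a => fk s T (t - a) * w a) :=
      hvw.and (cv_ae_integrable (fk_meas s T) hw (fk_fin h0 hT) w2f)
    have g1 : ∀ᵐ x ∂((volume.restrict (Ioo (0:ℝ) T)).prod (volume : Measure ℝ)), 0 < x.1 :=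
      Measure.quasiMeasurePreserving_fst.ae (p := fun h => 0 < h)
        ((ae_restrict_mem measurableSet_Ioo).mono fun h hh => hh.1)
    have g2 := (Measure.quasiMeasurePreserving_snd
      (μ := (volume.restrict (Ioo (0:ℝ) T))) (ν := (volume : Measure ℝ))).ae good
    have g3 := ((Measure.quasiMeasurePreserving_snd
      (μ := (volume.restrict (Ioo (0:ℝ) T))) (ν := (volume : Measure ℝ))).comp
      (measurePreserving_prod_add (volume.restrict (Ioo (0:ℝ) T))
        (volume : Measure ℝ)).quasiMeasurePreserving).ae good
    filter_upwards [g1, g2, g3] with x hx ht hth m1 m2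
    simp only [Function.comp] at hth
    rw [add_comm x.1] at hth
    apply le_of_eq
    rw [hth.1 m2, ht.1 m1]
    congr 1
    have e : cv (fk s T) w (x.2 + x.1) - cv (fk s T) w x.2 =
        x.1 ^ (s - 1) * ∫ a, kap s ((x.2 - a) / x.1) * w a := by
      unfold cv
      rw [← integral_sub hth.2 ht.2, ← integral_const_mul]
      congr 1; ext a
      by_cases ha : a ∈ Ioo 0 T
      · have f : ∀ y, y ∈ Ioo 0 T → fk s T (y - a) = pk s (y - a) := by
          intro y hy
          unfold fk pk
          by_cases hh : 0 < y - a
          · rw [if_pos ⟨hh, by linarith [hy.2, ha.1]⟩, if_pos hh]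
          · rw [if_neg (fun h => hh h.1), if_neg hh]
        rw [f _ m1, f _ m2]
        unfold kap
        rw [← sub_mul, ← mul_assoc, mul_sub, ← pk_scale hx, ← pk_scale hx]
        congr 3
        · field_simp; ring
        · field_simp
      · rw [hs a ha]; simp
    have e2 : ∫ a, phiS (kap s) x a * w a = x.1 ^ (-3 / 2 : ℝ) * ∫ a, kap s ((x.2 - a) / x.1) * w a := by
      rw [← integral_const_mul]; congr 1; ext a; unfold phiS; ring
    rw [e, e2, mul_pow, mul_pow, ← Real.rpow_natCast (x.1 ^ (s - 1)), ← Real.rpow_mul hx.le,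
      ← Real.rpow_natCast (x.1 ^ (-3 / 2 : ℝ)), ← Real.rpow_mul hx.le, mul_div_right_comm,
      ← Real.rpow_sub hx]
    congr 2
    push_cast; ring
  · have := sq_fun hδ0 (kap_meas s) (kap_integrable h0 h1) (kap_integral h0 h1)
      (kap_D h0 h1 hδ0 hδs hδs') hw w2f hT
    rw [w2, ← hK] at this
    clear_value K
    calc _ ≤ 2 * (2 * ENNReal.ofReal (∫ a, w a ^ 2) * ENNReal.ofReal K) := by gcongr
      _ = _ := by
        rw [show 4 * K * ∫ a, w a ^ 2 = 2 * (2 * (∫ a, w a ^ 2) * K) by ring,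
          ENNReal.ofReal_mul (p := 2) (by norm_num), ENNReal.ofReal_mul (by positivity),
          ENNReal.ofReal_mul (by norm_num)]
        simp


lemma cv_assoc {k1 k2 u : ℝ → ℝ} (m1 : Measurable k1) (m2 : Measurable k2) (mu : Measurable u)
    (i1 : Integrable k1) (i2 : Integrable k2) (iu : Integrable u) :
    ∀ᵐ t, cv k1 (cv k2 u) t = cv (cv k1 k2) u t := by
  have fin : ∫⁻ t, ∫⁻ p : ℝ × ℝ, ‖k1 (t - p.1)‖ₑ * (‖k2 (p.1 - p.2)‖ₑ * ‖u p.2‖ₑ) ≠ ∞ := by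
    rw [lintegral_lintegral_swap (by simp only [Function.uncurry_def]; fun_prop)]
    have e : ∀ p : ℝ × ℝ, ∫⁻ t, ‖k1 (t - p.1)‖ₑ * (‖k2 (p.1 - p.2)‖ₑ * ‖u p.2‖ₑ) =
        (∫⁻ t, ‖k1 t‖ₑ) * (‖k2 (p.1 - p.2)‖ₑ * ‖u p.2‖ₑ) := fun p => by
      rw [lintegral_mul_const _ (by fun_prop), lintegral_sub_right_eq_self (fun t => ‖k1 t‖ₑ)]
    simp only [e]
    rw [lintegral_const_mul _ (by fun_prop), Measure.volume_eq_prod,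
      lintegral_prod_symm _ (by fun_prop)]
    have e2 : ∀ y, ∫⁻ x, ‖k2 (x - y)‖ₑ * ‖u y‖ₑ = (∫⁻ t, ‖k2 t‖ₑ) * ‖u y‖ₑ := fun y => by
      rw [lintegral_mul_const _ (by fun_prop), lintegral_sub_right_eq_self (fun t => ‖k2 t‖ₑ)]
    simp only [e2]
    rw [lintegral_const_mul _ (by fun_prop)]
    exact ENNReal.mul_ne_top i1.2.ne (ENNReal.mul_ne_top i2.2.ne iu.2.ne)
  have mt : Measurable (fun t => ∫⁻ p : ℝ × ℝ, ‖k1 (t - p.1)‖ₑ * (‖k2 (p.1 - p.2)‖ₑ * ‖u p.2‖ₑ)) :=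
    Measurable.lintegral_prod_right' (f := fun z : ℝ × (ℝ × ℝ) =>
      ‖k1 (z.1 - z.2.1)‖ₑ * (‖k2 (z.2.1 - z.2.2)‖ₑ * ‖u z.2.2‖ₑ)) (by fun_prop)
  filter_upwards [ae_lt_top mt fin] with t ht
  have hI : Integrable (fun p : ℝ × ℝ => k1 (t - p.1) * (k2 (p.1 - p.2) * u p.2)) := by
    refine ⟨by fun_prop, ?_⟩
    rw [hasFiniteIntegral_iff_enorm]
    simpa only [enorm_mul] using ht
  unfold cv
  simp only [← integral_const_mul]
  rw [integral_integral_swap (f := fun r a => k1 (t - r) * (k2 (r - a) * u a)) hI]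
  congr 1; ext a
  rw [← integral_mul_const, ← integral_add_right_eq_self _ a]
  congr 1; ext r
  rw [add_sub_cancel_right, show t - (r + a) = t - a - r by ring]; ring

lemma cv_comm (k1 k2 : ℝ → ℝ) : cv k1 k2 = cv k2 k1 := by
  ext t
  unfold cv
  rw [← integral_sub_left_eq_self _ volume t]
  congr 1; ext a
  rw [sub_sub_cancel, mul_comm]

noncomputable def bI (a b : ℝ) : ℝ := ∫ r, fk b 1 (1 - r) * fk a 1 r

lemma bI_pos {a b : ℝ} (ha : 0 < a) (hb : 0 < b) (hab : a + b = 1) : 0 < bI a b := by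
  have i1 := fk_integrable ha one_pos
  have i2 := fk_integrable hb one_pos
  have i3 : Integrable (fun r => fk b 1 (1 - r)) := i2.comp_sub_left 1
  have ma := fk_meas a 1
  have mb := fk_meas b 1
  have hI : Integrable (fun r => fk b 1 (1 - r) * fk a 1 r) := by
    refine ((i1.add i3).const_mul 2).mono' (by fun_prop) (Eventually.of_forall fun r => ?_)
    have n1 := fk_nonneg a 1 r
    have n2 := fk_nonneg b 1 (1 - r)
    rw [Real.norm_of_nonneg (by positivity)]
    simp only [Pi.add_apply]
    by_cases hr : 0 < r ∧ r < 1
    · have q : ∀ e x : ℝ, 0 < e → 1 / 2 ≤ x → x < 1 → fk e 1 x ≤ 2 := by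
        intro e x he hx hx1
        unfold fk
        rw [if_pos ⟨by linarith, hx1⟩]
        calc x ^ (e - 1) ≤ x ^ (-1 : ℝ) :=
              Real.rpow_le_rpow_of_exponent_ge (by linarith) hx1.le (by linarith)
          _ ≤ 2 := by
              rw [Real.rpow_neg_one, inv_le_comm₀ (by linarith) (by norm_num)]; linarith
      rcases le_total r (1 / 2) with h | h
      · have := q b (1 - r) hb (by linarith) (by linarith)
        nlinarith
      · have := q a r ha h hr.2
        nlinarith
    · have : fk a 1 r = 0 := by unfold fk; rw [if_neg hr]
      rw [this]; linarith
  have h1 : ∫ r, (Ioo (0:ℝ) 1).indicator (fun _ => (1:ℝ)) r ≤ bI a b := by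
    refine integral_mono ?_ hI fun r => ?_
    · exact (integrable_indicator_iff measurableSet_Ioo).mpr (by simp)
    · by_cases hr : r ∈ Ioo (0:ℝ) 1
      · rw [indicator_of_mem hr]
        simp only [fk]
        rw [if_pos ⟨by linarith [hr.2], by linarith [hr.1]⟩, if_pos (c := 0 < r ∧ r < 1) hr]
        have a1 := Real.one_le_rpow_of_pos_of_le_one_of_nonpos hr.1 hr.2.le (show a - 1 ≤ 0 by linarith)
        have a2 := Real.one_le_rpow_of_pos_of_le_one_of_nonpos (x := 1 - r) (by linarith [hr.2])
          (by linarith [hr.1]) (show b - 1 ≤ 0 by linarith)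
        nlinarith
      · rw [indicator_of_notMem hr]
        exact mul_nonneg (fk_nonneg _ _ _) (fk_nonneg _ _ _)
  rw [integral_indicator measurableSet_Ioo] at h1
  simp at h1
  linarith

lemma cv_fk_fk {a b T x : ℝ} (hab : a + b = 1) (hx : 0 < x) (hxT : x < T) :
    cv (fk b T) (fk a T) x = bI a b := by
  have : ∀ r, fk b T (x - r) * fk a T r = x⁻¹ * (fun r => fk b 1 (1 - r) * fk a 1 r) (r / x) := by
    intro r
    simp only [fk]
    by_cases hr : 0 < r ∧ r < x
    · have hrx : r / x < 1 := (div_lt_one hx).mpr hr.2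
      have hr0 : 0 < r / x := div_pos hr.1 hx
      rw [if_pos ⟨by linarith [hr.2], by linarith [hr.1]⟩, if_pos ⟨hr.1, by linarith [hr.2]⟩,
        if_pos ⟨by linarith, by linarith⟩, if_pos ⟨hr0, hrx⟩,
        show 1 - r / x = (x - r) / x by field_simp, Real.div_rpow (by linarith [hr.2]) hx.le,
        Real.div_rpow hr.1.le hx.le, div_mul_div_comm, ← Real.rpow_add hx,
        show b - 1 + (a - 1) = -1 by linarith, Real.rpow_neg_one]
      field_simp
    · have h1 : ¬ (0 < r ∧ r < x) := hr
      have l : (if 0 < x - r ∧ x - r < T then (x - r) ^ (b - 1) else 0) *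
          (if 0 < r ∧ r < T then r ^ (a - 1) else 0) = 0 := by
        by_cases h0 : 0 < r
        · have : ¬ (0 < x - r) := fun h => hr ⟨h0, by linarith⟩
          rw [if_neg (fun h => this h.1), zero_mul]
        · rw [if_neg (c := 0 < r ∧ r < T) (fun h => h0 h.1), mul_zero]
      rw [l, if_neg (c := 0 < r / x ∧ r / x < 1), mul_zero, mul_zero]
      rintro ⟨h2, h3⟩
      rw [div_lt_one hx] at h3
      exact hr ⟨(div_pos_iff_of_pos_right hx).mp h2, h3⟩
  unfold cv
  simp only [this]
  rw [integral_const_mul, Measure.integral_comp_div (fun r => fk b 1 (1 - r) * fk a 1 r), smul_eq_mul, abs_of_pos hx,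
    ← mul_assoc, inv_mul_cancel₀ hx.ne', one_mul]
  rfl

lemma cv_fk_nonpos {a T : ℝ} {u : ℝ → ℝ} (hu : ∀ x, x ≤ 0 → u x = 0) {x : ℝ} (hx : x ≤ 0) :
    cv (fk a T) u x = 0 := by
  unfold cv
  have : ∀ r, fk a T (x - r) * u r = 0 := by
    intro r
    by_cases h0 : 0 < r
    · unfold fk; rw [if_neg (fun h => by linarith [h.1]), zero_mul]
    · rw [hu r (by linarith), mul_zero]
  simp [this]

lemma fk_nonpos {a T : ℝ} (x : ℝ) (hx : x ≤ 0) : fk a T x = 0 := by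
  unfold fk; rw [if_neg (fun h => by linarith [h.1])]

lemma cv_ind {a b T : ℝ} {u : ℝ → ℝ} (hu : ∀ x, x ≤ 0 → u x = 0) {t : ℝ} (ht : t ∈ Ioo 0 T) :
    cv (fk a T) ((Ioo 0 T).indicator (cv (fk b T) u)) t = cv (fk a T) (cv (fk b T) u) t := by
  unfold cv
  congr 1; ext r
  by_cases hr : r ∈ Ioo 0 T
  · rw [indicator_of_mem hr]
  · rw [indicator_of_notMem hr]
    by_cases h0 : r ≤ 0
    · have := cv_fk_nonpos (a := b) (T := T) hu h0
      unfold cv at this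
      rw [this]
    · have : T ≤ r := by
        by_contra h
        exact hr ⟨by linarith, by linarith⟩
      rw [fk_nonpos _ (by linarith [ht.2])]; simp

lemma cv_one {T : ℝ} {u : ℝ → ℝ} (hs : ∀ a, a ∉ Ioo 0 T → u a = 0) {t : ℝ} (ht : t ∈ Ioo 0 T) :
    cv (fk 1 T) u t = ∫ s in (0:ℝ)..t, u s := by
  rw [intervalIntegral.integral_of_le ht.1.le, integral_Ioc_eq_integral_Ioo,
    ← integral_indicator measurableSet_Ioo]
  unfold cv
  congr 1; ext a
  by_cases ha : a ∈ Ioo 0 T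
  · by_cases h : a < t
    · rw [indicator_of_mem (show a ∈ Ioo 0 t from ⟨ha.1, h⟩)]
      unfold fk
      rw [if_pos ⟨by linarith, by linarith [ha.1, ht.2]⟩]; simp
    · rw [indicator_of_notMem (fun hh => h hh.2), fk_nonpos _ (by linarith), zero_mul]
  · rw [hs a ha, mul_zero]
    by_cases h : a ∈ Ioo 0 t
    · rw [indicator_of_mem h, hs a ha]
    · rw [indicator_of_notMem h]

section
variable {α T : ℝ} {u : ℝ → ℝ}

lemma frac_rel (h0 : 0 < α) (h1 : α < 1) (hT : 0 < T) (hu : Measurable u)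
    (hs : ∀ a, a ∉ Ioo 0 T → u a = 0) (iu : Integrable u) :
    ∀ᵐ t, t ∈ Ioo 0 T → cv (fk (1 - α) T) ((Ioo 0 T).indicator (cv (fk α T) u)) t =
      bI α (1 - α) * ∫ s in (0:ℝ)..t, u s := by
  have hb : 0 < 1 - α := by linarith
  have hn : ∀ x, x ≤ 0 → u x = 0 := fun x hx => hs x (fun h => by linarith [h.1])
  filter_upwards [cv_assoc (fk_meas (1 - α) T) (fk_meas α T) hu (fk_integrable hb hT)
    (fk_integrable h0 hT) iu] with t ht hts
  rw [cv_ind hn hts, ht, ← cv_one hs hts]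
  unfold cv
  rw [← integral_const_mul]
  congr 1; ext a
  by_cases ha : a ∈ Ioo 0 T
  · rw [← mul_assoc]
    congr 1
    by_cases h : a < t
    · have := cv_fk_fk (a := α) (b := 1 - α) (T := T) (x := t - a) (by ring) (by linarith)
        (by linarith [ha.1, hts.2])
      unfold cv at this
      rw [this]
      unfold fk
      rw [if_pos ⟨by linarith, by linarith [ha.1, hts.2]⟩]; simp
    · have := cv_fk_nonpos (a := 1 - α) (T := T) (u := fk α T) fk_nonpos (x := t - a) (by linarith)
      unfold cv at this
      rw [this, fk_nonpos _ (by linarith), mul_zero]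
  · rw [hs a ha]; simp

lemma frac_prim (h0 : 0 < α) (hT : 0 < T) (hu : Measurable u)
    (hs : ∀ a, a ∉ Ioo 0 T → u a = 0) (iu : Integrable u) :
    ∀ᵐ t, t ∈ Ioo 0 T → cv (fk α T) ((Ioo 0 T).indicator (fun t => ∫ s in (0:ℝ)..t, u s)) t =
      ∫ s in (0:ℝ)..t, (Ioo 0 T).indicator (cv (fk α T) u) s := by
  have hn : ∀ x, x ≤ 0 → u x = 0 := fun x hx => hs x (fun h => by linarith [h.1])
  have e : (Ioo 0 T).indicator (fun t => ∫ s in (0:ℝ)..t, u s) =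
      (Ioo 0 T).indicator (cv (fk 1 T) u) := by
    ext t
    by_cases ht : t ∈ Ioo 0 T
    · rw [indicator_of_mem ht, indicator_of_mem ht, cv_one hs ht]
    · rw [indicator_of_notMem ht, indicator_of_notMem ht]
  filter_upwards [cv_assoc (fk_meas 1 T) (fk_meas α T) hu (fk_integrable one_pos hT)
    (fk_integrable h0 hT) iu, cv_assoc (fk_meas α T) (fk_meas 1 T) hu (fk_integrable h0 hT)
    (fk_integrable one_pos hT) iu] with t ht1 ht2 hts
  rw [e, cv_ind hn hts, ht2, cv_comm (fk α T), ← ht1, ← cv_ind hn hts, cv_one _ hts]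
  intro a ha
  rw [indicator_of_notMem ha]

lemma frac_eq {v : ℝ → ℝ} {t : ℝ} (ht : t ∈ Ioo 0 T) :
    leftFracInt α v t = (Real.Gamma α)⁻¹ * cv (fk α T) ((Ioo 0 T).indicator v) t := by
  unfold leftFracInt cv
  rw [intervalIntegral.integral_of_le ht.1.le, integral_Ioc_eq_integral_Ioo,
    ← integral_indicator measurableSet_Ioo]
  congr 2; ext a
  by_cases h : a ∈ Ioo 0 t
  · rw [indicator_of_mem h, indicator_of_mem (show a ∈ Ioo 0 T from ⟨h.1, h.2.trans ht.2⟩)]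
    unfold fk
    rw [if_pos ⟨by linarith [h.2], by linarith [h.1, ht.2]⟩]
  · rw [indicator_of_notMem h]
    by_cases h0 : 0 < a
    · rw [fk_nonpos _ (by have : ¬ (a < t) := fun hh => h ⟨h0, hh⟩
                          linarith), zero_mul]
    · rw [indicator_of_notMem (fun hh => h0 hh.1), mul_zero]

end


lemma lax_solve {H : Type*} [NormedAddCommGroup H] [InnerProductSpace ℝ H] [CompleteSpace H]
    (A : H →L[ℝ] H) (hA : ∀ f, 0 ≤ inner ℝ (A f) f) {l : ℝ} (hl : 0 < l) (g : H) :
    ∃ f, f + l • A f = g := by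
  set L : H →L[ℝ] H := ContinuousLinearMap.id ℝ H + l • A with hL
  set B : H →L[ℝ] H →L[ℝ] ℝ := (innerSL ℝ).comp L with hB
  have hB' : ∀ f h, B f h = inner ℝ (f + l • A f) h := fun f h => rfl
  have hc : IsCoercive B := by
    refine ⟨1, one_pos, fun f => ?_⟩
    rw [hB', inner_add_left, real_inner_smul_left, real_inner_self_eq_norm_sq]
    have := mul_nonneg hl.le (hA f)
    nlinarith
  obtain ⟨f, hf⟩ := hc.continuousLinearEquivOfBilin.surjective g
  refine ⟨f, ?_⟩
  rw [← hf]
  exact hc.unique_continuousLinearEquivOfBilin (fun w => (hB' f w).symm)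

lemma eLp2 (f : ℝ → ℝ) : eLpNorm f 2 volume ^ 2 = ∫⁻ x, ‖f x‖ₑ ^ 2 := by
  have := eLpNorm_nnreal_pow_eq_lintegral (μ := (volume : Measure ℝ)) (f := f) (p := 2) (by norm_num)
  simpa using this

lemma memLp2_iff {f : ℝ → ℝ} (hf : Measurable f) : MemLp f 2 volume ↔ ∫⁻ x, ‖f x‖ₑ ^ 2 ≠ ∞ := by
  rw [← eLp2]
  unfold MemLp
  simp [hf.aestronglyMeasurable, lt_top_iff_ne_top]

noncomputable def opF (α T : ℝ) (f : ℝ → ℝ) : ℝ → ℝ :=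
  (Ioo 0 T).indicator (cv (fk α T) ((Ioo 0 T).indicator f))

section
variable {α T : ℝ}

lemma ind_sq_le (f : ℝ → ℝ) (s : Set ℝ) : ∫⁻ x, ‖s.indicator f x‖ₑ ^ 2 ≤ ∫⁻ x, ‖f x‖ₑ ^ 2 := by
  refine lintegral_mono fun x => ?_
  gcongr
  exact enorm_indicator_le_enorm_self f x

lemma opF_meas {f : ℝ → ℝ} (hf : Measurable f) : Measurable (opF α T f) :=
  (cv_measurable (fk_meas α T) (hf.indicator measurableSet_Ioo)).indicator measurableSet_Ioo

lemma opF_bound {f : ℝ → ℝ} (hf : Measurable f) :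
    ∫⁻ x, ‖opF α T f x‖ₑ ^ 2 ≤ 2 * (∫⁻ x, ‖f x‖ₑ ^ 2) * (∫⁻ x, ‖fk α T x‖ₑ) ^ 2 := by
  refine (ind_sq_le _ _).trans ((cv_l2 (fk_meas α T) (hf.indicator measurableSet_Ioo)).trans ?_)
  exact mul_le_mul_left (mul_le_mul_right (ind_sq_le _ _) _) _

lemma opF_memLp (h0 : 0 < α) (hT : 0 < T) {f : ℝ → ℝ} (hf : Measurable f) (hf2 : MemLp f 2 volume) :
    MemLp (opF α T f) 2 volume := by
  rw [memLp2_iff (opF_meas hf)]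
  rw [memLp2_iff hf] at hf2
  refine ne_top_of_le_ne_top ?_ (opF_bound hf)
  exact ENNReal.mul_ne_top (ENNReal.mul_ne_top (by simp) hf2) (ENNReal.pow_ne_top (fk_fin h0 hT))

lemma Lp_meas (f : Lp ℝ 2 (volume : Measure ℝ)) : Measurable f := (Lp.stronglyMeasurable f).measurable

lemma opF_congr {f g : ℝ → ℝ} (h : f =ᵐ[volume] g) : opF α T f = opF α T g := by
  unfold opF
  congr 1
  ext t
  unfold cv
  refine integral_congr_ae ?_
  filter_upwards [h] with a ha
  simp only [indicator]
  rw [ha]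

noncomputable def opLin (h0 : 0 < α) (hT : 0 < T) :
    Lp ℝ 2 (volume : Measure ℝ) →ₗ[ℝ] Lp ℝ 2 (volume : Measure ℝ) where
  toFun f := (opF_memLp h0 hT (Lp_meas f) (Lp.memLp f)).toLp
  map_add' f g := by
    rw [← MemLp.toLp_add, MemLp.toLp_eq_toLp_iff, opF_congr (Lp.coeFn_add f g)]
    have mf := Lp_meas f
    have mg := Lp_meas g
    have F : ∀ f : Lp ℝ 2 (volume : Measure ℝ), ∫⁻ x, ‖(Ioo 0 T).indicator f x‖ₑ ^ 2 ≠ ∞ := fun f =>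
      ne_top_of_le_ne_top ((memLp2_iff (Lp_meas f)).mp (Lp.memLp f)) (ind_sq_le _ _)
    filter_upwards [cv_ae_integrable (fk_meas α T) (mf.indicator measurableSet_Ioo) (fk_fin h0 hT) (F f),
      cv_ae_integrable (fk_meas α T) (mg.indicator measurableSet_Ioo) (fk_fin h0 hT) (F g)] with t h1 h2
    simp only [opF, Pi.add_apply]
    by_cases ht : t ∈ Ioo 0 T
    · rw [indicator_of_mem ht, indicator_of_mem ht, indicator_of_mem ht]
      unfold cv
      rw [← integral_add h1 h2]
      congr 1; ext a
      simp only [indicator, Pi.add_apply]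
      split_ifs <;> ring
    · rw [indicator_of_notMem ht, indicator_of_notMem ht, indicator_of_notMem ht, add_zero]
  map_smul' c f := by
    rw [RingHom.id_apply, ← MemLp.toLp_const_smul, MemLp.toLp_eq_toLp_iff, opF_congr (Lp.coeFn_smul c f)]
    refine Eventually.of_forall fun t => ?_
    simp only [opF, Pi.smul_apply, smul_eq_mul]
    by_cases ht : t ∈ Ioo 0 T
    · rw [indicator_of_mem ht, indicator_of_mem ht]
      unfold cv
      rw [← integral_const_mul]
      congr 1; ext a
      simp only [indicator, Pi.smul_apply, smul_eq_mul]
      split_ifs <;> ring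
    · rw [indicator_of_notMem ht, indicator_of_notMem ht, mul_zero]

lemma two_ofReal {x y z : ℝ} (hy : 0 ≤ y) (hz : 0 ≤ z)
    (h : ENNReal.ofReal x ≤ 2 * ENNReal.ofReal y * ENNReal.ofReal z) : x ≤ 2 * y * z := by
  rw [show (2 : ℝ≥0∞) = ENNReal.ofReal 2 by simp, ← ENNReal.ofReal_mul (by norm_num),
    ← ENNReal.ofReal_mul (by positivity), ENNReal.ofReal_le_ofReal_iff (by positivity)] at h
  exact h

lemma Lp_norm_sq (f : Lp ℝ 2 (volume : Measure ℝ)) :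
    ENNReal.ofReal (‖f‖ ^ 2) = ∫⁻ x, ‖f x‖ₑ ^ 2 := by
  rw [← eLp2, ofReal_sq_eq, enorm_norm, Lp.enorm_def]

noncomputable def opC (h0 : 0 < α) (hT : 0 < T) :
    Lp ℝ 2 (volume : Measure ℝ) →L[ℝ] Lp ℝ 2 (volume : Measure ℝ) :=
  (opLin h0 hT).mkContinuous (2 * (∫⁻ x, ‖fk α T x‖ₑ).toReal) (by
    intro f
    have hc : opLin h0 hT f =ᵐ[volume] opF α T f := MemLp.coeFn_toLp (opF_memLp h0 hT (Lp_meas f) (Lp.memLp f))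
    have h1 : ∫⁻ x, ‖opLin h0 hT f x‖ₑ ^ 2 = ∫⁻ x, ‖opF α T f x‖ₑ ^ 2 :=
      lintegral_congr_ae (hc.mono fun x hx => by simp only [hx])
    have h2 := opF_bound (α := α) (T := T) (Lp_meas f)
    rw [← h1, ← Lp_norm_sq, ← Lp_norm_sq, ← ENNReal.ofReal_toReal (fk_fin h0 hT),
      ← ENNReal.ofReal_pow ENNReal.toReal_nonneg] at h2
    replace h2 := two_ofReal (by positivity) (by positivity) h2
    refine abs_le_of_sq_le_sq' ?_ (by positivity) |>.2
    have : 0 ≤ ‖f‖ ^ 2 * (∫⁻ x, ‖fk α T x‖ₑ).toReal ^ 2 := by positivity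
    nlinarith)

lemma opC_coe (h0 : 0 < α) (hT : 0 < T) (f : Lp ℝ 2 (volume : Measure ℝ)) :
    opC h0 hT f =ᵐ[volume] opF α T f :=
  MemLp.coeFn_toLp (opF_memLp h0 hT (Lp_meas f) (Lp.memLp f))

lemma opC_nonneg (h0 : 0 < α) (h1 : α < 1) (hT : 0 < T) (f : Lp ℝ 2 (volume : Measure ℝ)) :
    0 ≤ inner ℝ (opC h0 hT f) f := by
  have := (en_key (u := (Ioo 0 T).indicator f) h0 h1 hT ((Lp_meas f).indicator measurableSet_Ioo)
    (fun a ha => indicator_of_notMem ha _)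
    (ne_top_of_le_ne_top ((memLp2_iff (Lp_meas f)).mp (Lp.memLp f)) (ind_sq_le _ _))).1
  rw [L2.inner_def]
  refine this.trans (le_of_eq ?_)
  unfold en
  refine integral_congr_ae ?_
  filter_upwards [opC_coe h0 hT f] with t ht
  rw [ht]
  simp only [opF, indicator, RCLike.inner_apply, conj_trivial]
  split_ifs <;> simp

lemma solve (h0 : 0 < α) (h1 : α < 1) (hT : 0 < T) {l : ℝ} (hl : 0 < l) {G : ℝ → ℝ} (hG : Measurable G)
    (hG2 : ∫⁻ x, ‖G x‖ₑ ^ 2 ≠ ∞) :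
    ∃ u : ℝ → ℝ, Measurable u ∧ (∀ a, a ∉ Ioo 0 T → u a = 0) ∧ ∫⁻ x, ‖u x‖ₑ ^ 2 ≠ ∞ ∧
      ∀ᵐ t, t ∈ Ioo 0 T → u t + l * cv (fk α T) u t = G t := by
  have mG := (memLp2_iff hG).mpr hG2
  obtain ⟨f, hf⟩ := lax_solve (opC h0 hT) (opC_nonneg h0 h1 hT) hl mG.toLp
  refine ⟨(Ioo 0 T).indicator f, (Lp_meas f).indicator measurableSet_Ioo,
    fun a ha => indicator_of_notMem ha _,
    ne_top_of_le_ne_top ((memLp2_iff (Lp_meas f)).mp (Lp.memLp f)) (ind_sq_le _ _), ?_⟩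
  have e : (f + l • opC h0 hT f : Lp ℝ 2 (volume : Measure ℝ)) =ᵐ[volume] G := by
    rw [hf]; exact MemLp.coeFn_toLp _
  filter_upwards [e, Lp.coeFn_add f (l • opC h0 hT f), Lp.coeFn_smul l (opC h0 hT f),
    opC_coe h0 hT f] with t e1 e2 e3 e4 ht
  rw [← e1, e2, Pi.add_apply, e3, Pi.smul_apply, e4, indicator_of_mem ht]
  simp only [opF]
  rw [indicator_of_mem ht, smul_eq_mul]

end


lemma sq_int {f : ℝ → ℝ} (hf : Measurable f) (h : ∫⁻ x, ‖f x‖ₑ ^ 2 ≠ ∞) :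
    Integrable (fun x => f x ^ 2) :=
  (memLp_two_iff_integrable_sq hf.aestronglyMeasurable).mp ((memLp2_iff hf).mpr h)

lemma sq_lint {f : ℝ → ℝ} (h : Integrable (fun x => f x ^ 2)) :
    ∫⁻ x, ‖f x‖ₑ ^ 2 = ENNReal.ofReal (∫ x, f x ^ 2) := by
  rw [ofReal_integral_eq_lintegral_ofReal h (Eventually.of_forall fun a => sq_nonneg _)]
  simp only [ofReal_sq_eq]

lemma cv_fin {k u : ℝ → ℝ} (mk : Measurable k) (mu : Measurable u) (ik : Integrable k)
    (hu : ∫⁻ x, ‖u x‖ₑ ^ 2 ≠ ∞) : ∫⁻ x, ‖cv k u x‖ₑ ^ 2 ≠ ∞ :=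
  ne_top_of_le_ne_top (ENNReal.mul_ne_top (ENNReal.mul_ne_top (by simp) hu)
    (ENNReal.pow_ne_top ik.2.ne)) (cv_l2 mk mu)

lemma cv_real {k u : ℝ → ℝ} (mk : Measurable k) (mu : Measurable u) (ik : Integrable k)
    (hu : ∫⁻ x, ‖u x‖ₑ ^ 2 ≠ ∞) :
    ∫ x, cv k u x ^ 2 ≤ 2 * (∫ x, u x ^ 2) * (∫ x, |k x|) ^ 2 := by
  have h := cv_l2 mk mu
  have n0 : 0 ≤ ∫ x, |k x| := integral_nonneg fun x => abs_nonneg _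
  have n1 : 0 ≤ ∫ x, u x ^ 2 := integral_nonneg fun x => sq_nonneg _
  have e : ∫⁻ x, ‖k x‖ₑ = ENNReal.ofReal (∫ x, |k x|) :=
    (ofReal_integral_norm_eq_lintegral_enorm ik).symm
  rw [sq_lint (sq_int (cv_measurable mk mu) (cv_fin mk mu ik hu)), sq_lint (sq_int mu hu), e,
    ← ENNReal.ofReal_pow n0] at h
  exact two_ofReal n1 (by positivity) h

section
variable {α T l : ℝ} {u G : ℝ → ℝ}

lemma energy (h0 : 0 < α) (h1 : α < 1) (hT : 0 < T) (hl : 0 < l) (hu : Measurable u)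
    (hs : ∀ a, a ∉ Ioo 0 T → u a = 0) (hu2 : ∫⁻ x, ‖u x‖ₑ ^ 2 ≠ ∞)
    (hGs : ∀ a, a ∉ Ioo 0 T → G a = 0)
    (he : ∀ᵐ t, t ∈ Ioo 0 T → u t + l * cv (fk α T) u t = G t) :
    (∫ x, u x ^ 2) + 2 * l * en α T u + l ^ 2 * (∫ x, (Ioo 0 T).indicator (cv (fk α T) u) x ^ 2) =
      ∫ x, G x ^ 2 := by
  set w := (Ioo 0 T).indicator (cv (fk α T) u) with hw
  have mw : Measurable w := (cv_measurable (fk_meas α T) hu).indicator measurableSet_Ioo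
  have w2 : ∫⁻ x, ‖w x‖ₑ ^ 2 ≠ ∞ :=
    ne_top_of_le_ne_top (cv_fin (fk_meas α T) hu (fk_integrable h0 hT) hu2) (ind_sq_le _ _)
  have i1 := sq_int hu hu2
  have i2 := sq_int mw w2
  have i3 : Integrable (fun x => u x * w x) :=
    ((memLp2_iff hu).mpr hu2).integrable_mul ((memLp2_iff mw).mpr w2)
  have eE : en α T u = ∫ x, u x * w x := by
    unfold en
    congr 1; ext t
    by_cases ht : t ∈ Ioo 0 T
    · rw [hw, indicator_of_mem ht]
    · rw [hs t ht, zero_mul, zero_mul]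
  have eG : ∫ x, G x ^ 2 = ∫ x, (u x ^ 2 + 2 * l * (u x * w x) + l ^ 2 * w x ^ 2) := by
    refine integral_congr_ae ?_
    filter_upwards [he] with t ht
    by_cases hts : t ∈ Ioo 0 T
    · rw [← ht hts, hw, indicator_of_mem hts]; ring
    · rw [hGs t hts, hs t hts, hw, indicator_of_notMem hts]; ring
  rw [eG, eE]
  have j1 : Integrable (fun x => u x ^ 2 + 2 * l * (u x * w x)) := i1.add (i3.const_mul _)
  rw [integral_add j1 (i2.const_mul _), integral_add i1 (i3.const_mul _), integral_const_mul,
    integral_const_mul]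

lemma uniq (h0 : 0 < α) (h1 : α < 1) (hT : 0 < T) (hl : 0 < l) (hu : Measurable u)
    (hs : ∀ a, a ∉ Ioo 0 T → u a = 0) (hu2 : ∫⁻ x, ‖u x‖ₑ ^ 2 ≠ ∞)
    (he : ∀ᵐ t, t ∈ Ioo 0 T → u t + l * cv (fk α T) u t = 0) : ∀ᵐ t, u t = 0 := by
  have e := energy (G := fun _ => 0) h0 h1 hT hl hu hs hu2 (fun _ _ => rfl) he
  have p := (en_key h0 h1 hT hu hs hu2).1
  have p1 : 0 ≤ ∫ x, u x ^ 2 := integral_nonneg fun x => sq_nonneg _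
  have p2 : 0 ≤ ∫ x, (Ioo 0 T).indicator (cv (fk α T) u) x ^ 2 := integral_nonneg fun x => sq_nonneg _
  have p3 : 0 ≤ 2 * l * en α T u := by positivity
  have p4 : 0 ≤ l ^ 2 * ∫ x, (Ioo 0 T).indicator (cv (fk α T) u) x ^ 2 := by positivity
  simp only [ne_eq, OfNat.ofNat_ne_zero, not_false_eq_true, zero_pow, integral_zero] at e
  have z : ∫ x, u x ^ 2 = 0 := by linarith
  rw [integral_eq_zero_iff_of_nonneg (fun x => sq_nonneg _) (sq_int hu hu2)] at z
  filter_upwards [z] with t ht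
  simpa using ht

lemma ind_prim {f : ℝ → ℝ} {t : ℝ} (ht : t ∈ Ioo 0 T) :
    ∫ s in (0:ℝ)..t, (Ioo 0 T).indicator f s = ∫ s in (0:ℝ)..t, f s := by
  refine intervalIntegral.integral_congr_ae (Eventually.of_forall fun a ha => ?_)
  rw [uIoc_of_le ht.1.le] at ha
  rw [indicator_of_mem (show a ∈ Ioo 0 T from ⟨ha.1, ha.2.trans_lt ht.2⟩)]

/-- identification of the solution -/
lemma ident (h0 : 0 < α) (h1 : α < 1) (hT : 0 < T) (hl : 0 < l) (hu : Measurable u)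
    (hs : ∀ a, a ∉ Ioo 0 T → u a = 0) (hu2 : ∫⁻ x, ‖u x‖ₑ ^ 2 ≠ ∞)
    (hG : Measurable G) (hGs : ∀ a, a ∉ Ioo 0 T → G a = 0) (hG2 : ∫⁻ x, ‖G x‖ₑ ^ 2 ≠ ∞)
    (he : ∀ᵐ t, t ∈ Ioo 0 T → u t + l * cv (fk α T) u t = G t)
    {y : ℝ → ℝ} (hy : Measurable y) (hys : ∀ a, a ∉ Ioo 0 T → y a = 0)
    (hy2 : ∫⁻ x, ‖y x‖ₑ ^ 2 ≠ ∞)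
    (hye : ∀ᵐ t, t ∈ Ioo 0 T → y t = (∫ s in (0:ℝ)..t, G s) - l * cv (fk α T) y t) :
    ∀ᵐ t, t ∈ Ioo 0 T → y t = ∫ s in (0:ℝ)..t, u s := by
  have iu := supp_integrable hu hs hu2
  have iG := supp_integrable hG hGs hG2
  set w := (Ioo 0 T).indicator (cv (fk α T) u) with hw
  have mw : Measurable w := (cv_measurable (fk_meas α T) hu).indicator measurableSet_Ioo
  have w2 : ∫⁻ x, ‖w x‖ₑ ^ 2 ≠ ∞ :=
    ne_top_of_le_ne_top (cv_fin (fk_meas α T) hu (fk_integrable h0 hT) hu2) (ind_sq_le _ _)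
  have iw : Integrable w := supp_integrable mw (fun a ha => indicator_of_notMem ha _) w2
  have hcont : Continuous (fun t => ∫ s in (0:ℝ)..t, u s) :=
    intervalIntegral.continuous_primitive (fun a b => iu.intervalIntegrable) 0
  set Y := (Ioo 0 T).indicator (fun t => ∫ s in (0:ℝ)..t, u s) with hY
  have mY : Measurable Y := hcont.measurable.indicator measurableSet_Ioo
  have Ys : ∀ a, a ∉ Ioo 0 T → Y a = 0 := fun a ha => indicator_of_notMem ha _
  have Y2 : ∫⁻ x, ‖Y x‖ₑ ^ 2 ≠ ∞ := by
    have : Y = (Ioo 0 T).indicator (cv (fk 1 T) u) := by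
      ext t
      by_cases ht : t ∈ Ioo 0 T
      · rw [hY, indicator_of_mem ht, indicator_of_mem ht, cv_one hs ht]
      · rw [hY, indicator_of_notMem ht, indicator_of_notMem ht]
    rw [this]
    exact ne_top_of_le_ne_top (cv_fin (fk_meas 1 T) hu (fk_integrable one_pos hT) hu2) (ind_sq_le _ _)
  have uG : ∀ᵐ t, u t = G t - l * w t := by
    filter_upwards [he] with t ht
    by_cases hts : t ∈ Ioo 0 T
    · rw [← ht hts, hw, indicator_of_mem hts]; ring
    · rw [hGs t hts, hs t hts, hw, indicator_of_notMem hts]; ring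
  have Yp : ∀ t, ∫ s in (0:ℝ)..t, u s = (∫ s in (0:ℝ)..t, G s) - l * ∫ s in (0:ℝ)..t, w s := by
    intro t
    rw [← intervalIntegral.integral_const_mul, ← intervalIntegral.integral_sub
      iG.intervalIntegrable (iw.const_mul l).intervalIntegrable]
    exact intervalIntegral.integral_congr_ae (uG.mono fun s h _ => h)
  have hz := uniq (u := fun t => y t - Y t) h0 h1 hT hl (hy.sub mY)
    (fun a ha => by simp only [hys a ha, Ys a ha, sub_zero])
    ((memLp2_iff (hy.sub mY)).mp (((memLp2_iff hy).mpr hy2).sub ((memLp2_iff mY).mpr Y2))) (by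
      filter_upwards [hye, frac_prim h0 hT hu hs iu,
        cv_ae_integrable (fk_meas α T) hy (fk_fin h0 hT) hy2,
        cv_ae_integrable (fk_meas α T) mY (fk_fin h0 hT) Y2] with t a1 a2 a3 a4 ht
      have e : cv (fk α T) (fun t => y t - Y t) t = cv (fk α T) y t - cv (fk α T) Y t := by
        unfold cv
        rw [← integral_sub a3 a4]
        congr 1; ext a; ring
      have eY : Y t = ∫ s in (0:ℝ)..t, u s := by rw [hY, indicator_of_mem ht]
      rw [e, a2 ht, eY, Yp t, a1 ht]; ring)
  filter_upwards [hz] with t h ht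
  rw [hY, indicator_of_mem ht] at h
  linarith

lemma final_arith {l Ga K1 Kb Cg ci ce U W N E A P Q : ℝ} (hl : 0 < l) (Ga0 : 0 < Ga)
    (Cg0 : 0 ≤ Cg) (hce : 0 ≤ ce) (E0 : 0 ≤ E) (U0 : 0 ≤ U) (W0 : 0 ≤ W) (A0 : 0 ≤ A)
    (P0 : 0 ≤ P) (Q0 : 0 ≤ Q)
    (en_e : N = U + 2 * l * E + l ^ 2 * W) (y1 : A ≤ 2 * U * K1 ^ 2)
    (y2 : A ≤ 2 * (ci ^ 2 * W) * Kb ^ 2) (g1 : P ≤ 4 * ce * E) (g2 : Q ≤ Cg * (ci ^ 2 * W)) :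
    √U + √(l * Ga) * √(A + P) + (l * Ga) * √(A + Q) ≤
      (1 + √(2 * K1 ^ 2 + Ga ^ 2 * ((2 * Kb ^ 2 + Cg) * ci ^ 2) + 2 * ce * Ga) +
        √(Ga ^ 2 * ((2 * Kb ^ 2 + Cg) * ci ^ 2))) * √N := by
  have D0 : 0 ≤ (2 * Kb ^ 2 + Cg) * ci ^ 2 := by positivity
  have b3 : A + Q ≤ (2 * Kb ^ 2 + Cg) * ci ^ 2 * W := by linarith
  generalize (2 * Kb ^ 2 + Cg) * ci ^ 2 = D at *
  have C30 : 0 ≤ Ga ^ 2 * D := by positivity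
  have C20 : 0 ≤ 2 * K1 ^ 2 + Ga ^ 2 * D + 2 * ce * Ga := by positivity
  have lE : 0 ≤ l * E := by positivity
  have lW : 0 ≤ l ^ 2 * W := by positivity
  have bU : U ≤ N := by linarith
  have bW : l ^ 2 * W ≤ N := by linarith
  have bE : 2 * (l * E) ≤ N := by linarith
  have t3 : (l * Ga) ^ 2 * (A + Q) ≤ Ga ^ 2 * D * N := by
    calc (l * Ga) ^ 2 * (A + Q) ≤ (l * Ga) ^ 2 * (D * W) :=
          mul_le_mul_of_nonneg_left b3 (sq_nonneg _)
      _ = Ga ^ 2 * D * (l ^ 2 * W) := by ring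
      _ ≤ Ga ^ 2 * D * N := mul_le_mul_of_nonneg_left bW C30
  have t2 : (l * Ga) * (A + P) ≤ (2 * K1 ^ 2 + Ga ^ 2 * D + 2 * ce * Ga) * N := by
    have a1 : (l * Ga) * A ≤ A + (l * Ga) ^ 2 * A := by
      have h1 := mul_nonneg A0 (sq_nonneg (l * Ga - 1))
      have h2 : 0 ≤ (l * Ga) * A := by positivity
      linarith
    have a2 : (l * Ga) ^ 2 * A ≤ Ga ^ 2 * D * N :=
      le_trans (mul_le_mul_of_nonneg_left (by linarith : A ≤ A + Q) (sq_nonneg _)) t3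
    have a3 : A ≤ 2 * K1 ^ 2 * N := by
      calc A ≤ 2 * K1 ^ 2 * U := by linarith
        _ ≤ _ := mul_le_mul_of_nonneg_left bU (by positivity)
    have a4 : (l * Ga) * P ≤ 2 * ce * Ga * N := by
      calc (l * Ga) * P ≤ (l * Ga) * (4 * ce * E) :=
            mul_le_mul_of_nonneg_left g1 (by positivity)
        _ = 2 * ce * Ga * (2 * (l * E)) := by ring
        _ ≤ _ := mul_le_mul_of_nonneg_left bE (by positivity)
    linarith
  have s3 : (l * Ga) * √(A + Q) ≤ √(Ga ^ 2 * D) * √N := by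
    rw [← Real.sqrt_mul C30]
    refine Real.le_sqrt_of_sq_le ?_
    rw [mul_pow, Real.sq_sqrt (by linarith)]; exact t3
  have s2 : √(l * Ga) * √(A + P) ≤
      √(2 * K1 ^ 2 + Ga ^ 2 * D + 2 * ce * Ga) * √N := by
    rw [← Real.sqrt_mul C20, ← Real.sqrt_mul (by positivity)]
    exact Real.sqrt_le_sqrt t2
  have s1 : √U ≤ √N := Real.sqrt_le_sqrt bU
  linarith

lemma final_est (h0 : 0 < α) (h1 : α < 1) (hT : 0 < T) :
    ∃ C : ℝ, 0 < C ∧ ∀ l : ℝ, 0 < l → ∀ u G : ℝ → ℝ, Measurable u →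
      (∀ a, a ∉ Ioo 0 T → u a = 0) → ∫⁻ x, ‖u x‖ₑ ^ 2 ≠ ∞ →
      (∀ a, a ∉ Ioo 0 T → G a = 0) →
      (∀ᵐ t, t ∈ Ioo 0 T → u t + l * cv (fk α T) u t = G t) →
      Real.sqrt (∫ t in Ioo (0 : ℝ) T, (u t) ^ 2) +
            Real.sqrt (l * Real.Gamma α) * sobNormT T (1 - α / 2) (fun x => ∫ s in (0 : ℝ)..x, u s) +
            (l * Real.Gamma α) * sobNormT T (1 - α) (fun x => ∫ s in (0 : ℝ)..x, u s) ≤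
          C * Real.sqrt (∫ x, (G x) ^ 2) := by
  have hb : 0 < 1 - α := by linarith
  obtain ⟨Cg, Cg0, hCg⟩ := frac_gag (s := 1 - α) (T := T) hb (by linarith) hT
  set Ga := Real.Gamma α with hGa
  have Ga0 : 0 < Ga := Real.Gamma_pos_of_pos h0
  have hc := bI_pos h0 hb (by ring)
  set c := bI α (1 - α) with hcdef
  have hcE := cE_pos h1
  set K1 := ∫ x, |fk 1 T x|
  set Kb := ∫ x, |fk (1 - α) T x|
  set D := (2 * Kb ^ 2 + Cg) * (c⁻¹) ^ 2 with hD
  have D0 : 0 ≤ D := by positivity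
  set C3 := Ga ^ 2 * D with hC3
  set C2 := 2 * K1 ^ 2 + C3 + 2 * cE α * Ga with hC2
  have C30 : 0 ≤ C3 := by positivity
  have C20 : 0 ≤ C2 := by positivity
  refine ⟨1 + √C2 + √C3, by positivity, ?_⟩
  intro l hl u G hu hs hu2 hGs he
  have en_e := energy h0 h1 hT hl hu hs hu2 hGs he
  have E0 := (en_key h0 h1 hT hu hs hu2).1
  have g1 := en_gag h0 h1 hT hu hs hu2
  have iu := supp_integrable hu hs hu2
  set w := (Ioo 0 T).indicator (cv (fk α T) u) with hw
  have mw : Measurable w := (cv_measurable (fk_meas α T) hu).indicator measurableSet_Ioo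
  have ws : ∀ a, a ∉ Ioo 0 T → w a = 0 := fun a ha => indicator_of_notMem ha _
  have w2 : ∫⁻ x, ‖w x‖ₑ ^ 2 ≠ ∞ :=
    ne_top_of_le_ne_top (cv_fin (fk_meas α T) hu (fk_integrable h0 hT) hu2) (ind_sq_le _ _)
  have hcont : Continuous (fun t => ∫ s in (0:ℝ)..t, u s) :=
    intervalIntegral.continuous_primitive (fun a b => iu.intervalIntegrable) 0
  set Y := (fun t => ∫ s in (0:ℝ)..t, u s) with hY
  -- bounds of Y
  have rel := frac_rel h0 h1 hT hu hs iu
  have y1 : ∫ t in Ioo 0 T, Y t ^ 2 ≤ 2 * (∫ x, u x ^ 2) * K1 ^ 2 := by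
    refine le_trans ?_ (cv_real (fk_meas 1 T) hu (fk_integrable one_pos hT) hu2)
    rw [setIntegral_congr_fun measurableSet_Ioo (g := fun t => cv (fk 1 T) u t ^ 2)
      (fun t ht => by simp only [hY, cv_one hs ht])]
    exact setIntegral_le_integral (sq_int (cv_measurable (fk_meas 1 T) hu)
      (cv_fin (fk_meas 1 T) hu (fk_integrable one_pos hT) hu2)) (Eventually.of_forall fun x => sq_nonneg _)
  have Yw : ∀ᵐ t, t ∈ Ioo 0 T → Y t = cv (fk (1 - α) T) (fun x => c⁻¹ * w x) t := by
    filter_upwards [rel] with t h ht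
    have : cv (fk (1 - α) T) (fun x => c⁻¹ * w x) t = c⁻¹ * cv (fk (1 - α) T) w t := by
      unfold cv
      rw [← integral_const_mul]; congr 1; ext a; ring
    rw [this, h ht, ← mul_assoc, inv_mul_cancel₀ hc.ne', one_mul]
  have mw' : Measurable (fun x => c⁻¹ * w x) := by fun_prop
  have w2' : ∫⁻ x, ‖c⁻¹ * w x‖ₑ ^ 2 ≠ ∞ :=
    (memLp2_iff mw').mp (((memLp2_iff mw).mpr w2).const_mul _)
  have iw' := sq_int mw' w2'
  have ew' : ∫ x, (c⁻¹ * w x) ^ 2 = (c⁻¹) ^ 2 * ∫ x, w x ^ 2 := by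
    rw [← integral_const_mul]; congr 1; ext x; ring
  have y2 : ∫ t in Ioo 0 T, Y t ^ 2 ≤ 2 * ((c⁻¹) ^ 2 * ∫ x, w x ^ 2) * Kb ^ 2 := by
    rw [← ew']
    refine le_trans ?_ (cv_real (fk_meas (1 - α) T) mw' (fk_integrable hb hT) w2')
    rw [setIntegral_congr_ae measurableSet_Ioo
      (g := fun t => cv (fk (1 - α) T) (fun x => c⁻¹ * w x) t ^ 2)
      (Yw.mono fun t h ht => by rw [h ht])]
    exact setIntegral_le_integral (sq_int (cv_measurable (fk_meas (1 - α) T) mw')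
      (cv_fin (fk_meas (1 - α) T) mw' (fk_integrable hb hT) w2'))
      (Eventually.of_forall fun x => sq_nonneg _)
  have g2 := hCg (fun x => c⁻¹ * w x) mw' (fun a ha => by simp [ws a ha]) iw' Y hcont.measurable Yw
  rw [ew'] at g2
  have uS : ∫ t in Ioo (0 : ℝ) T, (u t) ^ 2 = ∫ t, u t ^ 2 :=
    setIntegral_eq_integral_of_forall_compl_eq_zero (fun t ht => by simp [hs t ht])
  rw [uS]
  have U0 : 0 ≤ ∫ x, u x ^ 2 := integral_nonneg fun x => sq_nonneg _
  have W0 : 0 ≤ ∫ x, w x ^ 2 := integral_nonneg fun x => sq_nonneg _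
  have Y0 : 0 ≤ ∫ t in Ioo 0 T, Y t ^ 2 := integral_nonneg fun x => sq_nonneg _
  have N0 : 0 ≤ ∫ x, G x ^ 2 := integral_nonneg fun x => sq_nonneg _
  unfold sobNormT
  exact final_arith hl Ga0 (by positivity) hcE.le E0 U0 W0 Y0 (sq_nonneg _) (sq_nonneg _) (by rw [en_e]) y1 y2 g1 g2

end

theorem stmt_7x (α T : ℝ) (hα0 : 0 < α) (hα1 : α < 1) (hT : 0 < T) :
    ∃ C : ℝ, 0 < C ∧ ∀ lam : ℝ, 0 < lam → ∀ g y : ℝ → ℝ,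
      Measurable g → Measurable y →
      IntegrableOn (fun t => (g t) ^ 2) (Set.Ioo 0 T) →
      IntegrableOn (fun t => (y t) ^ 2) (Set.Ioo 0 T) →
      (∀ᵐ t ∂(volume.restrict (Set.Ioo (0 : ℝ) T)),
        y t = (∫ s in (0 : ℝ)..t, g s) - lam * leftFracInt α y t) →
      ∃ y' : ℝ → ℝ, Measurable y' ∧
        IntegrableOn (fun t => (y' t) ^ 2) (Set.Ioo 0 T) ∧
        (∀ᵐ t ∂(volume.restrict (Set.Ioo (0 : ℝ) T)),
          y t = ∫ s in (0 : ℝ)..t, y' s) ∧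
        (∀ᵐ t ∂(volume.restrict (Set.Ioo (0 : ℝ) T)),
          y' t + lam * leftFracInt α y' t = g t) ∧
        Real.sqrt (∫ t in Set.Ioo (0 : ℝ) T, (y' t) ^ 2) +
            Real.sqrt lam * sobNormT T (1 - α / 2) (fun u => ∫ s in (0 : ℝ)..u, y' s) +
            lam * sobNormT T (1 - α) (fun u => ∫ s in (0 : ℝ)..u, y' s) ≤
          C * Real.sqrt (∫ t in Set.Ioo (0 : ℝ) T, (g t) ^ 2) := by
  obtain ⟨C, hC, est⟩ := final_est hα0 hα1 hT
  refine ⟨C, hC, fun lam hlam g y hg hy hg2 hy2 heq => ?_⟩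
  have Ga0 : 0 < Real.Gamma α := Real.Gamma_pos_of_pos hα0
  have hl : 0 < lam / Real.Gamma α := by positivity
  have mS : MeasurableSet (Ioo (0:ℝ) T) := measurableSet_Ioo
  have ind2 : ∀ f : ℝ → ℝ, Measurable f → IntegrableOn (fun t => (f t) ^ 2) (Ioo 0 T) →
      ∫⁻ x, ‖(Ioo 0 T).indicator f x‖ₑ ^ 2 ≠ ∞ := by
    intro f hf hf2
    have : Integrable (fun x => (Ioo 0 T).indicator f x ^ 2) := by
      refine ((integrable_indicator_iff mS).mpr hf2).congr (Eventually.of_forall fun x => ?_)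
      simp only [indicator]; split_ifs <;> simp
    rw [sq_lint this]; exact ENNReal.ofReal_ne_top
  have mG := hg.indicator mS
  have G2 := ind2 g hg hg2
  obtain ⟨u, hu, hs, hu2, he⟩ := solve hα0 hα1 hT hl mG G2
  have hGs : ∀ a, a ∉ Ioo 0 T → (Ioo 0 T).indicator g a = 0 := fun a ha => indicator_of_notMem ha _
  rw [ae_restrict_iff' mS] at heq
  refine ⟨u, hu, (sq_int hu hu2).integrableOn, ?_, ?_, ?_⟩
  · rw [ae_restrict_iff' mS]
    have := ident hα0 hα1 hT hl hu hs hu2 mG hGs G2 he (hy.indicator mS)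
      (fun a ha => indicator_of_notMem ha _) (ind2 y hy hy2) (by
        filter_upwards [heq] with t h ht
        rw [indicator_of_mem ht, ind_prim ht, h ht, frac_eq ht]
        ring)
    filter_upwards [this] with t h ht
    rw [← h ht, indicator_of_mem ht]
  · rw [ae_restrict_iff' mS]
    filter_upwards [he] with t h ht
    have hu' : (Ioo 0 T).indicator u = u := by
      ext a
      by_cases ha : a ∈ Ioo 0 T
      · rw [indicator_of_mem ha]
      · rw [indicator_of_notMem ha, hs a ha]
    have := h ht
    rw [indicator_of_mem ht] at this
    rw [← this, frac_eq ht, hu']; ring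
  · have := est _ hl u _ hu hs hu2 hGs he
    rw [div_mul_cancel₀ _ Ga0.ne'] at this
    have e : ∫ x, (Ioo 0 T).indicator g x ^ 2 = ∫ t in Ioo 0 T, g t ^ 2 := by
      rw [← integral_indicator mS]
      congr 1; ext x
      simp only [indicator]; split_ifs <;> simp
    rwa [e] at this


end Helpers

/-- Paper's Lemma 3.2: if `y ∈ L²(0,T)` satisfies `y(t) = ∫_0^t g - λ (I_{0+}^α y)(t)` a.e.
with `g ∈ L²(0,T)` and `λ > 0`, then `y` has an absolutely continuous representative
`ỹ(t) = ∫_0^t y'` with `ỹ(0) = 0` and `y' ∈ L²(0,T)`, the equation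
`y' + λ I_{0+}^α y' = g` holds a.e. (i.e. `y' + λ D_{0+}^{1-α} y = g`), and
`‖y'‖_{L²} + λ^{1/2} ‖y‖_{H^{1-α/2}(0,T)} + λ ‖y‖_{H^{1-α}(0,T)} ≤ C ‖g‖_{L²}`
where `C` depends only on `α` and `T`. -/
theorem stmt_7 (α T : ℝ) (hα0 : 0 < α) (hα1 : α < 1) (hT : 0 < T) :
    ∃ C : ℝ, 0 < C ∧ ∀ lam : ℝ, 0 < lam → ∀ g y : ℝ → ℝ,
      Measurable g → Measurable y →
      IntegrableOn (fun t => (g t) ^ 2) (Set.Ioo 0 T) →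
      IntegrableOn (fun t => (y t) ^ 2) (Set.Ioo 0 T) →
      (∀ᵐ t ∂(volume.restrict (Set.Ioo (0 : ℝ) T)),
        y t = (∫ s in (0 : ℝ)..t, g s) - lam * leftFracInt α y t) →
      ∃ y' : ℝ → ℝ, Measurable y' ∧
        IntegrableOn (fun t => (y' t) ^ 2) (Set.Ioo 0 T) ∧
        (∀ᵐ t ∂(volume.restrict (Set.Ioo (0 : ℝ) T)),
          y t = ∫ s in (0 : ℝ)..t, y' s) ∧
        (∀ᵐ t ∂(volume.restrict (Set.Ioo (0 : ℝ) T)),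
          y' t + lam * leftFracInt α y' t = g t) ∧
        Real.sqrt (∫ t in Set.Ioo (0 : ℝ) T, (y' t) ^ 2) +
            Real.sqrt lam * sobNormT T (1 - α / 2) (fun u => ∫ s in (0 : ℝ)..u, y' s) +
            lam * sobNormT T (1 - α) (fun u => ∫ s in (0 : ℝ)..u, y' s) ≤
          C * Real.sqrt (∫ t in Set.Ioo (0 : ℝ) T, (g t) ^ 2) := by
  exact stmt_7x α T hα0 hα1 hT
end

section
/- Let 0 < β < 1/2 < γ < 1, T > 0, and let 0 = t_0 < t_1 < … < t_J = T be a partition of [0,T] with τ := max_{1≤j≤J} (t_j − t_{j−1}). Let v : [0,T] → ℝ be continuous with finite Gagliardo H^γ(0,T) norm, define the right-endpoint interpolant P_τ v by (P_τ v)(t) = v(t_j) for t ∈ (t_{j−1}, t_j], and let g : ℝ → ℝ equal v − P_τ v on (0,T) and 0 outside (0,T). Then (∫_ℝ ∫_ℝ |g(s)−g(t)|²/|s−t|^{1+2β} ds dt)^{1/2} ≤ C τ^{γ−β} ‖v‖_{H^γ(0,T)}, where C depends only on β, γ and T. -/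
open MeasureTheory

theorem aux_jensen (c d : ℝ) (hcd : c < d) (f : ℝ → ℝ) (hf : ContinuousOn f (Set.Icc c d)) :
    (∫ x in c..d, f x) ^ 2 ≤ (d - c) * ∫ x in c..d, f x ^ 2 := by
  have hf' : ContinuousOn f (Set.uIcc c d) := by rwa [Set.uIcc_of_le hcd.le]
  have h1 : IntervalIntegrable f volume c d := hf'.intervalIntegrable
  have h2 : IntervalIntegrable (fun x => f x ^ 2) volume c d := (hf'.pow 2).intervalIntegrable
  set S := ∫ x in c..d, f x with hS
  set Q := ∫ x in c..d, f x ^ 2 with hQ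
  have hpos : 0 < d - c := sub_pos.2 hcd
  have h0 : 0 ≤ ∫ x in c..d, ((d - c) * f x - S) ^ 2 :=
    intervalIntegral.integral_nonneg hcd.le (fun x _ => sq_nonneg _)
  have he : ∫ x in c..d, ((d - c) * f x - S) ^ 2
      = (d - c) ^ 2 * Q - (2 * (d - c) * S) * S + (d - c) * S ^ 2 := by
    have : ∀ x, ((d - c) * f x - S) ^ 2
        = ((d - c) ^ 2 * f x ^ 2 - (2 * (d - c) * S) * f x) + S ^ 2 := fun x => by ring
    simp_rw [this]
    rw [intervalIntegral.integral_add ((h2.const_mul _).sub (h1.const_mul _)) (by simp),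
      intervalIntegral.integral_sub (h2.const_mul _) (h1.const_mul _),
      intervalIntegral.integral_const_mul, intervalIntegral.integral_const_mul,
      intervalIntegral.integral_const, smul_eq_mul]
  rw [he] at h0
  have : 0 ≤ (d - c) * ((d - c) * Q - S ^ 2) := by nlinarith
  have := nonneg_of_mul_nonneg_right this hpos
  linarith

/-- Gagliardo energy on a subinterval -/
noncomputable def auxA (γ : ℝ) (v : ℝ → ℝ) (a b : ℝ) : ℝ :=
  ∫ p in Set.Ioo a b ×ˢ Set.Ioo a b, (v p.1 - v p.2) ^ 2 / |p.1 - p.2| ^ (1 + 2 * γ)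

def auxInt (γ : ℝ) (v : ℝ → ℝ) (a b : ℝ) : Prop :=
  IntegrableOn (fun p : ℝ × ℝ => (v p.1 - v p.2) ^ 2 / |p.1 - p.2| ^ (1 + 2 * γ))
        (Set.Ioo a b ×ˢ Set.Ioo a b)

theorem aux_phi_nonneg (γ : ℝ) (v : ℝ → ℝ) (p : ℝ × ℝ) :
    0 ≤ (v p.1 - v p.2) ^ 2 / |p.1 - p.2| ^ (1 + 2 * γ) :=
  div_nonneg (sq_nonneg _) (Real.rpow_nonneg (abs_nonneg _) _)

theorem auxA_nonneg (γ : ℝ) (v : ℝ → ℝ) (a b : ℝ) : 0 ≤ auxA γ v a b :=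
  integral_nonneg (fun p => aux_phi_nonneg γ v p)

theorem auxA_mono (γ : ℝ) (v : ℝ → ℝ) (a b c d : ℝ) (h : auxInt γ v a b) (hac : a ≤ c)
    (hdb : d ≤ b) : auxInt γ v c d ∧ auxA γ v c d ≤ auxA γ v a b := by
  have hs : Set.Ioo c d ×ˢ Set.Ioo c d ⊆ Set.Ioo a b ×ˢ Set.Ioo a b :=
    Set.prod_mono (Set.Ioo_subset_Ioo hac hdb) (Set.Ioo_subset_Ioo hac hdb)
  refine ⟨h.mono_set hs, ?_⟩
  exact setIntegral_mono_set h (Filter.Eventually.of_forall (fun p => aux_phi_nonneg γ v p))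
    (hs.eventuallyLE)

theorem aux_sq_le (γ h : ℝ) (hγ : 0 < γ) (x y : ℝ) (w : ℝ) (hxy : |x - y| ≤ h) (hw : x = y → w = 0) :
    w ^ 2 ≤ h ^ (1 + 2 * γ) * (w ^ 2 / |x - y| ^ (1 + 2 * γ)) := by
  by_cases e : x = y
  · simp [hw e]
  have h0 : 0 < |x - y| := abs_pos.2 (sub_ne_zero.2 e)
  have h1 : 0 < |x - y| ^ (1 + 2 * γ) := Real.rpow_pos_of_pos h0 _
  have h2 : |x - y| ^ (1 + 2 * γ) ≤ h ^ (1 + 2 * γ) :=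
    Real.rpow_le_rpow h0.le hxy (by linarith)
  rw [← mul_div_assoc, le_div_iff₀ h1, mul_comm]
  exact mul_le_mul_of_nonneg_right h2 (sq_nonneg _)

theorem aux_var (γ : ℝ) (hγ : 0 < γ) (c d : ℝ) (hcd : c < d) (v : ℝ → ℝ)
    (hv : ContinuousOn v (Set.Icc c d)) (hi : auxInt γ v c d) (m : ℝ)
    (hm : (d - c) * m = ∫ x in c..d, v x) :
    (d - c) * ∫ s in c..d, (v s - m) ^ 2 ≤ (d - c) ^ (1 + 2 * γ) * auxA γ v c d := by
  have hpos : 0 < d - c := sub_pos.2 hcd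
  have hv' : ContinuousOn v (Set.uIcc c d) := by rwa [Set.uIcc_of_le hcd.le]
  have h1 : IntervalIntegrable v volume c d := hv'.intervalIntegrable
  have hcont : ContinuousOn (fun p : ℝ × ℝ => (v p.1 - v p.2) ^ 2) (Set.Icc c d ×ˢ Set.Icc c d) := by
    refine ContinuousOn.pow (ContinuousOn.sub ?_ ?_) 2
    · exact hv.comp continuousOn_fst (fun p hp => hp.1)
    · exact hv.comp continuousOn_snd (fun p hp => hp.2)
  have hI : IntegrableOn (fun p : ℝ × ℝ => (v p.1 - v p.2) ^ 2) (Set.Icc c d ×ˢ Set.Icc c d) :=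
    hcont.integrableOn_compact (isCompact_Icc.prod isCompact_Icc)
  have hI' : IntegrableOn (fun p : ℝ × ℝ => (v p.1 - v p.2) ^ 2) (Set.Ioo c d ×ˢ Set.Ioo c d) :=
    hI.mono_set (Set.prod_mono Set.Ioo_subset_Icc_self Set.Ioo_subset_Icc_self)
  have hpt : ∀ s ∈ Set.Ioo c d, (d - c) * (v s - m) ^ 2 ≤ ∫ u in Set.Ioo c d, (v s - v u) ^ 2 := by
    intro s hs
    have hj := aux_jensen c d hcd (fun u => v s - v u) (continuousOn_const.sub hv)
    rw [intervalIntegral.integral_sub (by simp) h1, intervalIntegral.integral_const, ← hm,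
      smul_eq_mul, ← mul_sub, mul_pow, pow_two (d - c), mul_assoc] at hj
    have := le_of_mul_le_mul_left hj hpos
    rwa [intervalIntegral.integral_of_le hcd.le, integral_Ioc_eq_integral_Ioo] at this
  calc (d - c) * ∫ s in c..d, (v s - m) ^ 2
      = ∫ s in Set.Ioo c d, (d - c) * (v s - m) ^ 2 := by
        rw [intervalIntegral.integral_of_le hcd.le, integral_Ioc_eq_integral_Ioo,
          integral_const_mul]
    _ ≤ ∫ s in Set.Ioo c d, ∫ u in Set.Ioo c d, (v s - v u) ^ 2 := by
        refine setIntegral_mono_on ?_ ?_ measurableSet_Ioo hpt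
        · refine IntegrableOn.mono_set (t := Set.Icc c d) ?_ Set.Ioo_subset_Icc_self
          exact (continuousOn_const.mul ((hv.sub continuousOn_const).pow 2)).integrableOn_Icc
        · have := hI'
          rw [IntegrableOn, Measure.volume_eq_prod, ← Measure.prod_restrict] at this
          exact this.integral_prod_left
    _ = ∫ p in Set.Ioo c d ×ˢ Set.Ioo c d, (v p.1 - v p.2) ^ 2 := by
        rw [Measure.volume_eq_prod]
        exact (setIntegral_prod _ hI').symm
    _ ≤ ∫ p in Set.Ioo c d ×ˢ Set.Ioo c d, (d - c) ^ (1 + 2 * γ) *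
          ((v p.1 - v p.2) ^ 2 / |p.1 - p.2| ^ (1 + 2 * γ)) := by
        refine setIntegral_mono_on hI' (hi.const_mul _) (measurableSet_Ioo.prod measurableSet_Ioo) ?_
        rintro ⟨x, y⟩ ⟨hx, hy⟩
        refine aux_sq_le γ (d - c) hγ x y _ ?_ (fun e => by simp [e])
        have := hx.1; have := hx.2; have := hy.1; have := hy.2
        simp only at *
        rw [abs_le]; constructor <;> linarith
    _ = _ := by rw [integral_const_mul]; rfl

theorem aux_step (γ : ℝ) (hγ : 0 < γ) (c d c' d' : ℝ) (hcd : c < d) (hc : c ≤ c') (hd : d' ≤ d)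
    (hh : d' - c' = (d - c) / 2) (v : ℝ → ℝ)
    (hv : ContinuousOn v (Set.Icc c d)) (hi : auxInt γ v c d) (m m' : ℝ)
    (hm : (d - c) * m = ∫ x in c..d, v x) (hm' : (d' - c') * m' = ∫ x in c'..d', v x) :
    (m' - m) ^ 2 ≤ 2 * (d - c) ^ (2 * γ - 1) * auxA γ v c d := by
  have hpos : 0 < d - c := sub_pos.2 hcd
  have hcd' : c' < d' := by linarith
  have hpos' : 0 < d' - c' := sub_pos.2 hcd'
  have hsub : Set.Icc c' d' ⊆ Set.Icc c d := Set.Icc_subset_Icc hc hd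
  have hv' : ContinuousOn v (Set.Icc c' d') := hv.mono hsub
  have hi1 : IntervalIntegrable v volume c' d' := by
    apply ContinuousOn.intervalIntegrable; rwa [Set.uIcc_of_le hcd'.le]
  have hj := aux_jensen c' d' hcd' (fun u => v u - m) (hv'.sub continuousOn_const)
  rw [intervalIntegral.integral_sub hi1 (by simp), intervalIntegral.integral_const, ← hm',
      smul_eq_mul, ← mul_sub, mul_pow, pow_two (d' - c'), mul_assoc] at hj
  have h1 := le_of_mul_le_mul_left hj hpos'
  have h2 : ∫ u in c'..d', (v u - m) ^ 2 ≤ ∫ u in c..d, (v u - m) ^ 2 := by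
    refine intervalIntegral.integral_mono_interval hc hcd'.le hd
      (Filter.Eventually.of_forall (fun x => sq_nonneg _)) ?_
    apply ContinuousOn.intervalIntegrable; rw [Set.uIcc_of_le hcd.le]
    exact (hv.sub continuousOn_const).pow 2
  have h3 := aux_var γ hγ c d hcd v hv hi m hm
  have h4 : (d - c) ^ (1 + 2 * γ) = (d - c) ^ 2 * (d - c) ^ (2 * γ - 1) := by
    rw [← Real.rpow_natCast, ← Real.rpow_add hpos]; congr 1; push_cast; ring
  rw [h4] at h3
  have h5 : (d - c) ^ 2 * (m' - m) ^ 2 ≤ (d - c) ^ 2 * (2 * (d - c) ^ (2 * γ - 1) * auxA γ v c d) := by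
    have h6 : (d - c) * ((d' - c') * (m' - m) ^ 2) ≤ (d - c) * ∫ u in c..d, (v u - m) ^ 2 :=
      mul_le_mul_of_nonneg_left (h1.trans h2) hpos.le
    rw [hh] at h6
    nlinarith
  exact le_of_mul_le_mul_left h5 (by positivity)

theorem aux_morrey (γ : ℝ) (hγ : 1 / 2 < γ) : ∃ C : ℝ, 0 < C ∧ ∀ (a b : ℝ) (v : ℝ → ℝ), a < b →
    ContinuousOn v (Set.Icc a b) → auxInt γ v a b → ∀ x ∈ Set.Icc a b,
    |v x - (∫ y in a..b, v y) / (b - a)| ≤ C * Real.sqrt ((b - a) ^ (2 * γ - 1) * auxA γ v a b) := by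
  set q : ℝ := (1 / 2 : ℝ) ^ (γ - 1 / 2) with hq
  have hq1 : q < 1 := Real.rpow_lt_one (by norm_num) (by norm_num) (by linarith)
  have hq0 : 0 < q := Real.rpow_pos_of_pos (by norm_num) _
  refine ⟨Real.sqrt 2 / (1 - q), div_pos (by positivity) (by linarith), ?_⟩
  intro a b v hab hv hi x hx
  have hpos : 0 < b - a := sub_pos.2 hab
  set A := auxA γ v a b with hA
  let e : ℕ → ℝ := fun n => (1 / 2 : ℝ) ^ n
  have he0 : ∀ n, 0 < e n := fun n => by positivity
  have he1 : ∀ n, e n ≤ 1 := fun n => pow_le_one₀ (by norm_num) (by norm_num)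
  have hes : ∀ n, e (n + 1) = e n / 2 := fun n => by simp only [e, pow_succ]; ring
  let c : ℕ → ℝ := fun n => x + e n * (a - x)
  let d : ℕ → ℝ := fun n => x + e n * (b - x)
  have hdc : ∀ n, d n - c n = e n * (b - a) := fun n => by simp only [c, d]; ring
  have hcd : ∀ n, c n < d n := fun n => by
    have := hdc n; have := mul_pos (he0 n) hpos; linarith
  have hc : ∀ n, a ≤ c n := fun n => by
    simp only [c]; nlinarith [he1 n, hx.1]
  have hd : ∀ n, d n ≤ b := fun n => by
    simp only [d]; nlinarith [he1 n, hx.2]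
  have hvn : ∀ n, ContinuousOn v (Set.Icc (c n) (d n)) := fun n =>
    hv.mono (Set.Icc_subset_Icc (hc n) (hd n))
  let m : ℕ → ℝ := fun n => (∫ y in c n..d n, v y) / (d n - c n)
  have hm : ∀ n, (d n - c n) * m n = ∫ y in c n..d n, v y := fun n => by
    simp only [m]; rw [mul_div_cancel₀]; exact (sub_pos.2 (hcd n)).ne'
  have hstep : ∀ n, dist (m n) (m (n + 1)) ≤ (Real.sqrt 2 * Real.sqrt ((b - a) ^ (2 * γ - 1) * A)) * q ^ n := by
    intro n
    have h1 := aux_step γ (by linarith) (c n) (d n) (c (n+1)) (d (n+1)) (hcd n)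
      (by simp only [c]; rw [hes]; nlinarith [he0 n, hx.1])
      (by simp only [d]; rw [hes]; nlinarith [he0 n, hx.2])
      (by rw [hdc, hdc, hes]; ring) v (hvn n) (auxA_mono γ v a b _ _ hi (hc n) (hd n)).1
      (m n) (m (n+1)) (hm n) (hm (n+1))
    have h2 := (auxA_mono γ v a b _ _ hi (hc n) (hd n)).2
    have h3 : (d n - c n) ^ (2 * γ - 1) = (q ^ n) ^ 2 * (b - a) ^ (2 * γ - 1) := by
      rw [hdc, Real.mul_rpow (he0 n).le hpos.le]
      congr 1
      simp only [e, hq]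
      rw [← Real.rpow_natCast, ← Real.rpow_natCast, ← Real.rpow_natCast, ← Real.rpow_mul (by positivity),
        ← Real.rpow_mul (by positivity), ← Real.rpow_mul (by positivity)]
      congr 1; push_cast; ring
    rw [dist_comm, Real.dist_eq]
    apply abs_le_of_sq_le_sq _ (by positivity)
    rw [mul_pow, mul_pow, Real.sq_sqrt (by norm_num), Real.sq_sqrt
      (mul_nonneg (Real.rpow_nonneg hpos.le _) (auxA_nonneg _ _ _ _))]
    rw [h3] at h1
    have : (q ^ n) ^ 2 * (b - a) ^ (2 * γ - 1) * auxA γ v (c n) (d n) ≤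
      (q ^ n) ^ 2 * (b - a) ^ (2 * γ - 1) * A :=
      mul_le_mul_of_nonneg_left h2 (mul_nonneg (sq_nonneg _) (Real.rpow_nonneg hpos.le _))
    nlinarith
  have hlim : Filter.Tendsto m Filter.atTop (nhds (v x)) := by
    have hex : ∀ n, ∃ y ∈ Set.Icc (c n) (d n), v y = m n := by
      intro n
      have := exists_eq_interval_average (f := v) (a := c n) (b := d n) (hcd n).ne
        (by rw [Set.uIcc_of_le (hcd n).le]; exact hvn n)
      obtain ⟨y, hy, hy'⟩ := this
      refine ⟨y, ?_, ?_⟩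
      · rw [Set.uIoo_of_le (hcd n).le] at hy
        exact Set.Ioo_subset_Icc_self hy
      · rw [hy', interval_average_eq, smul_eq_mul]; simp only [m]; ring
    choose y hy hy' using hex
    have het : Filter.Tendsto e Filter.atTop (nhds 0) :=
      tendsto_pow_atTop_nhds_zero_of_lt_one (by norm_num) (by norm_num)
    have hyt : Filter.Tendsto y Filter.atTop (nhds x) := by
      refine tendsto_of_tendsto_of_tendsto_of_le_of_le (g := c) (h := d) ?_ ?_
        (fun n => (hy n).1) (fun n => (hy n).2)
      · simpa using (het.mul_const (a - x)).const_add x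
      · simpa using (het.mul_const (b - x)).const_add x
    have h1 : Filter.Tendsto y Filter.atTop (nhdsWithin x (Set.Icc a b)) :=
      tendsto_nhdsWithin_iff.2 ⟨hyt, Filter.Eventually.of_forall
        (fun n => ⟨(hc n).trans (hy n).1, (hy n).2.trans (hd n)⟩)⟩
    have h2 := (hv x hx).tendsto.comp h1
    exact h2.congr (fun n => hy' n)
  have := dist_le_of_le_geometric_of_tendsto₀ q _ hq1 hstep hlim
  rw [dist_comm, Real.dist_eq] at this
  have hm0 : m 0 = (∫ y in a..b, v y) / (b - a) := by simp [m, c, d, e]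
  rw [hm0] at this
  refine this.trans (le_of_eq (by ring))

/-- singular kernel -/
noncomputable def auxK (β : ℝ) (y : ℝ) : ENNReal := ENNReal.ofReal (1 / |y| ^ (1 + 2 * β))

theorem auxK_meas (β : ℝ) : Measurable (auxK β) := by unfold auxK; fun_prop

theorem auxK_tail (β : ℝ) (hβ : 0 < β) (δ : ℝ) (hδ : 0 < δ) :
    ∫⁻ y in Set.Ici δ, auxK β y = ENNReal.ofReal (δ ^ (-(2 * β)) / (2 * β)) := by
  have e : ∀ y ∈ Set.Ioi δ, auxK β y = ENNReal.ofReal (y ^ (-(1 + 2 * β))) := by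
    intro y hy
    have : 0 < y := hδ.trans hy
    rw [auxK, abs_of_pos this, Real.rpow_neg this.le, one_div]
  rw [setLIntegral_congr Ioi_ae_eq_Ici.symm, setLIntegral_congr_fun measurableSet_Ioi e,
    ← ofReal_integral_eq_lintegral_ofReal, integral_Ioi_rpow_of_lt (by linarith) hδ]
  · congr 1
    rw [show -(1 + 2 * β) + 1 = -(2 * β) by ring, neg_div_neg_eq]
  · exact integrableOn_Ioi_rpow_of_lt (by linarith) hδ
  · filter_upwards [self_mem_ae_restrict measurableSet_Ioi] with y hy
    exact Real.rpow_nonneg (hδ.trans hy).le _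

theorem auxK_inner (β : ℝ) (hβ : 0 < β) (a b s : ℝ) (hs : s ∈ Set.Ioo a b) :
    ∫⁻ u in (Set.Ioo a b)ᶜ, auxK β (s - u) ≤
      ENNReal.ofReal ((s - a) ^ (-(2 * β)) / (2 * β)) +
      ENNReal.ofReal ((b - s) ^ (-(2 * β)) / (2 * β)) := by
  have hc : (Set.Ioo a b)ᶜ = Set.Iic a ∪ Set.Ici b := by
    ext x; simp only [Set.mem_compl_iff, Set.mem_Ioo, Set.mem_union, Set.mem_Iic, Set.mem_Ici,
      not_and_or, not_lt]
  rw [hc]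
  refine (lintegral_union_le _ _ _).trans ?_
  refine add_le_add (le_of_eq ?_) (le_of_eq ?_)
  · rw [← auxK_tail β hβ (s - a) (sub_pos.2 hs.1), ← lintegral_indicator measurableSet_Iic,
      ← lintegral_indicator measurableSet_Ici, eq_comm, ← lintegral_sub_left_eq_self _ s]
    congr 1; ext u
    simp only [Set.indicator, Set.mem_Iic, Set.mem_Ici, sub_le_sub_iff_left]
  · rw [← auxK_tail β hβ (b - s) (sub_pos.2 hs.2), ← lintegral_indicator measurableSet_Ici,
      ← lintegral_indicator measurableSet_Ici, eq_comm, ← lintegral_sub_right_eq_self _ s]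
    congr 1; ext u
    simp only [Set.indicator, Set.mem_Ici, sub_le_sub_iff_right]
    simp only [auxK, abs_sub_comm]

theorem auxK_near (β : ℝ) (hβ : 0 < β) (hβ2 : β < 1 / 2) (h : ℝ) (hh : 0 < h) :
    ∫⁻ y in Set.Ioo 0 h, ENNReal.ofReal (y ^ (-(2 * β)) / (2 * β)) =
      ENNReal.ofReal (h ^ (1 - 2 * β) / (2 * β * (1 - 2 * β))) := by
  have hi : IntervalIntegrable (fun x : ℝ => x ^ (-(2 * β)) / (2 * β)) volume 0 h :=
    (intervalIntegral.intervalIntegrable_rpow' (by linarith)).div_const _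
  rw [intervalIntegrable_iff_integrableOn_Ioo_of_le hh.le] at hi
  rw [← ofReal_integral_eq_lintegral_ofReal hi]
  · rw [← integral_Ioc_eq_integral_Ioo, ← intervalIntegral.integral_of_le hh.le,
      intervalIntegral.integral_div, integral_rpow (Or.inl (by linarith))]
    rw [show -(2 * β) + 1 = 1 - 2 * β by ring, Real.zero_rpow (by linarith), sub_zero, div_div,
      mul_comm (1 - 2 * β)]
  · filter_upwards [self_mem_ae_restrict measurableSet_Ioo] with y hy
    have := Real.rpow_nonneg hy.1.le (-(2 * β))
    exact div_nonneg this (by linarith)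

theorem auxK_double (β : ℝ) (hβ : 0 < β) (hβ2 : β < 1 / 2) (a b : ℝ) (hab : a < b) :
    ∫⁻ p in Set.Ioo a b ×ˢ (Set.Ioo a b)ᶜ, auxK β (p.1 - p.2) ≤
      ENNReal.ofReal (1 / (β * (1 - 2 * β)) * (b - a) ^ (1 - 2 * β)) := by
  have hm : Measurable (fun p : ℝ × ℝ => auxK β (p.1 - p.2)) :=
    (auxK_meas β).comp (measurable_fst.sub measurable_snd)
  rw [Measure.volume_eq_prod, ← Measure.prod_restrict, lintegral_prod _ hm.aemeasurable]
  simp only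
  have hpos : 0 < b - a := sub_pos.2 hab
  calc ∫⁻ s in Set.Ioo a b, ∫⁻ u in (Set.Ioo a b)ᶜ, auxK β (s - u)
      ≤ ∫⁻ s in Set.Ioo a b, (ENNReal.ofReal ((s - a) ^ (-(2 * β)) / (2 * β)) +
        ENNReal.ofReal ((b - s) ^ (-(2 * β)) / (2 * β))) := by
        refine setLIntegral_mono' measurableSet_Ioo (fun s hs => auxK_inner β hβ a b s hs)
    _ = ENNReal.ofReal ((b - a) ^ (1 - 2 * β) / (2 * β * (1 - 2 * β))) +
        ENNReal.ofReal ((b - a) ^ (1 - 2 * β) / (2 * β * (1 - 2 * β))) := by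
        rw [lintegral_add_left (by fun_prop)]
        congr 1
        · rw [← auxK_near β hβ hβ2 _ hpos, ← lintegral_indicator measurableSet_Ioo,
            ← lintegral_indicator measurableSet_Ioo, eq_comm, ← lintegral_sub_right_eq_self _ a]
          congr 1; ext u
          simp only [Set.indicator, Set.mem_Ioo, sub_lt_sub_iff_right, sub_pos]
        · rw [← auxK_near β hβ hβ2 _ hpos, ← lintegral_indicator measurableSet_Ioo,
            ← lintegral_indicator measurableSet_Ioo, eq_comm, ← lintegral_sub_left_eq_self _ b]
          congr 1; ext u
          simp only [Set.indicator, Set.mem_Ioo, sub_lt_sub_iff_left, sub_pos, and_comm]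
    _ ≤ _ := by
        have h2 : 0 < 1 - 2 * β := by linarith
        rw [← ENNReal.ofReal_add (by positivity) (by positivity)]
        apply ENNReal.ofReal_le_ofReal
        apply le_of_eq
        field_simp
        ring

theorem auxK_double' (β : ℝ) (hβ : 0 < β) (hβ2 : β < 1 / 2) (a b : ℝ) (hab : a < b) :
    ∫⁻ p in (Set.Ioo a b)ᶜ ×ˢ Set.Ioo a b, auxK β (p.1 - p.2) ≤
      ENNReal.ofReal (1 / (β * (1 - 2 * β)) * (b - a) ^ (1 - 2 * β)) := by
  refine le_trans (le_of_eq ?_) (auxK_double β hβ hβ2 a b hab)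
  have hm : Measurable (fun p : ℝ × ℝ => auxK β (p.1 - p.2)) :=
    (auxK_meas β).comp (measurable_fst.sub measurable_snd)
  rw [Measure.volume_eq_prod, ← Measure.prod_restrict, ← Measure.prod_restrict,
    lintegral_prod _ hm.aemeasurable, lintegral_prod_symm _ hm.aemeasurable]
  simp only [auxK, abs_sub_comm]

/-- indices: the point lies in an open cell unless it is a node or outside -/
theorem aux_cell (J : ℕ) (t : ℕ → ℝ) (s : ℝ) (h0 : t 0 < s) (hJ : s < t J)
    (hn : ∀ i ≤ J, s ≠ t i) : ∃ i < J, s ∈ Set.Ioo (t i) (t (i + 1)) := by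
  induction J with
  | zero => exact absurd (h0.trans hJ) (lt_irrefl _)
  | succ k ih =>
    rcases lt_or_gt_of_ne (hn k (by omega)) with h | h
    · obtain ⟨i, hi, hs⟩ := ih h (fun i hi => hn i (by omega))
      exact ⟨i, by omega, hs⟩
    · exact ⟨k, by omega, h, hJ⟩

theorem aux_core (β γ : ℝ) (hβ0 : 0 < β) (hβ : β < 1 / 2) (hγ1 : 1 / 2 < γ) :
    ∃ C : ℝ, 0 < C ∧ ∀ (T : ℝ) (J : ℕ) (t : ℕ → ℝ) (τ : ℝ) (v g : ℝ → ℝ), Measurable v → 0 < τ →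
      t 0 = 0 → t J = T → (∀ i < J, t i < t (i + 1)) →
      (∀ i < J, t (i + 1) - t i ≤ τ) →
      ContinuousOn v (Set.Icc 0 T) → auxInt γ v 0 T →
      (∀ s, s ∉ Set.Ioo (0 : ℝ) T → g s = 0) →
      (∀ i < J, ∀ s ∈ Set.Ioo (t i) (t (i + 1)), g s = v s - v (t (i + 1))) →
      ∫⁻ s, ∫⁻ u, ENNReal.ofReal ((g s - g u) ^ 2 / |s - u| ^ (1 + 2 * β)) ≤
        ENNReal.ofReal (C * τ ^ (2 * (γ - β)) * auxA γ v 0 T) := by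
  obtain ⟨D, hD, hmor⟩ := aux_morrey γ hγ1
  set c : ℝ := 1 / (β * (1 - 2 * β)) with hc
  have hcpos : 0 < c := by
    have : 0 < 1 - 2 * β := by linarith
    positivity
  refine ⟨1 + 16 * D ^ 2 * c, by positivity, ?_⟩
  intro T J t τ v g hvm hτ h0 hJ hmono hstep hv hi hg0 hg
  have htm : ∀ j ≤ J, ∀ i ≤ j, t i ≤ t j := by
    intro j hj
    induction j with
    | zero => intro i hi; rw [Nat.le_zero.1 hi]
    | succ k ih =>
      intro i hi
      rcases Nat.lt_or_ge k i with h | h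
      · rw [show i = k + 1 by omega]
      · exact (ih (by omega) i h).trans (hmono k (by omega)).le
  have ht0 : ∀ i ≤ J, 0 ≤ t i := fun i hi => h0 ▸ htm i hi 0 (Nat.zero_le _)
  have htT : ∀ i ≤ J, t i ≤ T := fun i hi => hJ ▸ htm J le_rfl i hi
  let I : ℕ → Set ℝ := fun i => Set.Ioo (t i) (t (i + 1))
  have hIm : ∀ i, MeasurableSet (I i) := fun i => measurableSet_Ioo
  let A : ℕ → ℝ := fun i => auxA γ v (t i) (t (i + 1))
  let h : ℕ → ℝ := fun i => t (i + 1) - t i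
  have hA0 : ∀ i, 0 ≤ A i := fun i => auxA_nonneg _ _ _ _
  let M : ℕ → ℝ := fun i => 4 * D ^ 2 * (h i ^ (2 * γ - 1) * A i)
  have hcellI : ∀ i < J, auxInt γ v (t i) (t (i + 1)) := fun i hiJ =>
    (auxA_mono γ v 0 T _ _ hi (ht0 i (by omega)) (htT (i + 1) (by omega))).1
  have hgM : ∀ i < J, ∀ s ∈ I i, g s ^ 2 ≤ M i := by
    intro i hiJ s hs
    have hlt := hmono i hiJ
    have hh : 0 < h i := sub_pos.2 hlt
    have hvi : ContinuousOn v (Set.Icc (t i) (t (i + 1))) :=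
      hv.mono (Set.Icc_subset_Icc (ht0 i (by omega)) (htT (i + 1) (by omega)))
    have h1 := hmor _ _ v hlt hvi (hcellI i hiJ) s (Set.Ioo_subset_Icc_self hs)
    have h2 := hmor _ _ v hlt hvi (hcellI i hiJ) (t (i + 1)) (Set.right_mem_Icc.2 hlt.le)
    rw [hg i hiJ s hs]
    set m := (∫ y in t i..t (i + 1), v y) / (t (i + 1) - t i)
    have h3 : |v s - v (t (i + 1))| ≤ 2 * D * Real.sqrt (h i ^ (2 * γ - 1) * A i) := by
      have := abs_sub_le (v s) m (v (t (i + 1)))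
      rw [abs_sub_comm m] at this
      simp only [h, A]
      linarith
    have h4 : (v s - v (t (i + 1))) ^ 2 ≤ (2 * D * Real.sqrt (h i ^ (2 * γ - 1) * A i)) ^ 2 := by
      rw [← sq_abs]
      exact pow_le_pow_left₀ (abs_nonneg _) h3 2
    refine h4.trans (le_of_eq ?_)
    rw [mul_pow, mul_pow, Real.sq_sqrt (mul_nonneg (Real.rpow_nonneg hh.le _) (hA0 i))]
    simp only [M]; ring
  have hM0 : ∀ i < J, 0 ≤ M i := fun i hiJ => by
    have : 0 ≤ h i := (sub_pos.2 (hmono i hiJ)).le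
    have := mul_nonneg (Real.rpow_nonneg this (2 * γ - 1)) (hA0 i)
    simp only [M]; positivity
  let φ : ℝ × ℝ → ENNReal := fun p =>
    ENNReal.ofReal ((v p.1 - v p.2) ^ 2 / |p.1 - p.2| ^ (1 + 2 * γ))
  let k : ℝ × ℝ → ENNReal := fun p => auxK β (p.1 - p.2)
  have hφm : Measurable φ := by
    have h1 : Measurable (fun p : ℝ × ℝ => v p.1) := hvm.comp measurable_fst
    have h2 : Measurable (fun p : ℝ × ℝ => v p.2) := hvm.comp measurable_snd
    simp only [φ]; fun_prop
  have hkm : Measurable k := (auxK_meas β).comp (measurable_fst.sub measurable_snd)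
  let τ' : ENNReal := ENNReal.ofReal (τ ^ (2 * (γ - β)))
  let H1 : ℕ → ℝ × ℝ → ENNReal := fun i => (I i ×ˢ I i).indicator (fun p => τ' * φ p)
  let H2 : ℕ → ℝ × ℝ → ENNReal := fun i =>
    (I i ×ˢ (I i)ᶜ).indicator (fun p => ENNReal.ofReal (2 * M i) * k p)
  let H3 : ℕ → ℝ × ℝ → ENNReal := fun i =>
    ((I i)ᶜ ×ˢ I i).indicator (fun p => ENNReal.ofReal (2 * M i) * k p)
  have hH1m : ∀ i, Measurable (H1 i) := fun i =>
    (hφm.const_mul _).indicator ((hIm i).prod (hIm i))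
  have hH2m : ∀ i, Measurable (H2 i) := fun i =>
    (hkm.const_mul _).indicator ((hIm i).prod (hIm i).compl)
  have hH3m : ∀ i, Measurable (H3 i) := fun i =>
    (hkm.const_mul _).indicator ((hIm i).compl.prod (hIm i))
  let H : ℝ × ℝ → ENNReal := fun p =>
    ∑ i ∈ Finset.range J, H1 i p + (∑ i ∈ Finset.range J, H2 i p + ∑ i ∈ Finset.range J, H3 i p)
  have hS1m : Measurable (fun p => ∑ i ∈ Finset.range J, H1 i p) :=
    Finset.measurable_fun_sum _ (fun i _ => hH1m i)
  have hS2m : Measurable (fun p => ∑ i ∈ Finset.range J, H2 i p) :=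
    Finset.measurable_fun_sum _ (fun i _ => hH2m i)
  have hS3m : Measurable (fun p => ∑ i ∈ Finset.range J, H3 i p) :=
    Finset.measurable_fun_sum _ (fun i _ => hH3m i)
  have hHm : Measurable H := hS1m.add (hS2m.add hS3m)
  -- pointwise bound
  let N : Set ℝ := t '' (Set.Iic J)
  have hN : ∀ᵐ s : ℝ, s ∉ N := by
    rw [ae_iff]
    simp only [not_not]
    exact ((Set.finite_Iic J).image t).measure_zero _
  have hcase : ∀ s ∉ N, (∃ i < J, s ∈ I i) ∨ g s = 0 := by
    intro s hs
    by_cases hsT : s ∈ Set.Ioo 0 T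
    · left
      exact aux_cell J t s (h0 ▸ hsT.1) (hJ ▸ hsT.2) (fun i hi e => hs ⟨i, hi, e.symm⟩)
    · exact Or.inr (hg0 s hsT)
  have hpt : ∀ s ∉ N, ∀ u ∉ N,
      ENNReal.ofReal ((g s - g u) ^ 2 / |s - u| ^ (1 + 2 * β)) ≤ H (s, u) := by
    intro s hs u hu
    by_cases hsame : ∃ i < J, s ∈ I i ∧ u ∈ I i
    · obtain ⟨i, hiJ, hsi, hui⟩ := hsame
      have hle : H1 i (s, u) ≤ H (s, u) :=
        (Finset.single_le_sum (f := fun i => H1 i (s, u)) (fun _ _ => zero_le)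
          (Finset.mem_range.2 hiJ)).trans le_self_add
      refine le_trans ?_ hle
      simp only [H1, Set.indicator_of_mem (Set.mk_mem_prod hsi hui), τ', φ]
      rw [← ENNReal.ofReal_mul (by positivity)]
      apply ENNReal.ofReal_le_ofReal
      rw [hg i hiJ s hsi, hg i hiJ u hui]
      rw [show v s - v (t (i + 1)) - (v u - v (t (i + 1))) = v s - v u by ring]
      by_cases e : s = u
      · simp [e]
      have hp : 0 < |s - u| := abs_pos.2 (sub_ne_zero.2 e)
      have hle : |s - u| ≤ τ := by
        refine le_trans ?_ (hstep i hiJ)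
        have := hsi.1; have := hsi.2; have := hui.1; have := hui.2
        rw [abs_le]; constructor <;> linarith
      have h1 : |s - u| ^ (1 + 2 * γ) = |s - u| ^ (1 + 2 * β) * |s - u| ^ (2 * (γ - β)) := by
        rw [← Real.rpow_add hp]; congr 1; ring
      have h2 : |s - u| ^ (2 * (γ - β)) ≤ τ ^ (2 * (γ - β)) :=
        Real.rpow_le_rpow hp.le hle (by linarith)
      have hp1 : 0 < |s - u| ^ (1 + 2 * β) := Real.rpow_pos_of_pos hp _
      have hp2 : 0 < |s - u| ^ (2 * (γ - β)) := Real.rpow_pos_of_pos hp _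
      rw [h1, ← mul_div_assoc, div_le_div_iff₀ hp1 (by positivity)]
      have := mul_le_mul_of_nonneg_left h2 (mul_nonneg (sq_nonneg (v s - v u)) hp1.le)
      linarith
    · have hz : 0 ≤ 1 / |s - u| ^ (1 + 2 * β) := by positivity
      have hb : (g s - g u) ^ 2 / |s - u| ^ (1 + 2 * β) ≤
          2 * g s ^ 2 * (1 / |s - u| ^ (1 + 2 * β)) + 2 * g u ^ 2 * (1 / |s - u| ^ (1 + 2 * β)) := by
        rw [← add_mul, div_eq_mul_one_div]
        apply mul_le_mul_of_nonneg_right _ hz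
        nlinarith [sq_nonneg (g s + g u)]
      refine (ENNReal.ofReal_le_ofReal hb).trans ?_
      rw [ENNReal.ofReal_add (by positivity) (by positivity)]
      refine le_trans ?_ (le_add_self (a := _) (b := ∑ i ∈ Finset.range J, H1 i (s, u)))
      refine add_le_add ?_ ?_
      · rcases hcase s hs with ⟨i, hiJ, hsi⟩ | hgs
        · refine le_trans ?_ (Finset.single_le_sum (f := fun i => H2 i (s, u))
            (fun _ _ => zero_le) (Finset.mem_range.2 hiJ))
          have hui : u ∈ (I i)ᶜ := fun hui => hsame ⟨i, hiJ, hsi, hui⟩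
          simp only [H2, Set.indicator_of_mem (Set.mk_mem_prod hsi hui), k, auxK]
          rw [← ENNReal.ofReal_mul (by have := hM0 i hiJ; positivity)]
          apply ENNReal.ofReal_le_ofReal
          apply mul_le_mul_of_nonneg_right _ hz
          linarith [hgM i hiJ s hsi]
        · simp [hgs]
      · rcases hcase u hu with ⟨i, hiJ, hui⟩ | hgs
        · refine le_trans ?_ (Finset.single_le_sum (f := fun i => H3 i (s, u))
            (fun _ _ => zero_le) (Finset.mem_range.2 hiJ))
          have hsi : s ∈ (I i)ᶜ := fun hsi => hsame ⟨i, hiJ, hsi, hui⟩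
          simp only [H3, Set.indicator_of_mem (Set.mk_mem_prod hsi hui), k, auxK]
          rw [← ENNReal.ofReal_mul (by have := hM0 i hiJ; positivity)]
          apply ENNReal.ofReal_le_ofReal
          apply mul_le_mul_of_nonneg_right _ hz
          linarith [hgM i hiJ u hui]
        · simp [hgs]
  -- energies
  have hφA : ∀ a b, auxInt γ v a b →
      ∫⁻ p in Set.Ioo a b ×ˢ Set.Ioo a b, φ p = ENNReal.ofReal (auxA γ v a b) := by
    intro a b hab
    exact (ofReal_integral_eq_lintegral_ofReal hab
      (Filter.Eventually.of_forall (fun p => aux_phi_nonneg γ v p))).symm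
  have hsumA : ∑ i ∈ Finset.range J, A i ≤ auxA γ v 0 T := by
    have hsub : (⋃ i ∈ Finset.range J, I i ×ˢ I i) ⊆ Set.Ioo 0 T ×ˢ Set.Ioo 0 T := by
      refine Set.iUnion₂_subset (fun i hi' => ?_)
      have hiJ := Finset.mem_range.1 hi'
      exact Set.prod_mono (Set.Ioo_subset_Ioo (ht0 i (by omega)) (htT (i + 1) (by omega)))
        (Set.Ioo_subset_Ioo (ht0 i (by omega)) (htT (i + 1) (by omega)))
    have hdis : Set.PairwiseDisjoint (↑(Finset.range J)) (fun i => I i ×ˢ I i) := by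
      have key : ∀ i j, j < J → i < j → ∀ x, x ∈ I i → x ∈ I j → False := by
        intro i j hj hij x hx hy
        have h1 := hx.2
        have h2 := hy.1
        have h3 := htm j (by omega) (i + 1) (by omega)
        linarith
      intro i hi' j hj' hne
      have hiJ := Finset.mem_range.1 (Finset.mem_coe.1 hi')
      have hjJ := Finset.mem_range.1 (Finset.mem_coe.1 hj')
      refine Set.disjoint_left.2 (fun p hp hq => ?_)
      rcases lt_or_gt_of_ne hne with hl | hl
      · exact key i j hjJ hl p.1 hp.1 hq.1
      · exact key j i hiJ hl p.1 hq.1 hp.1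
    have h1 := lintegral_mono_set (μ := volume) (f := φ) hsub
    rw [lintegral_biUnion_finset hdis (fun i _ => (hIm i).prod (hIm i)), hφA 0 T hi] at h1
    have h2 : ∑ i ∈ Finset.range J, ∫⁻ p in I i ×ˢ I i, φ p
        = ENNReal.ofReal (∑ i ∈ Finset.range J, A i) := by
      rw [ENNReal.ofReal_sum_of_nonneg (fun i _ => hA0 i)]
      exact Finset.sum_congr rfl (fun i hi' => hφA _ _ (hcellI i (Finset.mem_range.1 hi')))
    rw [h2] at h1
    exact (ENNReal.ofReal_le_ofReal_iff (auxA_nonneg _ _ _ _)).1 h1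
  have hI1 : ∀ i ∈ Finset.range J, ∫⁻ p, H1 i p ≤ ENNReal.ofReal (τ ^ (2 * (γ - β)) * A i) := by
    intro i hi'
    have hiJ := Finset.mem_range.1 hi'
    simp only [H1]
    rw [lintegral_indicator ((hIm i).prod (hIm i)), lintegral_const_mul _ hφm,
      hφA _ _ (hcellI i hiJ), ← ENNReal.ofReal_mul (by positivity)]
  have hreal : ∀ i < J, 2 * M i * (c * h i ^ (1 - 2 * β)) ≤
      8 * D ^ 2 * c * (τ ^ (2 * (γ - β)) * A i) := by
    intro i hiJ
    have hh : 0 < h i := sub_pos.2 (hmono i hiJ)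
    have h1 : h i ^ (2 * γ - 1) * h i ^ (1 - 2 * β) = h i ^ (2 * (γ - β)) := by
      rw [← Real.rpow_add hh]; congr 1; ring
    have h2 : h i ^ (2 * (γ - β)) ≤ τ ^ (2 * (γ - β)) :=
      Real.rpow_le_rpow hh.le (hstep i hiJ) (by linarith)
    calc 2 * M i * (c * h i ^ (1 - 2 * β))
        = 8 * D ^ 2 * c * (h i ^ (2 * γ - 1) * h i ^ (1 - 2 * β) * A i) := by
          simp only [M]; ring
      _ ≤ _ := by
          rw [h1]
          exact mul_le_mul_of_nonneg_left (mul_le_mul_of_nonneg_right h2 (hA0 i)) (by positivity)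
  have hI2 : ∀ i ∈ Finset.range J, ∫⁻ p, H2 i p ≤
      ENNReal.ofReal (8 * D ^ 2 * c * (τ ^ (2 * (γ - β)) * A i)) := by
    intro i hi'
    have hiJ := Finset.mem_range.1 hi'
    simp only [H2]
    rw [lintegral_indicator ((hIm i).prod (hIm i).compl), lintegral_const_mul _ hkm]
    refine (mul_le_mul_right (auxK_double β hβ0 hβ _ _ (hmono i hiJ)) _).trans ?_
    rw [← ENNReal.ofReal_mul (by have := hM0 i hiJ; positivity)]
    exact ENNReal.ofReal_le_ofReal (hreal i hiJ)
  have hI3 : ∀ i ∈ Finset.range J, ∫⁻ p, H3 i p ≤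
      ENNReal.ofReal (8 * D ^ 2 * c * (τ ^ (2 * (γ - β)) * A i)) := by
    intro i hi'
    have hiJ := Finset.mem_range.1 hi'
    simp only [H3]
    rw [lintegral_indicator ((hIm i).compl.prod (hIm i)), lintegral_const_mul _ hkm]
    refine (mul_le_mul_right (auxK_double' β hβ0 hβ _ _ (hmono i hiJ)) _).trans ?_
    rw [← ENNReal.ofReal_mul (by have := hM0 i hiJ; positivity)]
    exact ENNReal.ofReal_le_ofReal (hreal i hiJ)
  have hτA : ∀ i, 0 ≤ τ ^ (2 * (γ - β)) * A i := fun i => mul_nonneg (by positivity) (hA0 i)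
  have hτA' : ∀ i, 0 ≤ 8 * D ^ 2 * c * (τ ^ (2 * (γ - β)) * A i) := fun i =>
    mul_nonneg (by positivity) (hτA i)
  calc ∫⁻ s, ∫⁻ u, ENNReal.ofReal ((g s - g u) ^ 2 / |s - u| ^ (1 + 2 * β))
      ≤ ∫⁻ s, ∫⁻ u, H (s, u) := by
        refine lintegral_mono_ae ?_
        filter_upwards [hN] with s hs
        refine lintegral_mono_ae ?_
        filter_upwards [hN] with u hu
        exact hpt s hs u hu
    _ = ∫⁻ p, H p := by
        rw [Measure.volume_eq_prod, lintegral_prod _ hHm.aemeasurable]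
    _ = (∑ i ∈ Finset.range J, ∫⁻ p, H1 i p) + ((∑ i ∈ Finset.range J, ∫⁻ p, H2 i p) +
          (∑ i ∈ Finset.range J, ∫⁻ p, H3 i p)) := by
        simp only [H]
        rw [lintegral_add_left hS1m, lintegral_add_left hS2m,
          lintegral_finsetSum _ (fun i _ => hH1m i), lintegral_finsetSum _ (fun i _ => hH2m i),
          lintegral_finsetSum _ (fun i _ => hH3m i)]
    _ ≤ ∑ i ∈ Finset.range J, ENNReal.ofReal (τ ^ (2 * (γ - β)) * A i) +
          (∑ i ∈ Finset.range J, ENNReal.ofReal (8 * D ^ 2 * c * (τ ^ (2 * (γ - β)) * A i)) +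
          ∑ i ∈ Finset.range J, ENNReal.ofReal (8 * D ^ 2 * c * (τ ^ (2 * (γ - β)) * A i))) :=
        add_le_add (Finset.sum_le_sum hI1) (add_le_add (Finset.sum_le_sum hI2)
          (Finset.sum_le_sum hI3))
    _ = ENNReal.ofReal ((1 + 16 * D ^ 2 * c) * τ ^ (2 * (γ - β)) *
          ∑ i ∈ Finset.range J, A i) := by
        rw [← ENNReal.ofReal_sum_of_nonneg (fun i _ => hτA i),
          ← ENNReal.ofReal_sum_of_nonneg (fun i _ => hτA' i),
          ← ENNReal.ofReal_add (Finset.sum_nonneg (fun i _ => hτA' i))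
            (Finset.sum_nonneg (fun i _ => hτA' i)),
          ← ENNReal.ofReal_add (Finset.sum_nonneg (fun i _ => hτA i))
            (add_nonneg (Finset.sum_nonneg (fun i _ => hτA' i))
            (Finset.sum_nonneg (fun i _ => hτA' i)))]
        congr 1
        simp only [← Finset.mul_sum]
        ring
    _ ≤ _ := by
        apply ENNReal.ofReal_le_ofReal
        exact mul_le_mul_of_nonneg_left hsumA (by positivity)

theorem stmt_8 (β γ T : ℝ) (hβ0 : 0 < β) (hβ : β < 1 / 2) (hγ1 : 1 / 2 < γ)
    (hγ2 : γ < 1) (hT : 0 < T) :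
    ∃ C : ℝ, 0 < C ∧ ∀ (J : ℕ) (t : ℕ → ℝ) (τ : ℝ) (v g : ℝ → ℝ),
      1 ≤ J → t 0 = 0 → t J = T → (∀ i < J, t i < t (i + 1)) →
      IsGreatest {d : ℝ | ∃ j, 1 ≤ j ∧ j ≤ J ∧ d = t j - t (j - 1)} τ →
      ContinuousOn v (Set.Icc 0 T) →
      IntegrableOn (fun p : ℝ × ℝ => (v p.1 - v p.2) ^ 2 / |p.1 - p.2| ^ (1 + 2 * γ))
        (Set.Ioo 0 T ×ˢ Set.Ioo 0 T) →
      (∀ s, s ∉ Set.Ioo (0 : ℝ) T → g s = 0) →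
      (∀ j, 1 ≤ j → j ≤ J → ∀ s ∈ Set.Ioc (t (j - 1)) (t j),
        s ∈ Set.Ioo (0 : ℝ) T → g s = v s - v (t j)) →
      Real.sqrt (∫ s : ℝ, ∫ u : ℝ, (g s - g u) ^ 2 / |s - u| ^ (1 + 2 * β)) ≤
        C * τ ^ (γ - β) * sobNormT T γ v := by
  obtain ⟨C, hC, hcore⟩ := aux_core β γ hβ0 hβ hγ1
  refine ⟨Real.sqrt C, Real.sqrt_pos.2 hC, ?_⟩
  intro J t τ v g hJ1 h0 hJ hmono hτ hv hi hg0 hg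
  have hstep : ∀ i < J, t (i + 1) - t i ≤ τ := fun i hiJ =>
    hτ.2 ⟨i + 1, by omega, by omega, by simp⟩
  have hτ0 : 0 < τ := by
    have := hstep 0 (by omega)
    have := hmono 0 (by omega)
    linarith
  have htm : ∀ j ≤ J, ∀ i ≤ j, t i ≤ t j := by
    intro j hj
    induction j with
    | zero => intro i hi; rw [Nat.le_zero.1 hi]
    | succ k ih =>
      intro i hi
      rcases Nat.lt_or_ge k i with h | h
      · rw [show i = k + 1 by omega]
      · exact (ih (by omega) i h).trans (hmono k (by omega)).le
  have ht0 : ∀ i ≤ J, 0 ≤ t i := fun i hi => h0 ▸ htm i hi 0 (Nat.zero_le _)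
  have htT : ∀ i ≤ J, t i ≤ T := fun i hi => hJ ▸ htm J le_rfl i hi
  -- measurable replacement of `v`
  classical
  let w : ℝ → ℝ := (Set.Icc 0 T).indicator v
  have hw : ∀ x ∈ Set.Icc 0 T, w x = v x := fun x hx => Set.indicator_of_mem hx v
  have hwm : Measurable w := by
    have := hv.measurable_piecewise (g := fun _ => (0 : ℝ)) continuousOn_const
      (measurableSet_Icc (a := (0 : ℝ)) (b := T))
    show Measurable ((Set.Icc 0 T).indicator v)
    rw [← Set.piecewise_eq_indicator]
    exact this
  have hwc : ContinuousOn w (Set.Icc 0 T) := hv.congr hw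
  have hwphi : ∀ p ∈ Set.Ioo 0 T ×ˢ Set.Ioo 0 T,
      (w p.1 - w p.2) ^ 2 / |p.1 - p.2| ^ (1 + 2 * γ) =
      (v p.1 - v p.2) ^ 2 / |p.1 - p.2| ^ (1 + 2 * γ) := by
    intro p hp
    rw [hw _ (Set.Ioo_subset_Icc_self hp.1), hw _ (Set.Ioo_subset_Icc_self hp.2)]
  have hms : MeasurableSet (Set.Ioo 0 T ×ˢ Set.Ioo 0 T) := measurableSet_Ioo.prod measurableSet_Ioo
  have hwi : auxInt γ w 0 T := hi.congr_fun (fun p hp => (hwphi p hp).symm) hms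
  have hA : auxA γ w 0 T = auxA γ v 0 T := setIntegral_congr_fun hms hwphi
  have hmain := hcore T J t τ w g hwm hτ0 h0 hJ hmono hstep hwc hwi hg0 (by
    intro i hiJ s hs
    have h1 := ht0 i (by omega)
    have h2 := htT (i + 1) (by omega)
    have hs0 : s ∈ Set.Ioo 0 T := ⟨lt_of_le_of_lt h1 hs.1, lt_of_lt_of_le hs.2 h2⟩
    rw [hw s (Set.Ioo_subset_Icc_self hs0), hw _ ⟨ht0 _ (by omega), h2⟩]
    exact hg (i + 1) (by omega) (by omega) s ⟨by simpa using hs.1, hs.2.le⟩ hs0)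
  rw [hA] at hmain
  have hnn : ∀ s u : ℝ, 0 ≤ (g s - g u) ^ 2 / |s - u| ^ (1 + 2 * β) := fun s u => by positivity
  have hle : ∫ s : ℝ, ∫ u : ℝ, (g s - g u) ^ 2 / |s - u| ^ (1 + 2 * β) ≤
      C * τ ^ (2 * (γ - β)) * auxA γ v 0 T := by
    have h1 : ENNReal.ofReal (∫ s : ℝ, ∫ u : ℝ, (g s - g u) ^ 2 / |s - u| ^ (1 + 2 * β)) ≤
        ENNReal.ofReal (C * τ ^ (2 * (γ - β)) * auxA γ v 0 T) := by
      refine le_trans ?_ hmain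
      rw [← Real.enorm_of_nonneg (integral_nonneg (fun s => integral_nonneg (hnn s)))]
      refine (enorm_integral_le_lintegral_enorm _).trans (lintegral_mono (fun s => ?_))
      refine (enorm_integral_le_lintegral_enorm _).trans (lintegral_mono (fun u => ?_))
      exact (Real.enorm_of_nonneg (hnn s u)).le
    exact (ENNReal.ofReal_le_ofReal_iff (mul_nonneg (by positivity) (auxA_nonneg _ _ _ _))).1 h1
  have hsob : Real.sqrt (auxA γ v 0 T) ≤ sobNormT T γ v := by
    have h1 : gagliardoSemiT T γ v = Real.sqrt (auxA γ v 0 T) := by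
      unfold gagliardoSemiT auxA
      rw [Measure.volume_eq_prod, setIntegral_prod _ hi]
    unfold sobNormT
    rw [h1, Real.sq_sqrt (auxA_nonneg _ _ _ _)]
    apply Real.sqrt_le_sqrt
    have : 0 ≤ ∫ t in Set.Ioo (0 : ℝ) T, (v t) ^ 2 := integral_nonneg (fun t => sq_nonneg _)
    linarith
  calc Real.sqrt (∫ s : ℝ, ∫ u : ℝ, (g s - g u) ^ 2 / |s - u| ^ (1 + 2 * β))
      ≤ Real.sqrt (C * τ ^ (2 * (γ - β)) * auxA γ v 0 T) := Real.sqrt_le_sqrt hle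
    _ = Real.sqrt C * τ ^ (γ - β) * Real.sqrt (auxA γ v 0 T) := by
        rw [Real.sqrt_mul (by positivity), Real.sqrt_mul hC.le]
        congr 2
        rw [show 2 * (γ - β) = (γ - β) * (2 : ℕ) by push_cast; ring, Real.rpow_mul_natCast hτ0.le,
          Real.sqrt_sq (by positivity)]
    _ ≤ _ := mul_le_mul_of_nonneg_left hsob (by positivity)
end
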